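/- arXiv:1004.2259 — 2 statements merged into one kernel-verified Lean document; each statement's English description precedes it below -/
import Mathlib

section
/- (Interpolated Gagliardo–Nirenberg trace inequality.) Let m,n ≥ 1, let 0 < α_k < n for k = 1,…,m, set α = Σ α_k, assume 0 < mn − α < n, let 2 ≤ q < 2n/(mn − α), and set θ = (mn − 2n/q)/α. Then there exists a finite constant D, depending only on n, m, q and α_1,…,α_m, such that for every f ∈ 𝒮(ℝ^{mn}), (∫_{ℝ^n} |f(x,…,x)|^q dx)^{2/q} ≤ D · (∫_{ℝ^{mn}} |f|² dx)^{1−θ} · Λ(f; α_1,…,α_m)^{θ}. -/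
open MeasureTheory Real
open scoped ENNReal InnerProductSpace

noncomputable section

/-- Fourier transform with kernel `e^{2πi x·ξ}` on `(ℝ^n)^m`. -/
def fourierM {m n : ℕ} (f : (Fin m → EuclideanSpace ℝ (Fin n)) → ℂ)
    (ξ : Fin m → EuclideanSpace ℝ (Fin n)) : ℂ :=
  ∫ x, Complex.exp (2 * Real.pi * Complex.I * ((∑ k, ⟪x k, ξ k⟫_ℝ : ℝ) : ℂ)) * f x

/-- The multilinear fractional Dirichlet form
`Λ(f; α_1, …, α_m) = ∫ Π_k |ξ_k|^{α_k} |f̂(ξ)|² dξ`. -/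
def LamM {m n : ℕ} (f : (Fin m → EuclideanSpace ℝ (Fin n)) → ℂ)
    (α : Fin m → ℝ) : ℝ≥0∞ :=
  ∫⁻ ξ, (∏ k, ENNReal.ofReal (‖ξ k‖ ^ α k)) * (‖fourierM f ξ‖₊ : ℝ≥0∞) ^ (2 : ℕ)

open scoped FourierTransform SchwartzMap

/-- Currying preserves Lebesgue measure. -/
lemma measurePreserving_curry_real (m n : ℕ) :
    MeasurePreserving (MeasurableEquiv.curry (Fin m) (Fin n) ℝ) := by
  suffices h : MeasurePreserving (MeasurableEquiv.curry (Fin m) (Fin n) ℝ).symm by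
    simpa using h.symm
  refine ⟨MeasurableEquiv.measurable _, ?_⟩
  refine (Measure.pi_eq fun s hs => ?_).symm
  rw [Measure.map_apply (MeasurableEquiv.measurable _) (MeasurableSet.univ_pi hs)]
  have : (MeasurableEquiv.curry (Fin m) (Fin n) ℝ).symm ⁻¹' Set.univ.pi s =
      Set.univ.pi fun k => Set.univ.pi fun i => s (k, i) := by
    ext g
    simp [Set.mem_pi, MeasurableEquiv.curry, Function.uncurry]
  rw [this, volume_pi_pi]
  simp_rw [volume_pi_pi]
  rw [Fintype.prod_prod_type]

/-- The identification of `ℝ^(m × n)` with `(ℝ^n)^m`. -/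
def blockEquiv (m n : ℕ) :
    EuclideanSpace ℝ (Fin m × Fin n) ≃L[ℝ] (Fin m → EuclideanSpace ℝ (Fin n)) :=
  LinearEquiv.toContinuousLinearEquiv
    { toFun := fun x k => WithLp.toLp 2 fun i => x (k, i)
      invFun := fun y => WithLp.toLp 2 fun p => y p.1 p.2
      map_add' := fun x y => by ext; simp
      map_smul' := fun c x => by ext; simp
      left_inv := fun x => by ext; simp
      right_inv := fun x => by ext; simp }

lemma blockEquiv_apply {m n : ℕ} (x : EuclideanSpace ℝ (Fin m × Fin n)) (k : Fin m)
    (i : Fin n) : blockEquiv m n x k i = x (k, i) := rfl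

lemma measurePreserving_blockEquiv (m n : ℕ) : MeasurePreserving (blockEquiv m n) := by
  have h1 := PiLp.volume_preserving_ofLp (Fin m × Fin n)
  have h2 := measurePreserving_curry_real m n
  have h3 : MeasurePreserving
      (fun (y : Fin m → Fin n → ℝ) (k : Fin m) => WithLp.toLp 2 (y k)) :=
    volume_preserving_pi fun _ => PiLp.volume_preserving_toLp (Fin n)
  exact h3.comp (h2.comp h1)

lemma measurableEmbedding_blockEquiv (m n : ℕ) : MeasurableEmbedding (blockEquiv m n) :=
  (blockEquiv m n).toHomeomorph.measurableEmbedding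

lemma inner_eq_sum_blockEquiv {m n : ℕ} (x y : EuclideanSpace ℝ (Fin m × Fin n)) :
    ⟪x, y⟫_ℝ = ∑ k, ⟪blockEquiv m n x k, blockEquiv m n y k⟫_ℝ := by
  simp only [PiLp.inner_apply, blockEquiv_apply, Fintype.sum_prod_type]

/-- Plancherel's theorem in terms of lower Lebesgue integrals. -/
lemma lintegral_enorm_sq_fourier {V : Type*} [NormedAddCommGroup V] [InnerProductSpace ℝ V]
    [FiniteDimensional ℝ V] [MeasurableSpace V] [BorelSpace V] (f : 𝓢(V, ℂ)) :
    ∫⁻ ξ, ‖𝓕 f ξ‖ₑ ^ 2 = ∫⁻ x, ‖f x‖ₑ ^ 2 := by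
  have key (g : 𝓢(V, ℂ)) : ∫⁻ x, ‖g x‖ₑ ^ 2 = ENNReal.ofReal (∫ x, ‖g x‖ ^ 2) := by
    rw [ofReal_integral_eq_lintegral_ofReal]
    · simp_rw [ENNReal.ofReal_pow (norm_nonneg _), ofReal_norm]
    · exact (memLp_two_iff_integrable_sq_norm g.continuous.aestronglyMeasurable).1 (g.memLp 2)
    · exact Filter.Eventually.of_forall fun x => by positivity
  rw [key, key, SchwartzMap.integral_norm_sq_fourier]

lemma exists_schwartz_fourierM {m n : ℕ} (f : 𝓢(Fin m → EuclideanSpace ℝ (Fin n), ℂ)) :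
    ∃ g : 𝓢(Fin m → EuclideanSpace ℝ (Fin n), ℂ), (∀ ξ, fourierM f ξ = g ξ) ∧
      ∫⁻ x, ‖f x‖ₑ ^ 2 = ∫⁻ ξ, ‖g ξ‖ₑ ^ 2 ∧
      ∀ x, f x = ∫ ξ, 𝐞 (-∑ k, ⟪ξ k, x k⟫_ℝ) • g ξ := by
  set e := blockEquiv m n
  have he := measurePreserving_blockEquiv m n
  have hee := measurableEmbedding_blockEquiv m n
  let f' : 𝓢(EuclideanSpace ℝ (Fin m × Fin n), ℂ) :=
    SchwartzMap.compCLMOfContinuousLinearEquiv ℂ e f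
  let g' := 𝓕⁻ f'
  let g : 𝓢(Fin m → EuclideanSpace ℝ (Fin n), ℂ) :=
    SchwartzMap.compCLMOfContinuousLinearEquiv ℂ e.symm g'
  have hf' x : f' x = f (e x) := rfl
  have hg x : g (e x) = g' x := by
    change g' (e.symm (e x)) = _
    simp
  have hgf : 𝓕 g' = f' := FourierTransform.fourier_fourierInv_eq f'
  refine ⟨g, fun ξ => ?_, ?_, fun x => ?_⟩
  · obtain ⟨ξ, rfl⟩ := e.surjective ξ
    rw [hg, fourierM, ← he.integral_comp hee]
    change _ = 𝓕⁻ f' ξ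
    rw [SchwartzMap.fourierInv_coe, Real.fourierInv_eq']
    congr 1 with x
    rw [hf', inner_eq_sum_blockEquiv]
    simp only [smul_eq_mul]
    congr 2
    push_cast
    ring
  · rw [← he.lintegral_comp_emb hee, ← he.lintegral_comp_emb hee]
    change ∫⁻ x, ‖f' x‖ₑ ^ 2 = ∫⁻ x, ‖g (e x)‖ₑ ^ 2
    simp_rw [hg]
    rw [← hgf, lintegral_enorm_sq_fourier]
  · obtain ⟨x, rfl⟩ := e.surjective x
    rw [← he.integral_comp hee, ← hf', ← hgf, SchwartzMap.fourier_coe, Real.fourier_eq]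
    congr 1 with ξ
    change _ = 𝐞 _ • g (e ξ)
    rw [hg, inner_eq_sum_blockEquiv]

lemma exists_exp_le_one_add_exp_mul {ι : Type*} [Fintype ι] (α : ι → ℝ) {a N θ : ℝ}
    (hα : ∀ j, 0 < α j ∧ α j ≤ N) (ha : 0 < a) (hN : 0 < N) (hθ : 0 < θ) (hθ1 : θ < 1) :
    ∃ ε > 0, ∀ (v : ℝ) (u : ι → ℝ), (∀ j, u j ≤ v) →
      rexp ((θ * (a + ∑ j, α j) - Fintype.card ι * N) * v) ≤
        (1 + rexp (a * v + ∑ j, α j * u j)) * rexp (∑ j, (-N * u j - ε * |u j|)) := by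
  set S := a + ∑ j, α j with hS
  have hSpos : 0 < S := by
    have : 0 ≤ ∑ j, α j := Finset.sum_nonneg fun j _ => (hα j).1.le
    linarith
  set c : ℝ := (Fintype.card ι : ℝ) with hc
  have hc0 : 0 ≤ c := by positivity
  set δ := min θ ((1 - θ) / 2) with hδ
  have hδ0 : 0 < δ := lt_min hθ (by linarith)
  have hδ1 : δ ≤ θ := min_le_left _ _
  have hδ2 : δ ≤ (1 - θ) / 2 := min_le_right _ _
  set ε := min (N * (1 - θ) / 2) (δ * S / (c + 1)) with hε
  have hε0 : 0 < ε := lt_min (by have : 0 < 1 - θ := by linarith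
                                 positivity) (by positivity)
  have hε1 : ε ≤ N * (1 - θ) / 2 := min_le_left _ _
  have hε2 : ε * c ≤ δ * S := by
    have h : ε * (c + 1) ≤ δ * S := (le_div_iff₀ (by positivity)).1 (min_le_right _ _)
    linarith
  refine ⟨ε, hε0, fun v u hu => ?_⟩
  set X := a * v + ∑ j, α j * u j with hX
  have h1 : θ * X + δ * |X| ≤ max 0 X := by
    rcases abs_cases X with ⟨h, h'⟩ | ⟨h, h'⟩
    · rw [h]; exact le_max_of_le_right (by nlinarith)
    · rw [h]; exact le_max_of_le_left (by nlinarith)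
  have h2 : rexp (max 0 X) ≤ 1 + rexp X := by
    rcases le_total 0 X with h | h
    · rw [max_eq_right h]; linarith
    · rw [max_eq_left h, Real.exp_zero]; linarith [Real.exp_pos X]
  set d := ∑ j, (v - u j) with hd
  have hd0 : 0 ≤ d := Finset.sum_nonneg fun j _ => sub_nonneg.2 (hu j)
  have hXeq : X = S * v - ∑ j, α j * (v - u j) := by
    simp only [mul_sub, Finset.sum_sub_distrib, ← Finset.sum_mul, hX, hS]; ring
  have hαd : ∑ j, α j * (v - u j) ≤ N * d := by
    rw [hd, Finset.mul_sum]
    exact Finset.sum_le_sum fun j _ =>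
      mul_le_mul_of_nonneg_right (hα j).2 (sub_nonneg.2 (hu j))
  have hαd0 : 0 ≤ ∑ j, α j * (v - u j) :=
    Finset.sum_nonneg fun j _ => mul_nonneg (hα j).1.le (sub_nonneg.2 (hu j))
  have hXabs : S * |v| - N * d ≤ |X| := by
    have h3 : |S * v| - |∑ j, α j * (v - u j)| ≤ |X| := by rw [hXeq]; exact abs_sub_abs_le_abs_sub _ _
    rw [abs_mul, abs_of_pos hSpos, abs_of_nonneg hαd0] at h3
    linarith
  have habs : ∑ j, |u j| ≤ d + c * |v| := by
    have : ∀ j ∈ Finset.univ, |u j| ≤ (v - u j) + |v| := fun j _ => by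
      have h4 := abs_sub v (v - u j)
      rw [sub_sub_cancel, abs_of_nonneg (sub_nonneg.2 (hu j))] at h4
      linarith
    refine (Finset.sum_le_sum this).trans ?_
    rw [Finset.sum_add_distrib]
    simp [hc, hd]
  have hdeq : d = c * v - ∑ j, u j := by simp [hd, hc]
  have hmain : (θ * S - c * N) * v ≤
      max 0 X + ∑ j, (-N * u j - ε * |u j|) := by
    rw [Finset.sum_sub_distrib, ← Finset.mul_sum, ← Finset.mul_sum]
    have h5 : ε * ∑ j, |u j| ≤ ε * d + ε * c * |v| := by
      rw [mul_assoc, ← mul_add]; exact mul_le_mul_of_nonneg_left habs hε0.le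
    have h6 : ε * c * |v| ≤ δ * S * |v| := mul_le_mul_of_nonneg_right hε2 (abs_nonneg v)
    have h7 : ε * d ≤ N * (1 - θ) / 2 * d := mul_le_mul_of_nonneg_right hε1 hd0
    have h8 : δ * (S * |v| - N * d) ≤ δ * |X| := mul_le_mul_of_nonneg_left hXabs hδ0.le
    have h9 : δ * (N * d) ≤ (1 - θ) / 2 * (N * d) :=
      mul_le_mul_of_nonneg_right hδ2 (by positivity)
    have h10 : θ * ∑ j, α j * (v - u j) ≤ θ * (N * d) := mul_le_mul_of_nonneg_left hαd hθ.le
    have h11 : θ * X = θ * S * v - θ * ∑ j, α j * (v - u j) := by rw [hXeq]; ring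
    have h12 : N * d = N * (c * v) - N * ∑ j, u j := by rw [hdeq]; ring
    nlinarith
  calc rexp ((θ * S - c * N) * v) ≤ rexp (max 0 X + ∑ j, (-N * u j - ε * |u j|)) :=
        Real.exp_le_exp.2 hmain
    _ = rexp (max 0 X) * rexp (∑ j, (-N * u j - ε * |u j|)) := Real.exp_add _ _
    _ ≤ _ := mul_le_mul_of_nonneg_right h2 (Real.exp_pos _).le

/-- The radial function `min (‖x‖ ^ (-n + ε)) (‖x‖ ^ (-n - ε))`, up to its value at the origin. -/
def radialMin (n : ℕ) (ε : ℝ) (x : EuclideanSpace ℝ (Fin n)) : ℝ :=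
  rexp (-n * Real.log ‖x‖ - ε * |Real.log ‖x‖|)

lemma radialMin_nonneg (n : ℕ) (ε : ℝ) (x : EuclideanSpace ℝ (Fin n)) : 0 ≤ radialMin n ε x :=
  (Real.exp_pos _).le

lemma measurable_radialMin (n : ℕ) (ε : ℝ) : Measurable (radialMin n ε) := by
  unfold radialMin
  fun_prop

lemma integrable_radialMin {n : ℕ} (hn : 1 ≤ n) {ε : ℝ} (hε : 0 < ε) :
    Integrable (radialMin n ε) := by
  have : Nonempty (Fin n) := ⟨⟨0, hn⟩⟩
  refine (integrable_fun_norm_addHaar (volume : Measure (EuclideanSpace ℝ (Fin n)))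
    (f := fun y : ℝ => rexp (-n * Real.log y - ε * |Real.log y|))).2 ?_
  rw [finrank_euclideanSpace_fin]
  have hy : ∀ y : ℝ, 0 < y → y ^ (n - 1) • rexp (-n * Real.log y - ε * |Real.log y|) =
      rexp (-Real.log y - ε * |Real.log y|) := by
    intro y hy
    rw [smul_eq_mul, ← Real.rpow_natCast, Real.rpow_def_of_pos hy, ← Real.exp_add]
    congr 1
    push_cast [Nat.cast_sub hn]
    ring
  rw [← Set.Ioc_union_Ioi_eq_Ioi zero_le_one]
  refine IntegrableOn.union ?_ ?_
  · have h : IntegrableOn (fun y : ℝ => y ^ (-1 + ε)) (Set.Ioc 0 1) :=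
      (intervalIntegrable_iff_integrableOn_Ioc_of_le zero_le_one).1
        (intervalIntegral.intervalIntegrable_rpow' (by linarith))
    refine h.congr_fun (fun y hy' => ?_) measurableSet_Ioc
    dsimp only
    rw [hy y hy'.1, Real.rpow_def_of_pos hy'.1,
      abs_of_nonpos (Real.log_nonpos hy'.1.le hy'.2)]
    congr 1; ring
  · have h : IntegrableOn (fun y : ℝ => y ^ (-1 - ε)) (Set.Ioi 1) :=
      integrableOn_Ioi_rpow_of_lt (by linarith) one_pos
    refine h.congr_fun (fun y hy' => ?_) measurableSet_Ioi
    have hy0 : (0 : ℝ) < y := one_pos.trans hy'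
    dsimp only
    rw [hy y hy0, Real.rpow_def_of_pos hy0, abs_of_nonneg (Real.log_nonneg (le_of_lt hy'))]
    congr 1; ring

lemma lintegral_comp_smul_eq {n : ℕ} (H : EuclideanSpace ℝ (Fin n) → ℝ≥0∞) {r : ℝ} (hr : 0 < r) :
    ∫⁻ x, H (r⁻¹ • x) = ENNReal.ofReal (r ^ n) * ∫⁻ x, H x := by
  have hr' : r⁻¹ ≠ 0 := inv_ne_zero hr.ne'
  have h := lintegral_map_equiv (μ := volume) H
    (MeasurableEquiv.smul₀ (α := EuclideanSpace ℝ (Fin n)) r⁻¹ hr')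
  rw [MeasurableEquiv.coe_smul₀, Measure.map_addHaar_smul volume hr',
    lintegral_smul_measure, finrank_euclideanSpace_fin] at h
  rw [← h, smul_eq_mul]
  congr 2
  rw [inv_pow, inv_inv, abs_of_pos (by positivity)]

lemma lintegral_pi_fin_prod {X : Type*} [MeasureSpace X] [SigmaFinite (volume : Measure X)]
    {h : X → ℝ≥0∞} (hh : Measurable h) (M : ℕ) :
    ∫⁻ y : Fin M → X, ∏ j, h (y j) = (∫⁻ x, h x) ^ M := by
  induction M with
  | zero => simp [volume_pi]
  | succ M ih =>
    rw [← (volume_preserving_piFinSuccAbove (fun _ : Fin (M + 1) => X) 0).symm.lintegral_comp_emb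
      (MeasurableEquiv.measurableEmbedding _)]
    simp only [MeasurableEquiv.piFinSuccAbove_symm_apply, Fin.insertNthEquiv_apply,
      Fin.insertNth_zero, Fin.prod_univ_succ, Fin.cons_zero, Fin.cons_succ, cast_eq]
    rw [Measure.volume_eq_prod, lintegral_prod _ (by fun_prop)]
    have hm : Measurable fun y : Fin M → X => ∏ j, h (y j) := by fun_prop
    simp_rw [lintegral_const_mul _ hm, ih]
    rw [lintegral_mul_const _ hh, pow_succ']

lemma lintegral_piFin_insertNth {X : Type*} [MeasureSpace X] [SigmaFinite (volume : Measure X)]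
    {M : ℕ} (k : Fin (M + 1)) {H : (Fin (M + 1) → X) → ℝ≥0∞} (hH : Measurable H) :
    ∫⁻ ξ, H ξ = ∫⁻ y : Fin M → X, ∫⁻ t, H (k.insertNth t y) := by
  rw [← (volume_preserving_piFinSuccAbove (fun _ : Fin (M + 1) => X) k).symm.lintegral_comp_emb
      (MeasurableEquiv.measurableEmbedding _), Measure.volume_eq_prod]
  exact lintegral_prod_symm' _ (hH.comp (MeasurableEquiv.measurable _))

/-- The point of `X ^ (M + 1)` whose coordinates other than the `k`-th are `y`
and whose coordinates add up to `η`. -/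
def fiberPoint {X : Type*} [AddCommGroup X] {M : ℕ} (k : Fin (M + 1)) (η : X) (y : Fin M → X) :
    Fin (M + 1) → X :=
  k.insertNth (η - ∑ j, y j) y

lemma sum_insertNth {X : Type*} [AddCommGroup X] {M : ℕ} (k : Fin (M + 1)) (t : X)
    (y : Fin M → X) : ∑ j, (k.insertNth t y : Fin (M + 1) → X) j = t + ∑ j, y j := by
  rw [Fin.sum_univ_succAbove _ k]
  simp

lemma sum_fiberPoint {X : Type*} [AddCommGroup X] {M : ℕ} (k : Fin (M + 1)) (η : X)
    (y : Fin M → X) : ∑ j, fiberPoint k η y j = η := by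
  rw [fiberPoint, sum_insertNth, sub_add_cancel]

lemma continuous_fiberPoint {X : Type*} [NormedAddCommGroup X] {M : ℕ} (k : Fin (M + 1)) :
    Continuous fun p : X × (Fin M → X) => fiberPoint k p.1 p.2 := by
  unfold fiberPoint
  refine continuous_pi fun i => ?_
  refine Fin.succAboveCases k ?_ (fun j => ?_) i
  · simp only [Fin.insertNth_apply_same]
    fun_prop
  · simp only [Fin.insertNth_apply_succAbove]
    fun_prop

lemma insertNth_succ_cons {X : Type*} {M : ℕ} (k : Fin (M + 1)) (s t : X) (y : Fin M → X) :
    (k.succ.insertNth s (Fin.cons t y : Fin (M + 1) → X) : Fin (M + 2) → X) =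
      (Fin.cons t (k.insertNth s y : Fin (M + 1) → X) : Fin (M + 2) → X) := by
  symm
  rw [Fin.eq_insertNth_iff]
  refine ⟨by simp, funext fun j => ?_⟩
  refine Fin.cases ?_ (fun j => ?_) j <;> simp [Fin.removeNth]

lemma lintegral_fiberPoint {n M : ℕ} (k : Fin (M + 1))
    {H : (Fin (M + 1) → EuclideanSpace ℝ (Fin n)) → ℝ≥0∞}
    (hH : Measurable H) (η : EuclideanSpace ℝ (Fin n)) :
    ∫⁻ y, H (fiberPoint 0 η y) = ∫⁻ y, H (fiberPoint k η y) := by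
  induction k using Fin.cases with
  | zero => rfl
  | succ k =>
    cases M with
    | zero => exact k.elim0
    | succ M =>
      have hm (l : Fin (M + 2)) : Measurable fun y => H (fiberPoint l η y) :=
        hH.comp ((continuous_fiberPoint l).comp (Continuous.prodMk_right η)).measurable
      rw [lintegral_piFin_insertNth k (hm 0), lintegral_piFin_insertNth 0 (hm k.succ)]
      congr 1 with y
      rw [← lintegral_sub_left_eq_self _ (η - ∑ j, y j)]
      congr 1 with t
      congr 1
      rw [fiberPoint, fiberPoint, sum_insertNth, sum_insertNth, Fin.insertNth_zero',
        Fin.insertNth_zero', insertNth_succ_cons]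
      congr 1
      · abel
      · congr 1
        abel

lemma lintegral_lintegral_fiberPoint {n M : ℕ}
    {H : (Fin (M + 1) → EuclideanSpace ℝ (Fin n)) → ℝ≥0∞} (hH : Measurable H) :
    ∫⁻ η, ∫⁻ y, H (fiberPoint 0 η y) = ∫⁻ ξ, H ξ := by
  rw [lintegral_lintegral_swap, lintegral_piFin_insertNth 0 hH]
  · congr 1 with y
    exact lintegral_sub_right_eq_self (fun t => H ((0 : Fin (M + 1)).insertNth t y)) _
  · exact (hH.comp (continuous_fiberPoint 0).measurable).aemeasurable

/-- The weight `1 + r ^ (-∑ α) * ∏ ‖ξ_k‖ ^ α_k`. -/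
def trWeight {m n : ℕ} (α : Fin m → ℝ) (r : ℝ) (ξ : Fin m → EuclideanSpace ℝ (Fin n)) : ℝ :=
  1 + r ^ (-∑ k, α k) * ∏ k, ‖ξ k‖ ^ α k

lemma one_le_trWeight {m n : ℕ} (α : Fin m → ℝ) {r : ℝ} (hr : 0 < r)
    (ξ : Fin m → EuclideanSpace ℝ (Fin n)) : 1 ≤ trWeight α r ξ := by
  have : 0 ≤ r ^ (-∑ k, α k) * ∏ k, ‖ξ k‖ ^ α k := by positivity
  unfold trWeight
  linarith

lemma measurable_trWeight {m n : ℕ} (α : Fin m → ℝ) (r : ℝ) :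
    Measurable (trWeight α r : (Fin m → EuclideanSpace ℝ (Fin n)) → ℝ) := by
  unfold trWeight
  fun_prop

lemma exists_norm_sum_rpow_mul_inv_trWeight_le {M n : ℕ} (hn : 1 ≤ n) (α : Fin (M + 1) → ℝ)
    (hα : ∀ k, 0 < α k ∧ α k < n) {θ : ℝ} (hθ : 0 < θ) (hθ1 : θ < 1) {σ : ℝ} (hσ0 : 0 ≤ σ)
    (hσ : σ = θ * ∑ k, α k - M * n) (k : Fin (M + 1)) :
    ∃ ε > 0, ∀ (r : ℝ), 0 < r → ∀ ξ : Fin (M + 1) → EuclideanSpace ℝ (Fin n),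
      (∀ j, ‖ξ j‖ ≤ ‖ξ k‖) → ∑ j, ξ j ≠ 0 → (∀ j, ξ (k.succAbove j) ≠ 0) →
      ‖∑ j, ξ j‖ ^ σ * (trWeight α r ξ)⁻¹ ≤
        (M + 1) ^ σ * r ^ σ * ∏ j, radialMin n ε (r⁻¹ • ξ (k.succAbove j)) := by
  obtain ⟨ε, hε, H⟩ := exists_exp_le_one_add_exp_mul (fun j => α (k.succAbove j)) (a := α k)
    (N := n) (fun j => ⟨(hα _).1, (hα _).2.le⟩) (hα k).1 (by exact_mod_cast hn) hθ hθ1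
  refine ⟨ε, hε, fun r hr ξ hmax hsum hne => ?_⟩
  have hsumle : ‖∑ j, ξ j‖ ≤ (M + 1) * ‖ξ k‖ := by
    refine (norm_sum_le _ _).trans ((Finset.sum_le_sum fun j _ => hmax j).trans ?_)
    simp
  have hk : 0 < ‖ξ k‖ := by
    have h0 : 0 < ‖∑ j, ξ j‖ := norm_pos_iff.2 hsum
    by_contra h
    have : ‖ξ k‖ = 0 := le_antisymm (not_lt.1 h) (norm_nonneg _)
    rw [this] at hsumle
    linarith
  have hpos : ∀ j, 0 < ‖ξ j‖ := fun j => by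
    refine Fin.succAboveCases k hk (fun i => norm_pos_iff.2 (hne i)) j
  set w : Fin (M + 1) → ℝ := fun j => Real.log (‖ξ j‖ / r) with hw
  have hwexp : ∀ j (a : ℝ), rexp (a * w j) = ‖ξ j‖ ^ a * r ^ (-a) := fun j a => by
    have h1 : 0 < ‖ξ j‖ / r := div_pos (hpos j) hr
    rw [hw, mul_comm, ← Real.rpow_def_of_pos h1, Real.div_rpow (hpos j).le hr.le,
      Real.rpow_neg hr.le, div_eq_mul_inv]
  have key := H (w k) (fun j => w (k.succAbove j)) fun j =>
    Real.log_le_log (div_pos (hpos _) hr) (div_le_div_of_nonneg_right (hmax _) hr.le)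
  rw [← Fin.sum_univ_succAbove α k, Fintype.card_fin, ← hσ,
    ← Fin.sum_univ_succAbove (fun j => α j * w j) k] at key
  have hX : 1 + rexp (∑ j, α j * w j) = trWeight α r ξ := by
    rw [trWeight, Real.exp_sum]
    simp_rw [hwexp]
    rw [Finset.prod_mul_distrib, ← Real.rpow_sum_of_pos hr, Finset.sum_neg_distrib, mul_comm]
  have hrad : rexp (∑ j, (-(n : ℝ) * w (k.succAbove j) - ε * |w (k.succAbove j)|)) =
      ∏ j, radialMin n ε (r⁻¹ • ξ (k.succAbove j)) := by
    rw [Real.exp_sum]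
    refine Finset.prod_congr rfl fun j _ => ?_
    rw [radialMin, norm_smul, norm_inv, Real.norm_of_nonneg hr.le, inv_mul_eq_div]
  rw [hX, hrad, hwexp] at key
  have hw1 : 0 < trWeight α r ξ := one_pos.trans_le (one_le_trWeight α hr ξ)
  rw [mul_inv_le_iff₀ hw1]
  calc ‖∑ j, ξ j‖ ^ σ ≤ ((M + 1) * ‖ξ k‖) ^ σ := Real.rpow_le_rpow (norm_nonneg _) hsumle hσ0
    _ = (M + 1) ^ σ * r ^ σ * (‖ξ k‖ ^ σ * r ^ (-σ)) := by
      rw [Real.mul_rpow (by positivity) hk.le, Real.rpow_neg hr.le]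
      field_simp
    _ ≤ (M + 1) ^ σ * r ^ σ *
        (trWeight α r ξ * ∏ j, radialMin n ε (r⁻¹ • ξ (k.succAbove j))) := by gcongr
    _ = _ := by ring

lemma ae_pi_ne_zero {M n : ℕ} (hn : 1 ≤ n) :
    ∀ᵐ y : Fin M → EuclideanSpace ℝ (Fin n), ∀ j, y j ≠ 0 := by
  have : Nonempty (Fin n) := ⟨⟨0, hn⟩⟩
  refine ae_all_iff.2 fun j => ?_
  have h0 : ∀ᵐ x : EuclideanSpace ℝ (Fin n), x ≠ 0 := Measure.ae_ne volume 0
  exact (Measure.quasiMeasurePreserving_eval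
    (fun _ : Fin M => (volume : Measure (EuclideanSpace ℝ (Fin n)))) j).ae h0

lemma exists_lintegral_fiberPoint_le {M n : ℕ} (hn : 1 ≤ n) (α : Fin (M + 1) → ℝ)
    (hα : ∀ k, 0 < α k ∧ α k < n) {θ : ℝ} (hθ : 0 < θ) (hθ1 : θ < 1) {σ : ℝ} (hσ0 : 0 ≤ σ)
    (hσ : σ = θ * ∑ k, α k - M * n) :
    ∃ C : ℝ≥0∞, C ≠ ⊤ ∧ ∀ r : ℝ, 0 < r → ∀ η : EuclideanSpace ℝ (Fin n), η ≠ 0 →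
      ENNReal.ofReal (‖η‖ ^ σ) * ∫⁻ y, ENNReal.ofReal (trWeight α r (fiberPoint 0 η y))⁻¹ ≤
        C * ENNReal.ofReal (r ^ (θ * ∑ k, α k)) := by
  choose ε hε H using exists_norm_sum_rpow_mul_inv_trWeight_le hn α hα hθ hθ1 hσ0 hσ
  refine ⟨∑ k, ENNReal.ofReal ((M + 1) ^ σ) * (∫⁻ x, ENNReal.ofReal (radialMin n (ε k) x)) ^ M,
    ?_, fun r hr η hη => ?_⟩
  · refine ENNReal.sum_ne_top.2 fun k _ => ENNReal.mul_ne_top ENNReal.ofReal_ne_top ?_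
    exact ENNReal.pow_ne_top (integrable_radialMin hn (hε k)).lintegral_lt_top.ne
  let S : Fin (M + 1) → Set (Fin (M + 1) → EuclideanSpace ℝ (Fin n)) :=
    fun k => {ξ | ∀ j, ‖ξ j‖ ≤ ‖ξ k‖}
  have hS k : MeasurableSet (S k) := by
    have : S k = ⋂ j, {ξ | ‖ξ j‖ ≤ ‖ξ k‖} := by ext; simp [S]
    rw [this]
    exact MeasurableSet.iInter fun j => measurableSet_le (by fun_prop) (by fun_prop)
  let Q : (Fin (M + 1) → EuclideanSpace ℝ (Fin n)) → ℝ≥0∞ :=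
    fun ξ => ENNReal.ofReal (‖∑ j, ξ j‖ ^ σ * (trWeight α r ξ)⁻¹)
  have hQ : Measurable Q := by
    have := measurable_trWeight (n := n) α r
    fun_prop
  have hfm (k : Fin (M + 1)) : Measurable fun y => fiberPoint k η y :=
    ((continuous_fiberPoint k).comp (Continuous.prodMk_right η)).measurable
  calc ENNReal.ofReal (‖η‖ ^ σ) * ∫⁻ y, ENNReal.ofReal (trWeight α r (fiberPoint 0 η y))⁻¹
      = ∫⁻ y, Q (fiberPoint 0 η y) := by
        rw [← lintegral_const_mul']
        · congr 1 with y
          rw [← ENNReal.ofReal_mul (by positivity)]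
          simp only [Q, sum_fiberPoint]
        · exact ENNReal.ofReal_ne_top
    _ ≤ ∫⁻ y, ∑ k, (S k).indicator Q (fiberPoint 0 η y) := by
        refine lintegral_mono fun y => ?_
        obtain ⟨k, -, hk⟩ := Finset.exists_max_image Finset.univ
          (fun j => ‖fiberPoint 0 η y j‖) ⟨0, Finset.mem_univ _⟩
        have hmem : fiberPoint 0 η y ∈ S k := fun j => hk j (Finset.mem_univ _)
        calc Q (fiberPoint 0 η y) = (S k).indicator Q (fiberPoint 0 η y) :=
              (Set.indicator_of_mem hmem Q).symm
          _ ≤ _ := Finset.single_le_sum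
              (f := fun k => (S k).indicator Q (fiberPoint 0 η y)) (fun _ _ => zero_le)
              (Finset.mem_univ k)
    _ = ∑ k, ∫⁻ y, (S k).indicator Q (fiberPoint 0 η y) :=
        lintegral_finsetSum _ fun k _ => (hQ.indicator (hS k)).comp (hfm 0)
    _ = ∑ k, ∫⁻ y, (S k).indicator Q (fiberPoint k η y) :=
        Finset.sum_congr rfl fun k _ => lintegral_fiberPoint k (hQ.indicator (hS k)) η
    _ ≤ ∑ k, ∫⁻ y : Fin M → EuclideanSpace ℝ (Fin n), ENNReal.ofReal ((M + 1) ^ σ * r ^ σ) *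
          ∏ j, ENNReal.ofReal (radialMin n (ε k) (r⁻¹ • y j)) := by
        refine Finset.sum_le_sum fun k _ => lintegral_mono_ae ?_
        filter_upwards [ae_pi_ne_zero (M := M) hn] with y hy
        by_cases hmem : fiberPoint k η y ∈ S k
        · rw [Set.indicator_of_mem hmem, ← ENNReal.ofReal_prod_of_nonneg
            (fun _ _ => radialMin_nonneg _ _ _), ← ENNReal.ofReal_mul (by positivity)]
          have h := H k r hr (fiberPoint k η y) hmem (by rwa [sum_fiberPoint])
            (fun j => by simpa [fiberPoint] using hy j)
          refine ENNReal.ofReal_le_ofReal (h.trans_eq ?_)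
          simp [fiberPoint]
        · rw [Set.indicator_of_notMem hmem]
          exact zero_le
    _ = _ := by
        rw [Finset.sum_mul]
        refine Finset.sum_congr rfl fun k _ => ?_
        have hmr := (measurable_radialMin n (ε k))
        rw [lintegral_const_mul' _ _ ENNReal.ofReal_ne_top,
          lintegral_pi_fin_prod (h := fun x => ENNReal.ofReal (radialMin n (ε k) (r⁻¹ • x)))
            (by fun_prop),
          lintegral_comp_smul_eq (fun x => ENNReal.ofReal (radialMin n (ε k) x)) hr, mul_pow,
          ← ENNReal.ofReal_pow (by positivity), ENNReal.ofReal_mul (by positivity)]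
        have : r ^ (θ * ∑ k, α k) = r ^ σ * (r ^ n) ^ M := by
          rw [← pow_mul, ← Real.rpow_natCast, ← Real.rpow_add hr, hσ]
          congr 1
          push_cast
          ring
        rw [this, ENNReal.ofReal_mul (by positivity)]
        ring

/-- A weighted Cauchy–Schwarz inequality. -/
lemma lintegral_sq_le_mul_lintegral_weight {X : Type*} [MeasurableSpace X] {μ : Measure X}
    {w : X → ℝ} (hw : Measurable w) (hpos : ∀ᵐ x ∂μ, 0 < w x) {g : X → ℝ≥0∞}
    (hg : Measurable g) :
    (∫⁻ x, g x ∂μ) ^ 2 ≤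
      (∫⁻ x, ENNReal.ofReal (w x)⁻¹ ∂μ) * ∫⁻ x, ENNReal.ofReal (w x) * g x ^ 2 ∂μ := by
  let u : X → ℝ≥0∞ := fun x => ENNReal.ofReal (√(w x))⁻¹
  let v : X → ℝ≥0∞ := fun x => ENNReal.ofReal √(w x) * g x
  have huv : ∫⁻ x, g x ∂μ = ∫⁻ x, (u * v) x ∂μ := by
    refine lintegral_congr_ae ?_
    filter_upwards [hpos] with x hx
    have hs : 0 < √(w x) := Real.sqrt_pos.2 hx
    simp only [u, v, Pi.mul_apply]
    rw [← mul_assoc, ← ENNReal.ofReal_mul (by positivity), inv_mul_cancel₀ hs.ne',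
      ENNReal.ofReal_one, one_mul]
  have hu2 : ∫⁻ x, u x ^ (2 : ℝ) ∂μ = ∫⁻ x, ENNReal.ofReal (w x)⁻¹ ∂μ := by
    refine lintegral_congr_ae ?_
    filter_upwards [hpos] with x hx
    simp only [u]
    rw [ENNReal.rpow_ofNat, ← ENNReal.ofReal_pow (by positivity), inv_pow, Real.sq_sqrt hx.le]
  have hv2 : ∫⁻ x, v x ^ (2 : ℝ) ∂μ = ∫⁻ x, ENNReal.ofReal (w x) * g x ^ 2 ∂μ := by
    refine lintegral_congr_ae ?_
    filter_upwards [hpos] with x hx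
    simp only [v]
    rw [ENNReal.rpow_ofNat, mul_pow, ← ENNReal.ofReal_pow (by positivity), Real.sq_sqrt hx.le]
  have h := ENNReal.lintegral_mul_le_Lp_mul_Lq μ Real.HolderConjugate.two_two
    (f := u) (g := v) (by fun_prop) (by fun_prop)
  rw [← huv, hu2, hv2] at h
  calc (∫⁻ x, g x ∂μ) ^ 2 ≤ (_ * _) ^ 2 := pow_le_pow_left' h 2
    _ = _ := by
      rw [mul_pow, ← ENNReal.rpow_natCast, ← ENNReal.rpow_natCast, ← ENNReal.rpow_mul,
        ← ENNReal.rpow_mul]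
      norm_num

lemma setLIntegral_norm_rpow_neg_le {n : ℕ} (hn : 1 ≤ n) {σ : ℝ} {R : ℝ} (hR : 0 < R) :
    ∫⁻ x in Metric.closedBall (0 : EuclideanSpace ℝ (Fin n)) R, ENNReal.ofReal (‖x‖ ^ σ)⁻¹ ≤
      ENNReal.ofReal (R ^ (n - σ)) * ∫⁻ x, ENNReal.ofReal (radialMin n (n - σ) x) := by
  have : Nonempty (Fin n) := ⟨⟨0, hn⟩⟩
  calc _ ≤ ∫⁻ x in Metric.closedBall (0 : EuclideanSpace ℝ (Fin n)) R,
        ENNReal.ofReal (R ^ (-σ)) * ENNReal.ofReal (radialMin n (n - σ) (R⁻¹ • x)) := by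
        refine lintegral_mono_ae ?_
        filter_upwards [ae_restrict_mem Metric.isClosed_closedBall.measurableSet,
          ae_restrict_of_ae (Measure.ae_ne volume 0)] with x hx hx0
        have hx1 : 0 < ‖x‖ := norm_pos_iff.2 hx0
        have hx2 : ‖x‖ ≤ R := by simpa using hx
        rw [← ENNReal.ofReal_mul (by positivity)]
        refine ENNReal.ofReal_le_ofReal (le_of_eq ?_)
        have hlog : Real.log (‖x‖ / R) ≤ 0 :=
          Real.log_nonpos (by positivity) ((div_le_one hR).2 hx2)
        rw [radialMin, norm_smul, norm_inv, Real.norm_of_nonneg hR.le, inv_mul_eq_div,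
          abs_of_nonpos hlog, ← Real.rpow_neg hx1.le, Real.rpow_def_of_pos hx1,
          Real.rpow_def_of_pos hR, ← Real.exp_add, Real.log_div hx1.ne' hR.ne']
        congr 1
        ring
    _ ≤ ∫⁻ x : EuclideanSpace ℝ (Fin n),
        ENNReal.ofReal (R ^ (-σ)) * ENNReal.ofReal (radialMin n (n - σ) (R⁻¹ • x)) :=
        setLIntegral_le_lintegral _ _
    _ = _ := by
        rw [lintegral_const_mul' _ _ ENNReal.ofReal_ne_top,
          lintegral_comp_smul_eq (fun x => ENNReal.ofReal (radialMin n (n - σ) x)) hR, ← mul_assoc,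
          ← ENNReal.ofReal_mul (by positivity), ← Real.rpow_natCast, ← Real.rpow_add hR]
        congr 3
        ring

/-- The superlevel sets of a Fourier transform are controlled by the high frequencies
as soon as the low frequencies contribute at most half of the level. -/
lemma volume_lt_norm_fourier_le {n : ℕ} (Φ : 𝓢(EuclideanSpace ℝ (Fin n), ℂ)) {t R : ℝ}
    (ht : 0 < t) (hR : 0 < R)
    (hlow : ∫⁻ η in Metric.closedBall 0 (2 * R), ‖Φ η‖ₑ ≤ ENNReal.ofReal (t / 2)) :
    volume {x | t < ‖𝓕 Φ x‖} ≤
      ENNReal.ofReal (4 * t ^ (-2 : ℝ)) * ∫⁻ η in {η | R ≤ ‖η‖}, ‖Φ η‖ₑ ^ 2 := by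
  let χ : ContDiffBump (0 : EuclideanSpace ℝ (Fin n)) := ⟨R, 2 * R, hR, by linarith⟩
  have hχg : (fun x => (χ x : ℂ)).HasTemperateGrowth := by
    refine HasCompactSupport.hasTemperateGrowth ?_ ?_
    · exact χ.hasCompactSupport.comp_left Complex.ofReal_zero
    · exact Complex.ofRealCLM.contDiff.comp χ.contDiff
  let Φ₁ : 𝓢(EuclideanSpace ℝ (Fin n), ℂ) := SchwartzMap.smulLeftCLM ℂ (fun x => (χ x : ℂ)) Φ
  have hΦ₁ x : Φ₁ x = (χ x : ℂ) * Φ x := by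
    simp [Φ₁, SchwartzMap.smulLeftCLM_apply_apply hχg]
  let Φ₂ := Φ - Φ₁
  have hF x : 𝓕 Φ x = 𝓕 Φ₁ x + 𝓕 Φ₂ x := by
    have : Φ = Φ₁ + Φ₂ := by simp [Φ₂]
    conv_lhs => rw [this, FourierTransform.fourier_add]
    rfl
  have h1 x : ‖𝓕 Φ₁ x‖ ≤ t / 2 := by
    have h : ‖𝓕 Φ₁ x‖ₑ ≤ ENNReal.ofReal (t / 2) := by
      refine le_trans ?_ hlow
      rw [SchwartzMap.fourier_coe, Real.fourier_eq]
      refine (enorm_integral_le_lintegral_enorm _).trans ?_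
      rw [← lintegral_indicator Metric.isClosed_closedBall.measurableSet]
      refine lintegral_mono fun η => ?_
      rw [← ofReal_norm, Circle.norm_smul, ofReal_norm, hΦ₁]
      by_cases hη : η ∈ Metric.closedBall 0 (2 * R)
      · rw [Set.indicator_of_mem hη, enorm_mul]
        refine mul_le_of_le_one_left zero_le ?_
        rw [← ofReal_norm, Complex.norm_of_nonneg χ.nonneg]
        exact ENNReal.ofReal_le_one.2 χ.le_one
      · have : χ η = 0 := χ.zero_of_le_dist (by
          have := Metric.mem_closedBall.not.1 hη
          exact (not_le.1 this).le)
        simp [this]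
    rw [← ofReal_norm] at h
    exact (ENNReal.ofReal_le_ofReal_iff (by positivity)).1 h
  have hsub : {x | t < ‖𝓕 Φ x‖} ⊆ {x | ENNReal.ofReal (t / 2) ^ 2 ≤ ‖𝓕 Φ₂ x‖ₑ ^ 2} := by
    intro x hx
    have hx' : t < ‖𝓕 Φ x‖ := hx
    rw [hF] at hx'
    have h2 := norm_add_le (𝓕 Φ₁ x) (𝓕 Φ₂ x)
    have h3 : t / 2 ≤ ‖𝓕 Φ₂ x‖ := by linarith [h1 x]
    change ENNReal.ofReal (t / 2) ^ 2 ≤ ‖𝓕 Φ₂ x‖ₑ ^ 2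
    refine pow_le_pow_left' ?_ 2
    rw [← ofReal_norm]
    exact ENNReal.ofReal_le_ofReal h3
  have hcheb := mul_meas_ge_le_lintegral (μ := volume) (f := fun x => ‖𝓕 Φ₂ x‖ₑ ^ 2)
    (by have := (𝓕 Φ₂).continuous; fun_prop) (ENNReal.ofReal (t / 2) ^ 2)
  rw [lintegral_enorm_sq_fourier] at hcheb
  have hΦ₂ : ∫⁻ x, ‖Φ₂ x‖ₑ ^ 2 ≤ ∫⁻ η in {η | R ≤ ‖η‖}, ‖Φ η‖ₑ ^ 2 := by
    rw [← lintegral_indicator (measurableSet_le measurable_const measurable_norm)]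
    refine lintegral_mono fun η => ?_
    have hη2 : Φ₂ η = ((1 - χ η : ℝ) : ℂ) * Φ η := by
      change Φ η - Φ₁ η = _
      rw [hΦ₁]; push_cast; ring
    by_cases hη : R ≤ ‖η‖
    · rw [Set.indicator_of_mem (show η ∈ {η | R ≤ ‖η‖} from hη)]
      refine pow_le_pow_left' ?_ 2
      rw [hη2, enorm_mul]
      refine mul_le_of_le_one_left zero_le ?_
      rw [← ofReal_norm, Complex.norm_of_nonneg (by linarith [χ.le_one (x := η)])]
      exact ENNReal.ofReal_le_one.2 (by linarith [χ.nonneg (x := η)])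
    · have : χ η = 1 := χ.one_of_mem_closedBall (by
        simpa [χ] using (not_le.1 hη).le)
      simp [hη2, this]
  have hc : ENNReal.ofReal (4 * t ^ (-2 : ℝ)) * ENNReal.ofReal (t / 2) ^ 2 = 1 := by
    rw [← ENNReal.ofReal_pow (by positivity), ← ENNReal.ofReal_mul (by positivity)]
    rw [Real.rpow_neg ht.le, Real.rpow_ofNat]
    rw [show 4 * (t ^ 2)⁻¹ * (t / 2) ^ 2 = 1 by field_simp; norm_num, ENNReal.ofReal_one]
  calc volume {x | t < ‖𝓕 Φ x‖}
      ≤ volume {x | ENNReal.ofReal (t / 2) ^ 2 ≤ ‖𝓕 Φ₂ x‖ₑ ^ 2} := measure_mono hsub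
    _ = ENNReal.ofReal (4 * t ^ (-2 : ℝ)) * (ENNReal.ofReal (t / 2) ^ 2 *
        volume {x | ENNReal.ofReal (t / 2) ^ 2 ≤ ‖𝓕 Φ₂ x‖ₑ ^ 2}) := by
      rw [← mul_assoc, hc, one_mul]
    _ ≤ _ := by
      gcongr
      exact hcheb.trans hΦ₂

lemma setLIntegral_Ioc_rpow {p T : ℝ} (hp : -1 < p) (hT : 0 ≤ T) :
    ∫⁻ t in Set.Ioc 0 T, ENNReal.ofReal (t ^ p) = ENNReal.ofReal (T ^ (p + 1) / (p + 1)) := by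
  rw [← ofReal_integral_eq_lintegral_ofReal, ← intervalIntegral.integral_of_le hT,
    integral_rpow (Or.inl hp), Real.zero_rpow (by linarith), sub_zero]
  · exact (intervalIntegrable_iff_integrableOn_Ioc_of_le hT).1
      (intervalIntegral.intervalIntegrable_rpow' hp)
  · filter_upwards [ae_restrict_mem measurableSet_Ioc] with t ht
    exact Real.rpow_nonneg ht.1.le _

lemma setLIntegral_enorm_closedBall_le {n : ℕ} (hn : 1 ≤ n) {σ : ℝ}
    (Φ : 𝓢(EuclideanSpace ℝ (Fin n), ℂ)) {R : ℝ} (hR : 0 < R) :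
    (∫⁻ η in Metric.closedBall 0 R, ‖Φ η‖ₑ) ^ 2 ≤
      (ENNReal.ofReal (R ^ (n - σ)) *
        ∫⁻ x : EuclideanSpace ℝ (Fin n), ENNReal.ofReal (radialMin n (n - σ) x)) *
      ∫⁻ η, ENNReal.ofReal (‖η‖ ^ σ) * ‖Φ η‖ₑ ^ 2 := by
  have : Nonempty (Fin n) := ⟨⟨0, hn⟩⟩
  refine (lintegral_sq_le_mul_lintegral_weight (w := fun η => ‖η‖ ^ σ) (by fun_prop) ?_
    (by have := Φ.continuous; fun_prop)).trans ?_
  · filter_upwards [ae_restrict_of_ae (Measure.ae_ne volume 0)] with x hx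
    exact Real.rpow_pos_of_pos (norm_pos_iff.2 hx) _
  · exact mul_le_mul' (setLIntegral_norm_rpow_neg_le hn hR) (setLIntegral_le_lintegral _ _)

lemma lintegral_rpow_le_of_level {n : ℕ} {q s B : ℝ} (hq : 2 < q) (hs : 0 < s) (hB : 0 < B)
    (Φ : 𝓢(EuclideanSpace ℝ (Fin n), ℂ))
    (hlevel : ∀ t, 0 < t → volume {x | t < ‖𝓕 Φ x‖} ≤ ENNReal.ofReal (4 * t ^ (-2 : ℝ)) *
      ∫⁻ η in {η | (t / B) ^ (1 / s) / 2 ≤ ‖η‖}, ‖Φ η‖ₑ ^ 2) :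
    ∫⁻ x, ‖𝓕 Φ x‖ₑ ^ q ≤ ENNReal.ofReal (q * (4 * (B ^ (q - 2) * 2 ^ (s * (q - 2)) / (q - 2)))) *
      ∫⁻ η, ENNReal.ofReal (‖η‖ ^ (s * (q - 2))) * ‖Φ η‖ₑ ^ 2 := by
  have hΦc := Φ.continuous
  have hlc : ∫⁻ x, ‖𝓕 Φ x‖ₑ ^ q = ENNReal.ofReal q * ∫⁻ t in Set.Ioi 0,
      volume {x | t < ‖𝓕 Φ x‖} * ENNReal.ofReal (t ^ (q - 1)) := by
    rw [← lintegral_rpow_eq_lintegral_meas_lt_mul volume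
      (Filter.Eventually.of_forall fun x => norm_nonneg _)
      (by have := (𝓕 Φ).continuous; fun_prop) (by linarith)]
    refine lintegral_congr fun x => ?_
    rw [← ofReal_norm, ENNReal.ofReal_rpow_of_nonneg (norm_nonneg _) (by linarith)]
  have hmeas : Measurable (fun p : ℝ × EuclideanSpace ℝ (Fin n) =>
      ENNReal.ofReal (4 * p.1 ^ (q - 3)) *
        Set.indicator {p : ℝ × EuclideanSpace ℝ (Fin n) | (p.1 / B) ^ (1 / s) / 2 ≤ ‖p.2‖}
          (fun p => ‖Φ p.2‖ₑ ^ 2) p) := by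
    refine Measurable.mul (by fun_prop) (Measurable.indicator
      ((hΦc.measurable.comp measurable_snd).enorm.pow_const 2) ?_)
    exact measurableSet_le (by fun_prop) (by fun_prop)
  have hstep : ∫⁻ t in Set.Ioi 0, volume {x | t < ‖𝓕 Φ x‖} * ENNReal.ofReal (t ^ (q - 1)) ≤
      ∫⁻ t in Set.Ioi (0 : ℝ), ∫⁻ η, ENNReal.ofReal (4 * t ^ (q - 3)) *
        Set.indicator {p : ℝ × EuclideanSpace ℝ (Fin n) | (p.1 / B) ^ (1 / s) / 2 ≤ ‖p.2‖}
          (fun p => ‖Φ p.2‖ₑ ^ 2) (t, η) := by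
    refine setLIntegral_mono' measurableSet_Ioi fun t ht => ?_
    have ht' : 0 < t := ht
    rw [lintegral_const_mul' _ _ ENNReal.ofReal_ne_top]
    have hset : MeasurableSet {η : EuclideanSpace ℝ (Fin n) | (t / B) ^ (1 / s) / 2 ≤ ‖η‖} :=
      measurableSet_le (by fun_prop) (by fun_prop)
    have h := hlevel t ht'
    rw [← lintegral_indicator hset] at h
    calc _ ≤ _ := mul_le_mul_left h _
      _ = _ := by
        rw [mul_right_comm, ← ENNReal.ofReal_mul (by positivity)]
        congr 2
        rw [mul_assoc, ← Real.rpow_add ht']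
        ring_nf
  rw [hlc, ENNReal.ofReal_mul (by linarith), mul_assoc]
  refine mul_le_mul_right (hstep.trans ?_) _
  rw [lintegral_lintegral_swap hmeas.aemeasurable, ← lintegral_const_mul' _ _ ENNReal.ofReal_ne_top]
  refine lintegral_mono fun η => ?_
  have hT : 0 ≤ B * (2 * ‖η‖) ^ s := by positivity
  calc _ ≤ ∫⁻ t in Set.Ioi (0 : ℝ), (Set.Ioc 0 (B * (2 * ‖η‖) ^ s)).indicator
          (fun t => ENNReal.ofReal 4 * ‖Φ η‖ₑ ^ 2 * ENNReal.ofReal (t ^ (q - 3))) t := by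
        refine setLIntegral_mono' measurableSet_Ioi fun t ht => ?_
        have ht' : 0 < t := ht
        by_cases h : (t / B) ^ (1 / s) / 2 ≤ ‖η‖
        · have hle : t ≤ B * (2 * ‖η‖) ^ s := by
            have h1 : (t / B) ^ (1 / s) ≤ 2 * ‖η‖ := by linarith
            have h2 := Real.rpow_le_rpow (by positivity) h1 hs.le
            rw [← Real.rpow_mul (by positivity), one_div_mul_cancel hs.ne', Real.rpow_one,
              div_le_iff₀ hB] at h2
            linarith
          rw [Set.indicator_of_mem (show (t, η) ∈ {p : ℝ × EuclideanSpace ℝ (Fin n) |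
            (p.1 / B) ^ (1 / s) / 2 ≤ ‖p.2‖} from h), Set.indicator_of_mem (Set.mem_Ioc.2 ⟨ht', hle⟩),
            ENNReal.ofReal_mul (by norm_num), mul_right_comm]
        · rw [Set.indicator_of_notMem (show (t, η) ∉ {p : ℝ × EuclideanSpace ℝ (Fin n) |
            (p.1 / B) ^ (1 / s) / 2 ≤ ‖p.2‖} from h), mul_zero]
          exact zero_le
    _ ≤ ∫⁻ t, (Set.Ioc 0 (B * (2 * ‖η‖) ^ s)).indicator
          (fun t => ENNReal.ofReal 4 * ‖Φ η‖ₑ ^ 2 * ENNReal.ofReal (t ^ (q - 3))) t :=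
        setLIntegral_le_lintegral _ _
    _ = _ := by
        rw [lintegral_indicator measurableSet_Ioc, lintegral_const_mul' _ _ (by finiteness),
          setLIntegral_Ioc_rpow (by linarith) hT, mul_right_comm, ← mul_assoc,
          ← ENNReal.ofReal_mul (by norm_num), ← ENNReal.ofReal_mul (by
            have : 0 < q - 2 := by linarith
            positivity)]
        congr 2
        rw [show q - 3 + 1 = q - 2 by ring, Real.mul_rpow hB.le (by positivity),
          ← Real.rpow_mul (by positivity), Real.mul_rpow (by norm_num) (norm_nonneg _)]
        ring

/-- The Sobolev embedding of `Ḣ^(σ/2)` into `L^q`, in terms of the Fourier transform. -/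
lemma exists_sobolev_le {n : ℕ} (hn : 1 ≤ n) {q σ : ℝ} (hq : 2 ≤ q)
    (hσ : σ = n - 2 * n / q) :
    ∃ C : ℝ≥0∞, C ≠ ⊤ ∧ ∀ (Φ : 𝓢(EuclideanSpace ℝ (Fin n), ℂ)) (A : ℝ), 0 < A →
      ∫⁻ η, ENNReal.ofReal (‖η‖ ^ σ) * ‖Φ η‖ₑ ^ 2 ≤ ENNReal.ofReal A →
      (∫⁻ x, ‖𝓕 Φ x‖ₑ ^ q) ^ (2 / q) ≤ C * ENNReal.ofReal A := by
  have hn0 : (0 : ℝ) < n := by exact_mod_cast hn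
  rcases hq.eq_or_lt with rfl | hq
  · refine ⟨1, ENNReal.one_ne_top, fun Φ A _ h => ?_⟩
    have hσ0 : σ = 0 := by rw [hσ]; ring
    simp only [hσ0, Real.rpow_zero, ENNReal.ofReal_one, one_mul] at h
    simpa [lintegral_enorm_sq_fourier] using h
  have hs : 0 < n / q := by positivity
  have hnσ : n - σ = 2 * (n / q) := by rw [hσ]; ring
  have hsσ : n / q * (q - 2) = σ := by rw [hσ]; field_simp
  have hK : ∫⁻ x : EuclideanSpace ℝ (Fin n), ENNReal.ofReal (radialMin n (n - σ) x) ≠ ⊤ :=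
    (integrable_radialMin hn (by rw [hnσ]; positivity)).lintegral_lt_top.ne
  set K := (∫⁻ x : EuclideanSpace ℝ (Fin n), ENNReal.ofReal (radialMin n (n - σ) x)).toReal
  have hK0 : 0 ≤ K := ENNReal.toReal_nonneg
  set c := q * (4 * ((4 * (K + 1)) ^ ((q - 2) / 2) * 2 ^ σ / (q - 2)))
  have hq2 : 0 < q - 2 := by linarith
  have hc : 0 ≤ c := by positivity
  refine ⟨ENNReal.ofReal (c ^ (2 / q)), ENNReal.ofReal_ne_top, fun Φ A hA h => ?_⟩
  set B := √(4 * (K + 1) * A)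
  have hBpos : 0 < 4 * (K + 1) * A := by positivity
  have hB : 0 < B := Real.sqrt_pos.2 hBpos
  have hB2 : B ^ 2 = 4 * (K + 1) * A := Real.sq_sqrt hBpos.le
  have hBq : B ^ (q - 2) = (4 * (K + 1)) ^ ((q - 2) / 2) * A ^ ((q - 2) / 2) := by
    rw [← Real.mul_rpow (by positivity) hA.le, ← hB2, ← Real.rpow_natCast, ← Real.rpow_mul hB.le]
    congr 1
    push_cast
    ring
  have hlevel : ∀ t, 0 < t → volume {x | t < ‖𝓕 Φ x‖} ≤ ENNReal.ofReal (4 * t ^ (-2 : ℝ)) *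
      ∫⁻ η in {η | (t / B) ^ (1 / (n / q)) / 2 ≤ ‖η‖}, ‖Φ η‖ₑ ^ 2 := by
    intro t ht
    refine volume_lt_norm_fourier_le Φ ht (by positivity) ?_
    rw [← ENNReal.pow_le_pow_left_iff two_ne_zero]
    refine (setLIntegral_enorm_closedBall_le (σ := σ) hn Φ (by positivity)).trans ?_
    calc _ ≤ _ := mul_le_mul_right h _
      _ ≤ _ := by
        rw [← ENNReal.ofReal_toReal hK, ← ENNReal.ofReal_mul (by positivity),
          ← ENNReal.ofReal_mul (by positivity), ← ENNReal.ofReal_pow (by positivity)]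
        refine ENNReal.ofReal_le_ofReal ?_
        change _ * K * A ≤ _
        rw [mul_div_cancel₀ _ (two_ne_zero), hnσ, ← Real.rpow_mul (by positivity),
          show 1 / (n / q) * (2 * (n / q)) = (2 : ℕ) by field_simp; norm_num, Real.rpow_natCast,
          div_pow, hB2, div_pow, mul_assoc, div_mul_eq_mul_div, div_le_div_iff₀ hBpos (by norm_num)]
        nlinarith [mul_pos (pow_pos ht 2) hA]
  have hmain := lintegral_rpow_le_of_level hq hs hB Φ hlevel
  rw [hsσ] at hmain
  calc (∫⁻ x, ‖𝓕 Φ x‖ₑ ^ q) ^ (2 / q)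
      ≤ (ENNReal.ofReal (c * A ^ (q / 2))) ^ (2 / q) := by
        refine ENNReal.rpow_le_rpow ((hmain.trans (mul_le_mul_right h _)).trans_eq ?_)
          (by positivity)
        rw [← ENNReal.ofReal_mul (by positivity)]
        congr 1
        rw [hBq, show q / 2 = (q - 2) / 2 + 1 by ring, Real.rpow_add hA, Real.rpow_one]
        simp only [c]
        ring
    _ = _ := by
        rw [ENNReal.ofReal_rpow_of_nonneg (by positivity) (by positivity),
          Real.mul_rpow hc (by positivity), ← Real.rpow_mul hA.le,
          div_mul_div_cancel₀ two_ne_zero, div_self (by positivity), Real.rpow_one,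
          ENNReal.ofReal_mul (by positivity)]

lemma integrable_schwartz_pi {m n : ℕ} (g : 𝓢(Fin m → EuclideanSpace ℝ (Fin n), ℂ)) :
    Integrable g := by
  have : (volume : Measure (Fin m → EuclideanSpace ℝ (Fin n))).HasTemperateGrowth :=
    Measure.IsAddHaarMeasure.instHasTemperateGrowth
  exact g.integrable

/-- The sum-fibre parametrization of `(ℝ^n)^(M+1)` preserves Lebesgue measure. -/
lemma measurePreserving_fiberPoint (n M : ℕ) :
    MeasurePreserving (fun p : EuclideanSpace ℝ (Fin n) × (Fin M → EuclideanSpace ℝ (Fin n)) =>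
      fiberPoint 0 p.1 p.2) := by
  refine ⟨(continuous_fiberPoint 0).measurable, Measure.ext fun s hs => ?_⟩
  have hT := (continuous_fiberPoint (X := EuclideanSpace ℝ (Fin n)) (M := M) 0).measurable
  have h1 : Measurable (s.indicator (1 : (Fin (M + 1) → EuclideanSpace ℝ (Fin n)) → ℝ≥0∞)) :=
    measurable_one.indicator hs
  rw [← lintegral_indicator_one hs, ← lintegral_indicator_one hs, lintegral_map h1 hT,
    Measure.volume_eq_prod,
    lintegral_prod (fun p => s.indicator 1 (fiberPoint 0 p.1 p.2)) (h1.comp hT).aemeasurable]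
  exact lintegral_lintegral_fiberPoint h1

lemma norm_le_norm_fiberPoint {n M : ℕ} (η : EuclideanSpace ℝ (Fin n))
    (y : Fin M → EuclideanSpace ℝ (Fin n)) : ‖y‖ ≤ ‖fiberPoint 0 η y‖ := by
  refine (pi_norm_le_iff_of_nonneg (norm_nonneg _)).2 fun j => ?_
  have := norm_le_pi_norm (fiberPoint 0 η y) j.succ
  simpa [fiberPoint] using this

/-- Integrating a Schwartz function over the sum fibres gives a continuous function. -/
lemma continuous_integral_fiberPoint {n M : ℕ}
    (g : 𝓢(Fin (M + 1) → EuclideanSpace ℝ (Fin n), ℂ)) :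
    Continuous fun η => ∫ y : Fin M → EuclideanSpace ℝ (Fin n), g (fiberPoint 0 η y) := by
  let d := Module.finrank ℝ (Fin M → EuclideanSpace ℝ (Fin n))
  let C := 2 ^ (d + 1) * ((Finset.Iic (d + 1, 0)).sup fun p => SchwartzMap.seminorm ℝ p.1 p.2) g
  have hT (η) : Continuous fun y : Fin M → EuclideanSpace ℝ (Fin n) => fiberPoint 0 η y :=
    (continuous_fiberPoint 0).comp (by fun_prop : Continuous fun y => (η, y))
  have hT' (y : Fin M → EuclideanSpace ℝ (Fin n)) :
      Continuous fun η : EuclideanSpace ℝ (Fin n) => fiberPoint 0 η y :=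
    (continuous_fiberPoint 0).comp (by fun_prop : Continuous fun η => (η, y))
  refine continuous_of_dominated (bound := fun y => C * (1 + ‖y‖) ^ (-((d + 1 : ℕ) : ℝ)))
    (fun η => (g.continuous.comp (hT η)).aestronglyMeasurable)
    (fun η => Filter.Eventually.of_forall fun y => ?_) ?_
    (Filter.Eventually.of_forall fun y => g.continuous.comp (hT' y))
  · have h := SchwartzMap.one_add_le_sup_seminorm_apply (𝕜 := ℝ) (m := (d + 1, 0)) le_rfl le_rfl g
      (fiberPoint 0 η y)
    rw [norm_iteratedFDeriv_zero] at h
    rw [Real.rpow_neg (by positivity), Real.rpow_natCast, ← div_eq_mul_inv,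
      le_div_iff₀ (by positivity), mul_comm]
    refine le_trans ?_ h
    gcongr
    exact norm_le_norm_fiberPoint η y
  · refine (integrable_one_add_norm ?_).const_mul C
    push_cast
    exact lt_add_one _

/-- The diagonal restriction of a Schwartz function is the Fourier transform of a Schwartz
function, dominated by the fibre integrals of the Fourier transform. -/
lemma exists_schwartz_fourier_diagonal {n M : ℕ}
    (f : 𝓢(Fin (M + 1) → EuclideanSpace ℝ (Fin n), ℂ))
    (g : 𝓢(Fin (M + 1) → EuclideanSpace ℝ (Fin n), ℂ))
    (hfg : ∀ x, f x = ∫ ξ, 𝐞 (-∑ k, ⟪ξ k, x k⟫_ℝ) • g ξ) :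
    ∃ Φ : 𝓢(EuclideanSpace ℝ (Fin n), ℂ), (∀ x, 𝓕 Φ x = f fun _ => x) ∧
      ∀ η, ‖Φ η‖ₑ ≤ ∫⁻ y : Fin M → EuclideanSpace ℝ (Fin n), ‖g (fiberPoint 0 η y)‖ₑ := by
  let L : EuclideanSpace ℝ (Fin n) →L[ℝ] (Fin (M + 1) → EuclideanSpace ℝ (Fin n)) :=
    ContinuousLinearMap.pi fun _ => ContinuousLinearMap.id ℝ _
  have hL : AntilipschitzWith 1 L := by
    refine AntilipschitzWith.of_le_mul_dist fun x y => ?_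
    rw [NNReal.coe_one, one_mul]
    exact dist_le_pi_dist (L x) (L y) 0
  let F : 𝓢(EuclideanSpace ℝ (Fin n), ℂ) :=
    SchwartzMap.compCLMOfAntilipschitz ℝ L.hasTemperateGrowth hL f
  have hF x : F x = f fun _ => x := rfl
  let G : EuclideanSpace ℝ (Fin n) → ℂ :=
    fun η => ∫ y : Fin M → EuclideanSpace ℝ (Fin n), g (fiberPoint 0 η y)
  have hmp := measurePreserving_fiberPoint n M
  have hgi : Integrable g := integrable_schwartz_pi g
  have hgT : Integrable (fun p : EuclideanSpace ℝ (Fin n) × (Fin M → EuclideanSpace ℝ (Fin n)) =>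
      g (fiberPoint 0 p.1 p.2)) := hmp.integrable_comp_of_integrable hgi
  have hFG x : 𝓕 G x = F x := by
    have hH : Continuous fun ξ : Fin (M + 1) → EuclideanSpace ℝ (Fin n) =>
        𝐞 (-∑ k, ⟪ξ k, x⟫_ℝ) • g ξ := by
      have := g.continuous
      have := Real.continuous_fourierChar
      fun_prop
    rw [hF, hfg, ← hmp.map_eq, integral_map hmp.aemeasurable hH.aestronglyMeasurable,
      Measure.volume_eq_prod, integral_prod, Real.fourier_eq]
    · refine integral_congr_ae (Filter.Eventually.of_forall fun η => ?_)
      simp only [G]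
      rw [Circle.smul_def, ← integral_smul]
      refine integral_congr_ae (Filter.Eventually.of_forall fun y => ?_)
      simp only
      rw [← sum_inner, sum_fiberPoint, Circle.smul_def]
    · refine (hmp.integrable_comp_of_integrable (g := fun ξ => 𝐞 (-∑ k, ⟪ξ k, x⟫_ℝ) • g ξ) ?_)
      refine hgi.mono hH.aestronglyMeasurable (Filter.Eventually.of_forall fun ξ => ?_)
      rw [Circle.norm_smul]
  have hG : Integrable G := hgT.integral_prod_left
  have hFG' : 𝓕 G = F := funext hFG
  have hΦ : 𝓕⁻ (F : EuclideanSpace ℝ (Fin n) → ℂ) = G := by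
    rw [← hFG']
    exact (continuous_integral_fiberPoint g).fourierInv_fourier_eq hG (hFG' ▸ F.integrable)
  refine ⟨𝓕⁻ F, fun x => ?_, fun η => ?_⟩
  · rw [FourierTransform.fourier_fourierInv_eq, hF]
  · rw [SchwartzMap.fourierInv_coe, hΦ]
    exact enorm_integral_le_lintegral_enorm _

lemma lintegral_trWeight_mul {m n : ℕ} (α : Fin m → ℝ) {r : ℝ} (hr : 0 < r)
    {u : (Fin m → EuclideanSpace ℝ (Fin n)) → ℝ≥0∞} (hu : Measurable u) :
    ∫⁻ ξ, ENNReal.ofReal (trWeight α r ξ) * u ξ = (∫⁻ ξ, u ξ) +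
      ENNReal.ofReal (r ^ (-∑ k, α k)) * ∫⁻ ξ, (∏ k, ENNReal.ofReal (‖ξ k‖ ^ α k)) * u ξ := by
  rw [← lintegral_const_mul' _ _ ENNReal.ofReal_ne_top, ← lintegral_add_left hu]
  refine lintegral_congr fun ξ => ?_
  rw [trWeight, ENNReal.ofReal_add one_pos.le (by positivity), ENNReal.ofReal_one,
    ENNReal.ofReal_mul (by positivity), ENNReal.ofReal_prod_of_nonneg fun _ _ => by positivity]
  ring

/-- The weighted `L²` norm of fibre integrals is controlled at every scale `r`. -/
lemma exists_lintegral_norm_rpow_mul_le {M n : ℕ} (hn : 1 ≤ n) (α : Fin (M + 1) → ℝ)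
    (hα : ∀ k, 0 < α k ∧ α k < n) {θ : ℝ} (hθ : 0 < θ) (hθ1 : θ < 1) {σ : ℝ} (hσ0 : 0 ≤ σ)
    (hσ : σ = θ * ∑ k, α k - M * n) :
    ∃ C : ℝ≥0∞, C ≠ ⊤ ∧ ∀ (g : 𝓢(Fin (M + 1) → EuclideanSpace ℝ (Fin n), ℂ))
      (Φ : EuclideanSpace ℝ (Fin n) → ℂ),
      (∀ η, ‖Φ η‖ₑ ≤ ∫⁻ y : Fin M → EuclideanSpace ℝ (Fin n), ‖g (fiberPoint 0 η y)‖ₑ) →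
      ∀ r : ℝ, 0 < r → ∫⁻ η, ENNReal.ofReal (‖η‖ ^ σ) * ‖Φ η‖ₑ ^ 2 ≤
        C * ENNReal.ofReal (r ^ (θ * ∑ k, α k)) * ((∫⁻ ξ, ‖g ξ‖ₑ ^ 2) +
          ENNReal.ofReal (r ^ (-∑ k, α k)) *
            ∫⁻ ξ, (∏ k, ENNReal.ofReal (‖ξ k‖ ^ α k)) * ‖g ξ‖ₑ ^ 2) := by
  have : Nonempty (Fin n) := ⟨⟨0, hn⟩⟩
  obtain ⟨C, hC, H⟩ := exists_lintegral_fiberPoint_le hn α hα hθ hθ1 hσ0 hσ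
  refine ⟨C, hC, fun g Φ hΦ r hr => ?_⟩
  have hg : Measurable g := g.continuous.measurable
  have hw : Measurable (trWeight α r : (Fin (M + 1) → EuclideanSpace ℝ (Fin n)) → ℝ) :=
    measurable_trWeight α r
  have hg2 : Measurable fun ξ => ‖g ξ‖ₑ ^ 2 := hg.enorm.pow_const 2
  have hT (η : EuclideanSpace ℝ (Fin n)) :
      Measurable fun y : Fin M → EuclideanSpace ℝ (Fin n) => fiberPoint 0 η y :=
    (continuous_fiberPoint 0).measurable.comp measurable_prodMk_left
  have hCr : C * ENNReal.ofReal (r ^ (θ * ∑ k, α k)) ≠ ⊤ :=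
    ENNReal.mul_ne_top hC ENNReal.ofReal_ne_top
  rw [← lintegral_trWeight_mul α hr hg2,
    ← lintegral_lintegral_fiberPoint (H := fun ξ => ENNReal.ofReal (trWeight α r ξ) * ‖g ξ‖ₑ ^ 2)
      (hw.ennreal_ofReal.mul hg2),
    ← lintegral_const_mul' _ _ hCr]
  refine lintegral_mono_ae ?_
  filter_upwards [Measure.ae_ne volume 0] with η hη
  have hcs := lintegral_sq_le_mul_lintegral_weight (μ := volume)
    (w := fun y => trWeight α r (fiberPoint 0 η y)) (hw.comp (hT η))
    (Filter.Eventually.of_forall fun y => one_pos.trans_le (one_le_trWeight α hr _))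
    (g := fun y => ‖g (fiberPoint 0 η y)‖ₑ) (hg.comp (hT η)).enorm
  calc _ ≤ ENNReal.ofReal (‖η‖ ^ σ) * _ :=
        mul_le_mul_right ((pow_le_pow_left' (hΦ η) 2).trans hcs) _
    _ ≤ _ := by
        rw [← mul_assoc]
        exact mul_le_mul_left (H r hr η hη) _

lemma lintegral_enorm_sq_schwartz_ne_top {m n : ℕ}
    (f : 𝓢(Fin m → EuclideanSpace ℝ (Fin n), ℂ)) : ∫⁻ x, ‖f x‖ₑ ^ 2 ≠ ⊤ := by
  have : (volume : Measure (Fin m → EuclideanSpace ℝ (Fin n))).HasTemperateGrowth :=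
    Measure.IsAddHaarMeasure.instHasTemperateGrowth
  have h := (f.memLp 2).eLpNorm_lt_top
  rw [eLpNorm_lt_top_iff_lintegral_rpow_enorm_lt_top two_ne_zero ENNReal.ofNat_ne_top] at h
  simpa using h.ne

lemma eq_zero_of_lintegral_enorm_sq_eq_zero {m n : ℕ}
    (f : 𝓢(Fin m → EuclideanSpace ℝ (Fin n), ℂ)) (h : ∫⁻ x, ‖f x‖ₑ ^ 2 = 0) (x) : f x = 0 := by
  rw [lintegral_eq_zero_iff (f.continuous.measurable.enorm.pow_const 2)] at h
  have h0 : (f : _ → ℂ) =ᵐ[volume] fun _ => 0 := by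
    filter_upwards [h] with x hx
    simpa using hx
  exact congrFun (Continuous.ae_eq_iff_eq volume f.continuous continuous_const |>.1 h0) x

lemma lintegral_enorm_sq_eq_zero_of_weighted {m n : ℕ} (hn : 1 ≤ n) (α : Fin m → ℝ)
    (g : 𝓢(Fin m → EuclideanSpace ℝ (Fin n), ℂ))
    (h : ∫⁻ ξ, (∏ k, ENNReal.ofReal (‖ξ k‖ ^ α k)) * ‖g ξ‖ₑ ^ 2 = 0) :
    ∫⁻ ξ, ‖g ξ‖ₑ ^ 2 = 0 := by
  have hg2 : Measurable fun ξ => ‖g ξ‖ₑ ^ 2 := g.continuous.measurable.enorm.pow_const 2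
  rw [lintegral_eq_zero_iff (by fun_prop)] at h
  rw [lintegral_eq_zero_iff hg2]
  filter_upwards [h, ae_pi_ne_zero hn] with ξ hξ hne
  refine (mul_eq_zero.1 hξ).resolve_left (Finset.prod_ne_zero_iff.2 fun k _ => ?_)
  exact (ENNReal.ofReal_pos.2 (Real.rpow_pos_of_pos (norm_pos_iff.2 (hne k)) _)).ne'

lemma scale_optimization {a b s θ : ℝ} (ha : 0 < a) (hb : 0 < b) (hs : 0 < s) :
    ((b / a) ^ (1 / s)) ^ (θ * s) * (a + ((b / a) ^ (1 / s)) ^ (-s) * b) =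
      2 * (a ^ (1 - θ) * b ^ θ) := by
  have hba : 0 < b / a := div_pos hb ha
  rw [← Real.rpow_mul hba.le, ← Real.rpow_mul hba.le, show 1 / s * (θ * s) = θ by field_simp,
    show 1 / s * -s = -1 by field_simp, Real.rpow_neg_one, Real.div_rpow hb.le ha.le,
    Real.rpow_sub ha, Real.rpow_one]
  field_simp
  norm_num

lemma exists_trace_le {M n : ℕ} (hn : 1 ≤ n) (α : Fin (M + 1) → ℝ)
    (hα : ∀ k, 0 < α k ∧ α k < n) {θ : ℝ} (hθ : 0 < θ) (hθ1 : θ < 1) {q : ℝ} (hq : 2 ≤ q)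
    (hσ : n - 2 * n / q = θ * ∑ k, α k - M * n) :
    ∃ D : ℝ≥0∞, D ≠ ⊤ ∧ ∀ f : 𝓢(Fin (M + 1) → EuclideanSpace ℝ (Fin n), ℂ),
      (∫⁻ x, ‖f fun _ => x‖ₑ ^ q) ^ (2 / q) ≤
        D * (∫⁻ x, ‖f x‖ₑ ^ 2) ^ (1 - θ) * LamM (fun x => f x) α ^ θ := by
  have hn0 : (0 : ℝ) < n := by exact_mod_cast hn
  have hq0 : 0 < q := by linarith
  have hs : 0 < ∑ k, α k := Finset.sum_pos (fun k _ => (hα k).1) Finset.univ_nonempty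
  have hσ0 : 0 ≤ n - 2 * n / q := by
    rw [sub_nonneg, div_le_iff₀ hq0]
    nlinarith
  obtain ⟨C₁, hC₁, hsob⟩ := exists_sobolev_le (σ := n - 2 * n / q) hn hq rfl
  obtain ⟨C₂, hC₂, htr⟩ := exists_lintegral_norm_rpow_mul_le hn α hα hθ hθ1 hσ0 hσ
  refine ⟨(C₁ + 1) * ((C₂ + 1) * 2), by finiteness, fun f => ?_⟩
  obtain ⟨g, hfg, hpl, hinv⟩ := exists_schwartz_fourierM f
  obtain ⟨Φ, hΦ, hΦle⟩ := exists_schwartz_fourier_diagonal f g hinv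
  have hLam : LamM (fun x => f x) α =
      ∫⁻ ξ, (∏ k, ENNReal.ofReal (‖ξ k‖ ^ α k)) * ‖g ξ‖ₑ ^ 2 := by
    simp only [LamM, hfg, enorm_eq_nnnorm]
  have ha_top := lintegral_enorm_sq_schwartz_ne_top f
  have htr' := htr g Φ hΦle
  rw [← hLam, ← hpl] at htr'
  rcases eq_or_ne (∫⁻ x, ‖f x‖ₑ ^ 2) 0 with ha0 | ha0
  · have hf := eq_zero_of_lintegral_enorm_sq_eq_zero f ha0
    simp [hf, hq0]
  have hb0 : LamM (fun x => f x) α ≠ 0 := fun hb => ha0 <| by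
    rw [hpl]
    exact lintegral_enorm_sq_eq_zero_of_weighted hn α g (hLam ▸ hb)
  rcases eq_or_ne (LamM (fun x => f x) α) ⊤ with hbt | hbt
  · rw [hbt, ENNReal.top_rpow_of_pos hθ, ENNReal.mul_top]
    · exact le_top
    · refine mul_ne_zero (by simp) ?_
      exact (ENNReal.rpow_pos (pos_iff_ne_zero.2 ha0) ha_top).ne'
  generalize hb_def : LamM (fun x => f x) α = b at *
  generalize ha_def : ∫⁻ x, ‖f x‖ₑ ^ 2 = a at *
  lift a to NNReal using ha_top
  lift b to NNReal using hbt
  lift C₂ to NNReal using hC₂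
  have ha : (0 : ℝ) < a := by
    exact_mod_cast pos_iff_ne_zero.2 ha0
  have hb : (0 : ℝ) < b := by
    exact_mod_cast pos_iff_ne_zero.2 hb0
  have hr : 0 < ((b : ℝ) / a) ^ (1 / ∑ k, α k) := by positivity
  have hbound : ∫⁻ η, ENNReal.ofReal (‖η‖ ^ (n - 2 * n / q)) * ‖Φ η‖ₑ ^ 2 ≤
      ENNReal.ofReal ((C₂ + 1) * (2 * ((a : ℝ) ^ (1 - θ) * (b : ℝ) ^ θ))) := by
    refine (htr' _ hr).trans ?_
    rw [← scale_optimization ha hb hs, ENNReal.ofReal_mul (by positivity),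
      ENNReal.ofReal_mul (by positivity), ENNReal.ofReal_add ha.le (by positivity),
      ENNReal.ofReal_mul (by positivity), ENNReal.ofReal_coe_nnreal, ENNReal.ofReal_coe_nnreal,
      ENNReal.ofReal_add (by positivity) one_pos.le, ENNReal.ofReal_coe_nnreal,
      ENNReal.ofReal_one, ← mul_assoc]
    gcongr
    exact le_self_add
  have hfin := hsob Φ _ (by positivity) hbound
  simp only [hΦ] at hfin
  refine hfin.trans ?_
  rw [ENNReal.ofReal_mul (by positivity), ENNReal.ofReal_mul (by positivity),
    ENNReal.ofReal_mul (by positivity), ← ENNReal.ofReal_rpow_of_pos ha,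
    ← ENNReal.ofReal_rpow_of_pos hb, ENNReal.ofReal_coe_nnreal, ENNReal.ofReal_coe_nnreal,
    ENNReal.ofReal_add (by positivity) one_pos.le, ENNReal.ofReal_coe_nnreal,
    ENNReal.ofReal_one, ENNReal.ofReal_ofNat]
  calc _ ≤ (C₁ + 1) * (((C₂ : ℝ≥0∞) + 1) * (2 * ((a : ℝ≥0∞) ^ (1 - θ) * (b : ℝ≥0∞) ^ θ))) :=
        mul_le_mul_left le_self_add _
    _ = _ := by ring

lemma lintegral_fin_one_const {X : Type*} [MeasureSpace X] [SigmaFinite (volume : Measure X)]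
    (H : (Fin 1 → X) → ℝ≥0∞) : ∫⁻ x, H (fun _ => x) = ∫⁻ x, H x :=
  (volume_preserving_funUnique (Fin 1) X).symm.lintegral_comp_emb
    (MeasurableEquiv.measurableEmbedding _) H

/-- **Interpolated Gagliardo–Nirenberg trace inequality.**
For `0 < mn − α < n`, `2 ≤ q < 2n/(mn−α)` and `θ = (mn − 2n/q)/α`, there is a finite `D` with
`(∫ |f(x,…,x)|^q)^{2/q} ≤ D (∫ |f|²)^{1−θ} Λ(f; α)^θ` for all Schwartz `f`. -/
theorem stmt17 (m n : ℕ) (hm : 1 ≤ m) (hn : 1 ≤ n)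
    (α : Fin m → ℝ) (hα : ∀ k, 0 < α k ∧ α k < n)
    (hlow : 0 < (m : ℝ) * n - ∑ k, α k) (hhigh : (m : ℝ) * n - (∑ k, α k) < n)
    (q : ℝ) (hq2 : 2 ≤ q) (hq : q < 2 * n / ((m : ℝ) * n - ∑ k, α k))
    (θ : ℝ) (hθ : θ = ((m : ℝ) * n - 2 * n / q) / ∑ k, α k) :
    ∃ D : ℝ≥0∞, D ≠ ⊤ ∧
      ∀ f : SchwartzMap (Fin m → EuclideanSpace ℝ (Fin n)) ℂ,
        (∫⁻ x : EuclideanSpace ℝ (Fin n), (‖f (fun _ => x)‖₊ : ℝ≥0∞) ^ q) ^ (2 / q) ≤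
          D * (∫⁻ x : Fin m → EuclideanSpace ℝ (Fin n), (‖f x‖₊ : ℝ≥0∞) ^ (2 : ℕ)) ^ (1 - θ) *
            LamM (fun x => f x) α ^ θ := by
  obtain ⟨M, rfl⟩ : ∃ M, m = M + 1 := ⟨m - 1, by omega⟩
  simp only [← enorm_eq_nnnorm]
  have hn0 : (0 : ℝ) < n := by exact_mod_cast hn
  have hq0 : 0 < q := by linarith
  have hs : 0 < ∑ k, α k := Finset.sum_pos (fun k _ => (hα k).1) Finset.univ_nonempty
  have hθs : θ * ∑ k, α k = ((M + 1 : ℕ) : ℝ) * n - 2 * n / q := by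
    rw [hθ, div_mul_cancel₀ _ hs.ne']
  have hσ : n - 2 * n / q = θ * ∑ k, α k - M * n := by
    rw [hθs]
    push_cast
    ring
  have hθ1 : θ < 1 := by
    rw [lt_div_comm₀ hq0 hlow] at hq
    rw [hθ, div_lt_one hs]
    linarith
  have hnq : 2 * n / q ≤ n := by
    rw [div_le_iff₀ hq0]
    nlinarith
  have hMn : (0 : ℝ) ≤ M * n := by positivity
  have hθ0 : 0 ≤ θ := by
    refine nonneg_of_mul_nonneg_left ?_ hs
    linarith
  rcases hθ0.eq_or_lt with rfl | hθ0
  · rw [zero_mul] at hσ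
    have hM : M = 0 := by
      have : (M : ℝ) * n = 0 := by linarith
      simpa [hn0.ne'] using this
    subst hM
    have hq' : q = 2 := by
      have : 2 * n / q = n := by linarith
      rw [div_eq_iff hq0.ne'] at this
      nlinarith
    subst hq'
    refine ⟨1, ENNReal.one_ne_top, fun f => ?_⟩
    simpa using (lintegral_fin_one_const fun x => ‖f x‖ₑ ^ 2).le
  · exact exists_trace_le hn α hα hθ0 hθ1 hq2 hσ
end
end

section
/- (Sharp Hardy–Littlewood–Sobolev inequality on the sphere, bilinear form.) Let n ≥ 1, let 2 < q < ∞ and p = q/(q−1), and let dξ denote the rotation-invariant probability measure on the unit sphere S^n ⊂ ℝ^{n+1}. Then for every nonnegative measurable function G on S^n, ∫_{S^n × S^n} G(ξ) |ξ − η|^{−2n/q} G(η) dξ dη ≤ 2^{−2n/q} · [Γ(n)/Γ(n/2)] · [Γ(n/2 − n/q)/Γ(n/p)] · (∫_{S^n} G(ξ)^p dξ)^{2/p}, where |ξ − η| is the Euclidean (chordal) distance in ℝ^{n+1}; and this constant is the least possible. -/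
open MeasureTheory Real
open scoped ENNReal

noncomputable section

/-- The rotation-invariant probability measure on the unit sphere `S^n ⊂ ℝ^{n+1}`. -/
def sphereProb (n : ℕ) :
    Measure (Metric.sphere (0 : EuclideanSpace ℝ (Fin (n + 1))) 1) :=
  ((volume : Measure (EuclideanSpace ℝ (Fin (n + 1)))).toSphere Set.univ)⁻¹ •
    (volume : Measure (EuclideanSpace ℝ (Fin (n + 1)))).toSphere

section Development

open Set Filter Topology
open scoped RealInnerProductSpace

section Polar

variable {E : Type*} [NormedAddCommGroup E] [InnerProductSpace ℝ E] [FiniteDimensional ℝ E]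
  [MeasurableSpace E] [BorelSpace E]

/-- Integration in polar coordinates. -/
theorem lintegral_eq_lintegral_toSphere [Nontrivial E] (μ : Measure E) [μ.IsAddHaarMeasure]
    {g : E → ℝ≥0∞} (hg : Measurable g) :
    ∫⁻ x, g x ∂μ = ∫⁻ ξ : Metric.sphere (0 : E) 1, ∫⁻ s in Ioi (0 : ℝ),
      ENNReal.ofReal (s ^ (Module.finrank ℝ E - 1)) * g (s • (ξ : E)) ∂volume ∂μ.toSphere := by
  have h1 : ∫⁻ x, g x ∂μ = ∫⁻ x : ({(0 : E)}ᶜ : Set E), g x ∂(μ.comap (↑)) := by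
    rw [lintegral_subtype_comap (measurableSet_singleton _).compl, restrict_compl_singleton]
  have h2 := μ.measurePreserving_homeomorphUnitSphereProd.symm
    (homeomorphUnitSphereProd E).toMeasurableEquiv
  have hm : Measurable fun x : ({(0 : E)}ᶜ : Set E) => g x := hg.comp measurable_subtype_coe
  rw [h1, ← h2.lintegral_comp hm]
  refine (lintegral_prod _ (hm.comp h2.measurable).aemeasurable).trans ?_
  refine lintegral_congr fun ξ => ?_
  rw [Measure.volumeIoiPow, lintegral_withDensity_eq_lintegral_mul₀ (by fun_prop)]
  · rw [← lintegral_subtype_comap measurableSet_Ioi]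
    rfl
  · exact (hm.comp (h2.measurable.comp measurable_prodMk_left)).aemeasurable

theorem lintegral_rpow_mul_exp_neg_mul_Ioi {a m : ℝ} (ha : 0 < a) (hm : 0 < m) :
    ∫⁻ s in Ioi (0 : ℝ), ENNReal.ofReal (s ^ (a - 1) * exp (-(m * s))) =
      ENNReal.ofReal (m ^ (-a) * Gamma a) := by
  rw [← ofReal_integral_eq_lintegral_ofReal]
  · rw [Real.integral_rpow_mul_exp_neg_mul_Ioi ha hm, one_div, inv_rpow hm.le, rpow_neg hm.le]
  · have := integrableOn_rpow_mul_exp_neg_mul_rpow (p := 1) (s := a - 1) (b := m) (by linarith)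
      one_pos hm
    simpa [IntegrableOn] using this
  · filter_upwards [ae_restrict_mem measurableSet_Ioi] with s hs
    have := mem_Ioi.1 hs
    positivity

end Polar

/-- A reflection of Minkowski space `ℝ × E` along the spacelike unit vector `(height, vec)`. It acts
on the unit sphere of `E` (the projectivized light cone) as the inversion in the spherical cap
`{ξ | ⟪ξ, vec⟫ > height}`, which is smaller than a hemisphere. -/
structure CapReflection (E : Type*) [NormedAddCommGroup E] [InnerProductSpace ℝ E] where
  /-- the spatial part of the normal vector -/
  vec : E
  /-- the time part of the normal vector -/
  height : ℝ
  height_pos : 0 < height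
  norm_vec_sq : ‖vec‖ ^ 2 = 1 + height ^ 2

namespace CapReflection

variable {E : Type*} [NormedAddCommGroup E] [InnerProductSpace ℝ E] (R : CapReflection E)

/-- The spatial part of the image of the light ray through `(‖x‖, x)`. -/
def coneMap (x : E) : E := x - (2 * (⟪x, R.vec⟫ - R.height * ‖x‖)) • R.vec

/-- The time part of the image of the light ray through `(‖x‖, x)`. -/
def coneNorm (x : E) : ℝ := ‖x‖ - 2 * R.height * (⟪x, R.vec⟫ - R.height * ‖x‖)

theorem inner_vec_self : ⟪R.vec, R.vec⟫ = 1 + R.height ^ 2 := by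
  rw [real_inner_self_eq_norm_sq, R.norm_vec_sq]

theorem inner_coneMap (x y : E) :
    ⟪R.coneMap x, R.coneMap y⟫ = ⟪x, y⟫ - ‖x‖ * ‖y‖ + R.coneNorm x * R.coneNorm y := by
  simp only [coneMap, coneNorm, inner_sub_left, inner_sub_right, inner_smul_left, inner_smul_right,
    R.inner_vec_self, RCLike.conj_to_real, real_inner_comm y R.vec]
  ring

theorem inner_le_height_mul (x : E) : ⟪x, R.vec⟫ * (2 * R.height) ≤ (1 + 2 * R.height ^ 2) * ‖x‖ := by
  have h1 : ⟪x, R.vec⟫ ≤ ‖x‖ * ‖R.vec‖ := real_inner_le_norm x R.vec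
  have h2 : ‖R.vec‖ * (2 * R.height) ≤ 1 + 2 * R.height ^ 2 := by
    nlinarith [sq_nonneg (‖R.vec‖ - R.height), R.norm_vec_sq]
  nlinarith [R.height_pos, norm_nonneg x]

theorem coneNorm_nonneg (x : E) : 0 ≤ R.coneNorm x := by
  have := R.inner_le_height_mul x
  unfold coneNorm
  linarith

theorem norm_coneMap (x : E) : ‖R.coneMap x‖ = R.coneNorm x := by
  have h := R.inner_coneMap x x
  rw [real_inner_self_eq_norm_sq, real_inner_self_eq_norm_sq] at h
  rw [← abs_of_nonneg (norm_nonneg (R.coneMap x)), ← abs_of_nonneg (R.coneNorm_nonneg x)]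
  apply (sq_eq_sq_iff_abs_eq_abs _ _).1
  linarith

theorem coneMap_coneMap (x : E) : R.coneMap (R.coneMap x) = x := by
  have h : ⟪R.coneMap x, R.vec⟫ - R.height * ‖R.coneMap x‖ = -(⟪x, R.vec⟫ - R.height * ‖x‖) := by
    rw [norm_coneMap]
    simp only [coneMap, coneNorm, inner_sub_left, inner_smul_left, R.inner_vec_self,
      RCLike.conj_to_real]
    ring
  conv_lhs => rw [coneMap, h]
  rw [coneMap]
  module

theorem coneNorm_coneMap (x : E) : R.coneNorm (R.coneMap x) = ‖x‖ := by
  rw [← norm_coneMap, coneMap_coneMap]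

theorem coneMap_eq_zero_iff (x : E) : R.coneMap x = 0 ↔ x = 0 := by
  have h0 : R.coneMap 0 = 0 := by simp [coneMap]
  refine ⟨fun h => ?_, fun h => by rw [h, h0]⟩
  rw [← R.coneMap_coneMap x, h, h0]

theorem coneNorm_pos {x : E} (hx : x ≠ 0) : 0 < R.coneNorm x := by
  rw [← norm_coneMap, norm_pos_iff, Ne, coneMap_eq_zero_iff]
  exact hx

theorem coneMap_smul {s : ℝ} (hs : 0 ≤ s) (x : E) : R.coneMap (s • x) = s • R.coneMap x := by
  simp only [coneMap, inner_smul_left, norm_smul, norm_of_nonneg hs, RCLike.conj_to_real]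
  module

theorem coneNorm_smul {s : ℝ} (hs : 0 ≤ s) (x : E) : R.coneNorm (s • x) = s * R.coneNorm x := by
  rw [← norm_coneMap, coneMap_smul _ hs, norm_smul, norm_of_nonneg hs, norm_coneMap]

@[fun_prop]
theorem continuous_coneMap : Continuous R.coneMap := by
  unfold coneMap
  fun_prop

@[fun_prop]
theorem continuous_coneNorm : Continuous R.coneNorm := by
  unfold coneNorm
  fun_prop

/-- The derivative of `coneMap`. -/
def coneMapDeriv (x : E) : E →L[ℝ] E :=
  ContinuousLinearMap.id ℝ E -
    ((2 : ℝ) • (innerSL ℝ R.vec - (R.height * ‖x‖⁻¹) • innerSL ℝ x)).smulRight R.vec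

theorem hasFDerivAt_coneMap {x : E} (hx : x ≠ 0) : HasFDerivAt R.coneMap (R.coneMapDeriv x) x := by
  have h1 : HasFDerivAt (fun x : E => ⟪x, R.vec⟫) (innerSL ℝ R.vec) x := by
    simpa [real_inner_comm] using (innerSL ℝ R.vec).hasFDerivAt (x := x)
  have h2 : HasFDerivAt (fun x : E => ‖x‖) (‖x‖⁻¹ • innerSL ℝ x) x := by
    have h3 := (hasStrictFDerivAt_norm_sq x).hasFDerivAt.sqrt (by positivity)
    simp only [sqrt_sq (norm_nonneg _)] at h3
    convert! h3 using 1
    ext y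
    simp
    field_simp
  have h4 := (hasFDerivAt_id (𝕜 := ℝ) x).sub
    (((h1.sub (h2.const_mul R.height)).const_mul 2).smul_const R.vec)
  convert! h4 using 1
  rw [coneMapDeriv, smul_smul]

theorem det_coneMapDeriv [FiniteDimensional ℝ E] {x : E} (hx : x ≠ 0) :
    (R.coneMapDeriv x).det = -(R.coneNorm x / ‖x‖) := by
  have h : ((R.coneMapDeriv x : E →L[ℝ] E) : E →ₗ[ℝ] E) = LinearMap.transvection
      ((-((2 : ℝ) • (innerSL ℝ R.vec - (R.height * ‖x‖⁻¹) • innerSL ℝ x)) : E →L[ℝ] ℝ) :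
        E →ₗ[ℝ] ℝ) R.vec := by
    ext y
    simp [coneMapDeriv, LinearMap.transvection.apply]
    module
  rw [ContinuousLinearMap.det, h, LinearMap.transvection.det]
  have hx' : ‖x‖ ≠ 0 := norm_ne_zero_iff.2 hx
  simp [R.norm_vec_sq, coneNorm]
  field_simp
  ring

section Measure

variable [FiniteDimensional ℝ E] [MeasurableSpace E] [BorelSpace E]

/-- The measure `dx / ‖x‖` on the light cone is Lorentz invariant. -/
theorem lintegral_coneMap [Nontrivial E] (μ : Measure E) [μ.IsAddHaarMeasure] (g : E → ℝ≥0∞) :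
    ∫⁻ x, ENNReal.ofReal ‖x‖⁻¹ * g (R.coneMap x) ∂μ = ∫⁻ x, ENNReal.ofReal ‖x‖⁻¹ * g x ∂μ := by
  have himg : R.coneMap '' {0}ᶜ = {0}ᶜ := by
    ext y
    constructor
    · rintro ⟨x, hx, rfl⟩
      simpa [coneMap_eq_zero_iff] using hx
    · intro hy
      exact ⟨R.coneMap y, by simpa [coneMap_eq_zero_iff] using hy, R.coneMap_coneMap y⟩
  have h := lintegral_image_eq_lintegral_abs_det_fderiv_mul μ
    (measurableSet_singleton (0 : E)).compl
    (fun x hx => (R.hasFDerivAt_coneMap hx).hasFDerivWithinAt)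
    (fun x _ y _ hxy => by rw [← R.coneMap_coneMap x, hxy, R.coneMap_coneMap])
    (fun x => ENNReal.ofReal ‖x‖⁻¹ * g x)
  rw [himg] at h
  nth_rewrite 2 [← restrict_compl_singleton (μ := μ) 0]
  rw [h]
  nth_rewrite 1 [← restrict_compl_singleton (μ := μ) 0]
  refine setLIntegral_congr_fun (measurableSet_singleton (0 : E)).compl fun x hx => ?_
  have hc := R.coneNorm_pos hx
  have hx' : 0 < ‖x‖ := norm_pos_iff.2 hx
  rw [R.det_coneMapDeriv hx, abs_neg, abs_of_pos (by positivity), ← mul_assoc,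
    ← ENNReal.ofReal_mul (by positivity), norm_coneMap]
  congr 2
  field_simp

end Measure

/-- The conformal factor of the reflection on the unit sphere (the inverse of the dilation). -/
def factor (ξ : Metric.sphere (0 : E) 1) : ℝ := R.coneNorm ξ

theorem factor_pos (ξ : Metric.sphere (0 : E) 1) : 0 < R.factor ξ :=
  R.coneNorm_pos (ne_zero_of_mem_unit_sphere ξ)

theorem factor_eq (ξ : Metric.sphere (0 : E) 1) :
    R.factor ξ = 1 - 2 * R.height * (⟪(ξ : E), R.vec⟫ - R.height) := by
  simp [factor, coneNorm]

/-- The action of the reflection on the unit sphere. -/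
def onSphere (ξ : Metric.sphere (0 : E) 1) : Metric.sphere (0 : E) 1 :=
  ⟨(R.factor ξ)⁻¹ • R.coneMap ξ, by
    rw [mem_sphere_zero_iff_norm, norm_smul, norm_coneMap, norm_inv, norm_of_nonneg (R.factor_pos ξ).le]
    exact inv_mul_cancel₀ (R.factor_pos ξ).ne'⟩

theorem coe_onSphere (ξ : Metric.sphere (0 : E) 1) :
    (R.onSphere ξ : E) = (R.factor ξ)⁻¹ • R.coneMap ξ := rfl

@[fun_prop]
theorem continuous_factor : Continuous R.factor := by
  unfold factor
  fun_prop

@[fun_prop]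
theorem continuous_onSphere : Continuous R.onSphere := by
  refine Continuous.subtype_mk ?_ _
  exact (R.continuous_factor.inv₀ fun ξ => (R.factor_pos ξ).ne').smul (by fun_prop)

theorem factor_onSphere (ξ : Metric.sphere (0 : E) 1) :
    R.factor (R.onSphere ξ) = (R.factor ξ)⁻¹ := by
  rw [factor, coe_onSphere, coneNorm_smul _ (inv_nonneg.2 (R.factor_pos ξ).le), coneNorm_coneMap]
  simp

theorem onSphere_onSphere (ξ : Metric.sphere (0 : E) 1) : R.onSphere (R.onSphere ξ) = ξ := by
  ext1
  rw [coe_onSphere, factor_onSphere, coe_onSphere,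
    coneMap_smul _ (inv_nonneg.2 (R.factor_pos ξ).le), coneMap_coneMap, inv_inv, smul_smul,
    mul_inv_cancel₀ (R.factor_pos ξ).ne', one_smul]

theorem norm_sub_sq_of_sphere (ξ η : Metric.sphere (0 : E) 1) :
    ‖(ξ : E) - η‖ ^ 2 = 2 * (1 - ⟪(ξ : E), η⟫) := by
  rw [norm_sub_sq_real]
  simp
  ring

theorem inner_onSphere (ξ η : Metric.sphere (0 : E) 1) :
    1 - ⟪(R.onSphere ξ : E), (R.onSphere η : E)⟫ =
      (1 - ⟪(ξ : E), (η : E)⟫) * (R.factor ξ)⁻¹ * (R.factor η)⁻¹ := by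
  have h1 := (R.factor_pos ξ).ne'
  have h2 := (R.factor_pos η).ne'
  rw [coe_onSphere, coe_onSphere, inner_smul_left, inner_smul_right, inner_coneMap]
  simp only [norm_eq_of_mem_sphere, RCLike.conj_to_real]
  rw [← factor, ← factor]
  field_simp
  ring

/-- The chordal distance is conformally covariant. -/
theorem norm_onSphere_sub_sq (ξ η : Metric.sphere (0 : E) 1) :
    ‖(R.onSphere ξ : E) - R.onSphere η‖ ^ 2 =
      ‖(ξ : E) - η‖ ^ 2 * (R.factor ξ)⁻¹ * (R.factor η)⁻¹ := by
  rw [norm_sub_sq_of_sphere, norm_sub_sq_of_sphere, inner_onSphere]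
  ring

/-- Comparison of the distances to a point and to its mirror image. -/
theorem norm_sub_onSphere_sq (ξ η : Metric.sphere (0 : E) 1) :
    ‖(ξ : E) - R.onSphere η‖ ^ 2 * R.factor η =
      ‖(ξ : E) - η‖ ^ 2 + (R.factor ξ - 1) * (R.factor η - 1) / R.height ^ 2 := by
  have h2 := (R.factor_pos η).ne'
  have h3 := R.height_pos.ne'
  rw [norm_sub_sq_of_sphere, norm_sub_sq_of_sphere, coe_onSphere, inner_smul_right, coneMap,
    inner_sub_right, inner_smul_right]
  simp only [norm_eq_of_mem_sphere]
  have : (1 - (R.factor η)⁻¹ * (⟪(ξ : E), η⟫ - 2 * (⟪(η : E), R.vec⟫ - R.height * 1) *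
      ⟪(ξ : E), R.vec⟫)) * R.factor η = R.factor η - (⟪(ξ : E), η⟫ -
        2 * (⟪(η : E), R.vec⟫ - R.height * 1) * ⟪(ξ : E), R.vec⟫) := by
    field_simp
  rw [mul_assoc, this, factor_eq, factor_eq]
  field_simp
  ring

section Measure

variable [FiniteDimensional ℝ E] [MeasurableSpace E] [BorelSpace E]

/-- Change of variables on the unit sphere. -/
theorem lintegral_onSphere {n : ℕ} (hn : 1 ≤ n) (hE : Module.finrank ℝ E = n + 1)
    {F : Metric.sphere (0 : E) 1 → ℝ≥0∞} (hF : Measurable F) :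
    ∫⁻ ξ, ENNReal.ofReal (R.factor ξ ^ (-(n : ℝ))) * F (R.onSphere ξ)
      ∂(volume : Measure E).toSphere = ∫⁻ ξ, F ξ ∂(volume : Measure E).toSphere := by
  have : Nontrivial E := Module.nontrivial_of_finrank_pos (R := ℝ) (by omega)
  have hemb : MeasurableEmbedding ((↑) : Metric.sphere (0 : E) 1 → E) :=
    MeasurableEmbedding.subtype_coe Metric.isClosed_sphere.measurableSet
  let F' : E → ℝ≥0∞ := Function.extend (↑) F 0
  have hF' : Measurable F' := hemb.measurable_extend hF measurable_zero
  have hF'F (ξ : Metric.sphere (0 : E) 1) : F' ξ = F ξ := Subtype.val_injective.extend_apply F 0 ξ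
  let g : E → ℝ≥0∞ := fun x => F' (‖x‖⁻¹ • x) * ENNReal.ofReal (exp (-‖x‖))
  have hg : Measurable g := by fun_prop
  have hn' : (0 : ℝ) < n := by exact_mod_cast hn
  have hradial (c : ℝ≥0∞) {m : ℝ} (hm : 0 < m) : ∫⁻ s in Ioi (0 : ℝ), ENNReal.ofReal (s ^ n) *
      (ENNReal.ofReal s⁻¹ * (c * ENNReal.ofReal (exp (-(m * s))))) =
        ENNReal.ofReal (Gamma n) * (ENNReal.ofReal (m ^ (-(n : ℝ))) * c) := by
    have h1 : ∀ s ∈ Ioi (0 : ℝ), ENNReal.ofReal (s ^ n) * (ENNReal.ofReal s⁻¹ *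
        (c * ENNReal.ofReal (exp (-(m * s))))) =
          c * ENNReal.ofReal (s ^ ((n : ℝ) - 1) * exp (-(m * s))) := by
      intro s hs
      have hs' : 0 < s := hs
      rw [rpow_sub_one hs'.ne', rpow_natCast, div_eq_mul_inv, ENNReal.ofReal_mul (by positivity),
        ENNReal.ofReal_mul (by positivity)]
      ring
    rw [setLIntegral_congr_fun measurableSet_Ioi h1, lintegral_const_mul _ (by fun_prop),
      lintegral_rpow_mul_exp_neg_mul_Ioi hn' hm, ENNReal.ofReal_mul (by positivity)]
    ring
  have h := R.lintegral_coneMap volume g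
  rw [lintegral_eq_lintegral_toSphere _ (by fun_prop),
    lintegral_eq_lintegral_toSphere (g := fun x => ENNReal.ofReal ‖x‖⁻¹ * g x) _ (by fun_prop), hE, Nat.add_sub_cancel] at h
  have hR (ξ : Metric.sphere (0 : E) 1) : ∫⁻ s in Ioi (0 : ℝ), ENNReal.ofReal (s ^ n) *
      (ENNReal.ofReal ‖s • (ξ : E)‖⁻¹ * g (s • (ξ : E))) =
        ENNReal.ofReal (Gamma n) * F ξ := by
    have := hradial (F ξ) one_pos
    rw [one_rpow, ENNReal.ofReal_one, one_mul] at this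
    rw [← this]
    refine setLIntegral_congr_fun measurableSet_Ioi fun s hs => ?_
    have hs' : 0 < s := hs
    simp [g, norm_smul, abs_of_pos hs', smul_smul, inv_mul_cancel₀ hs'.ne', hF'F]
  have hL (ξ : Metric.sphere (0 : E) 1) : ∫⁻ s in Ioi (0 : ℝ), ENNReal.ofReal (s ^ n) *
      (ENNReal.ofReal ‖s • (ξ : E)‖⁻¹ * g (R.coneMap (s • (ξ : E)))) =
        ENNReal.ofReal (Gamma n) *
          (ENNReal.ofReal (R.factor ξ ^ (-(n : ℝ))) * F (R.onSphere ξ)) := by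
    rw [← hradial (F (R.onSphere ξ)) (R.factor_pos ξ)]
    refine setLIntegral_congr_fun measurableSet_Ioi fun s hs => ?_
    have hs' : 0 < s := hs
    have h1 : ‖R.coneMap (s • (ξ : E))‖ = R.factor ξ * s := by
      rw [norm_coneMap, coneNorm_smul _ hs'.le, mul_comm, factor]
    have h2 : (R.factor ξ * s)⁻¹ • R.coneMap (s • (ξ : E)) = R.onSphere ξ := by
      rw [coneMap_smul _ hs'.le, smul_smul, coe_onSphere, mul_inv, mul_assoc,
        inv_mul_cancel₀ hs'.ne', mul_one]
    simp only [g]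
    rw [h1, h2, hF'F]
    simp [norm_smul, abs_of_pos hs']
  simp only [hL, hR] at h
  have hFm : Measurable fun ξ => ENNReal.ofReal (R.factor ξ ^ (-(n : ℝ))) * F (R.onSphere ξ) :=
    ((R.continuous_factor.measurable.pow_const _).ennreal_ofReal).mul
      (hF.comp R.continuous_onSphere.measurable)
  rw [lintegral_const_mul _ hFm, lintegral_const_mul _ hF] at h
  exact (ENNReal.mul_right_inj (by simpa using Gamma_pos_of_pos hn') ENNReal.ofReal_ne_top).1 h

end Measure

end CapReflection

section Constant

theorem lintegral_exp_neg_mul_sq_norm {V : Type*} [NormedAddCommGroup V] [InnerProductSpace ℝ V]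
    [FiniteDimensional ℝ V] [MeasurableSpace V] [BorelSpace V] {b : ℝ} (hb : 0 < b) :
    ∫⁻ v : V, ENNReal.ofReal (exp (-b * ‖v‖ ^ 2)) =
      ENNReal.ofReal ((π / b) ^ (Module.finrank ℝ V / 2 : ℝ)) := by
  have h := GaussianFourier.integral_rexp_neg_mul_sq_norm (V := V) hb
  rw [← h, ofReal_integral_eq_lintegral_ofReal]
  · refine Integrable.of_integral_ne_zero ?_
    rw [h]
    positivity
  · exact ae_of_all _ fun v => (exp_pos _).le

/-- The light-cone substitution `x = (r ^ 2 / u - u) / 2` on a line at distance `r` of the origin. -/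
theorem lintegral_light_cone_line {r : ℝ} (hr : 0 < r) (ν : ℝ) :
    ∫⁻ x : ℝ, ENNReal.ofReal (√(x ^ 2 + r ^ 2))⁻¹ *
        ENNReal.ofReal ((√(x ^ 2 + r ^ 2) - x) ^ (-ν) * exp (-√(x ^ 2 + r ^ 2))) =
      ∫⁻ u in Ioi (0 : ℝ), ENNReal.ofReal (u ^ (-ν - 1) * exp (-(2⁻¹ * u))) *
        ENNReal.ofReal (exp (-(2 * u)⁻¹ * r ^ 2)) := by
  let f : ℝ → ℝ := fun u => (r ^ 2 / u - u) / 2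
  have hsqrt {u : ℝ} (hu : 0 < u) : √(f u ^ 2 + r ^ 2) = (r ^ 2 / u + u) / 2 := by
    rw [sqrt_eq_iff_mul_self_eq_of_pos (by positivity)]
    simp only [f]
    field_simp
    ring
  have hinj : InjOn f (Ioi 0) := by
    intro u hu v hv huv
    have h1 := hsqrt hu
    have h2 := hsqrt hv
    rw [huv, h2] at h1
    simp only [f] at huv
    linarith
  have himg : f '' Ioi 0 = univ := by
    refine eq_univ_of_forall fun x => ?_
    have hs : √(x ^ 2 + r ^ 2) ^ 2 = x ^ 2 + r ^ 2 := sq_sqrt (by positivity)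
    have hx : |x| < √(x ^ 2 + r ^ 2) := by
      rw [← sqrt_sq_eq_abs]
      exact sqrt_lt_sqrt (by positivity) (by nlinarith)
    have hpos : 0 < √(x ^ 2 + r ^ 2) - x := by linarith [le_abs_self x]
    refine ⟨√(x ^ 2 + r ^ 2) - x, hpos, ?_⟩
    simp only [f]
    field_simp
    nlinarith
  have hderiv : ∀ u ∈ Ioi (0 : ℝ),
      HasDerivWithinAt f ((r ^ 2 * -(u ^ 2)⁻¹ - 1) / 2) (Ioi 0) u := by
    intro u hu
    have := (((hasDerivAt_inv (mem_Ioi.1 hu).ne').const_mul (r ^ 2)).sub (hasDerivAt_id u)).div_const 2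
    exact this.hasDerivWithinAt
  rw [← setLIntegral_univ, ← himg,
    lintegral_image_eq_lintegral_abs_deriv_mul measurableSet_Ioi hderiv hinj]
  refine setLIntegral_congr_fun measurableSet_Ioi fun u hu => ?_
  have hu' : 0 < u := hu
  have h1 : |(r ^ 2 * -(u ^ 2)⁻¹ - 1) / 2| = (r ^ 2 / u + u) / 2 / u := by
    rw [abs_of_neg]
    · field_simp
      ring
    · have : 0 < r ^ 2 * (u ^ 2)⁻¹ := by positivity
      linarith
  have h2 : (r ^ 2 / u + u) / 2 - f u = u := by
    simp only [f]
    ring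
  have h3 : -((r ^ 2 / u + u) / 2) = -(2⁻¹ * u) + -(2 * u)⁻¹ * r ^ 2 := by
    field_simp
    ring
  rw [h1, hsqrt hu', h2, h3, exp_add, ← ENNReal.ofReal_mul (by positivity),
    ← ENNReal.ofReal_mul (by positivity), ← ENNReal.ofReal_mul (by positivity),
    rpow_sub_one hu'.ne']
  congr 1
  field_simp

theorem lintegral_light_cone_prod {n : ℕ} (hn : 1 ≤ n) {ν : ℝ} (hν : ν < n / 2) :
    ∫⁻ y : EuclideanSpace ℝ (Fin n), ∫⁻ x : ℝ, ENNReal.ofReal (√(x ^ 2 + ‖y‖ ^ 2))⁻¹ *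
        ENNReal.ofReal ((√(x ^ 2 + ‖y‖ ^ 2) - x) ^ (-ν) * exp (-√(x ^ 2 + ‖y‖ ^ 2))) =
      ENNReal.ofReal ((2 * π) ^ (n / 2 : ℝ) * (2 ^ (n / 2 - ν : ℝ) * Gamma (n / 2 - ν))) := by
  have : Nonempty (Fin n) := ⟨⟨0, hn⟩⟩
  have h1 : ∀ᵐ y : EuclideanSpace ℝ (Fin n), ∫⁻ x : ℝ, ENNReal.ofReal (√(x ^ 2 + ‖y‖ ^ 2))⁻¹ *
        ENNReal.ofReal ((√(x ^ 2 + ‖y‖ ^ 2) - x) ^ (-ν) * exp (-√(x ^ 2 + ‖y‖ ^ 2))) =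
      ∫⁻ u in Ioi (0 : ℝ), ENNReal.ofReal (u ^ (-ν - 1) * exp (-(2⁻¹ * u))) *
        ENNReal.ofReal (exp (-(2 * u)⁻¹ * ‖y‖ ^ 2)) := by
    filter_upwards [Measure.ae_ne volume (0 : EuclideanSpace ℝ (Fin n))] with y hy
    exact lintegral_light_cone_line (norm_pos_iff.2 hy) ν
  rw [lintegral_congr_ae h1, lintegral_lintegral_swap (by fun_prop)]
  have h2 : ∀ u ∈ Ioi (0 : ℝ), ∫⁻ y : EuclideanSpace ℝ (Fin n),
      ENNReal.ofReal (u ^ (-ν - 1) * exp (-(2⁻¹ * u))) *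
        ENNReal.ofReal (exp (-(2 * u)⁻¹ * ‖y‖ ^ 2)) =
      ENNReal.ofReal ((2 * π) ^ (n / 2 : ℝ)) *
        ENNReal.ofReal (u ^ ((n / 2 - ν : ℝ) - 1) * exp (-(2⁻¹ * u))) := by
    intro u hu
    have hu' : 0 < u := hu
    rw [lintegral_const_mul _ (by fun_prop), lintegral_exp_neg_mul_sq_norm (by positivity),
      ← ENNReal.ofReal_mul (by positivity), ← ENNReal.ofReal_mul (by positivity),
      finrank_euclideanSpace_fin, div_inv_eq_mul,
      show π * (2 * u) = 2 * π * u by ring, mul_rpow (by positivity) hu'.le,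
      show (n / 2 - ν : ℝ) - 1 = (-ν - 1) + n / 2 by ring, rpow_add hu']
    congr 1
    ring
  rw [setLIntegral_congr_fun measurableSet_Ioi h2, lintegral_const_mul _ (by fun_prop),
    lintegral_rpow_mul_exp_neg_mul_Ioi (by linarith) (by positivity),
    ← ENNReal.ofReal_mul (by positivity), inv_rpow zero_le_two, rpow_neg zero_le_two, inv_inv]

theorem exists_linearIsometryEquiv_map_eq {E F : Type*} [NormedAddCommGroup E]
    [InnerProductSpace ℝ E] [FiniteDimensional ℝ E] [NormedAddCommGroup F]
    [InnerProductSpace ℝ F] [FiniteDimensional ℝ F]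
    (h : Module.finrank ℝ E = Module.finrank ℝ F) {e : E} {v : F} (hev : ‖e‖ = ‖v‖) :
    ∃ U : E ≃ₗᵢ[ℝ] F, U e = v := by
  let U₀ : E ≃ₗᵢ[ℝ] F := (stdOrthonormalBasis ℝ E).repr.trans
    ((stdOrthonormalBasis ℝ F).reindex (finCongr h.symm)).repr.symm
  refine ⟨U₀.trans (Submodule.reflection (ℝ ∙ (U₀ e - v))ᗮ), ?_⟩
  exact Submodule.reflection_sub (by rw [U₀.norm_map, hev])

variable {E : Type*} [NormedAddCommGroup E] [InnerProductSpace ℝ E] [FiniteDimensional ℝ E]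
  [MeasurableSpace E] [BorelSpace E]

theorem lintegral_light_cone {n : ℕ} (hn : 1 ≤ n) (hE : Module.finrank ℝ E = n + 1)
    {e : E} (he : ‖e‖ = 1) {ν : ℝ} (hν : ν < n / 2) :
    ∫⁻ x : E, ENNReal.ofReal ‖x‖⁻¹ * ENNReal.ofReal ((‖x‖ - ⟪x, e⟫) ^ (-ν) * exp (-‖x‖)) =
      ENNReal.ofReal ((2 * π) ^ (n / 2 : ℝ) * (2 ^ (n / 2 - ν : ℝ) * Gamma (n / 2 - ν))) := by
  obtain ⟨U, hU⟩ := exists_linearIsometryEquiv_map_eq (E := E) 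
    (F := WithLp 2 (ℝ × EuclideanSpace ℝ (Fin n))) (e := e)
    (v := WithLp.toLp 2 (1, 0)) (by
      rw [hE, (WithLp.linearEquiv 2 ℝ _).finrank_eq, Module.finrank_prod]
      simp [add_comm])
    (by simp [he])
  rw [← lintegral_light_cone_prod hn hν]
  have h1 := U.measurePreserving.lintegral_comp (f := fun x => ENNReal.ofReal ‖x‖⁻¹ *
    ENNReal.ofReal ((‖x‖ - ⟪x, WithLp.toLp 2 (1, 0)⟫) ^ (-ν) * exp (-‖x‖))) (by fun_prop)
  simp only [← hU, U.norm_map, U.inner_map_map] at h1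
  rw [h1, hU, ← (WithLp.volume_preserving_toLp _ _).lintegral_comp (by fun_prop),
    Measure.volume_eq_prod, lintegral_prod_symm' _ (by fun_prop)]
  simp [WithLp.prod_norm_eq_of_L2]

theorem lintegral_toSphere_one_sub_inner_rpow {n : ℕ} (hn : 1 ≤ n)
    (hE : Module.finrank ℝ E = n + 1) {e : E} (he : ‖e‖ = 1) {ν : ℝ} (hν : ν < n / 2) :
    ENNReal.ofReal (Gamma (n - ν)) * ∫⁻ ξ : Metric.sphere (0 : E) 1,
        ENNReal.ofReal ((1 - ⟪(ξ : E), e⟫) ^ (-ν)) ∂(volume : Measure E).toSphere =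
      ENNReal.ofReal ((2 * π) ^ (n / 2 : ℝ) * (2 ^ (n / 2 - ν : ℝ) * Gamma (n / 2 - ν))) := by
  have : Nontrivial E := Module.nontrivial_of_finrank_pos (R := ℝ) (by omega)
  rw [← lintegral_light_cone hn hE he hν, lintegral_eq_lintegral_toSphere (g := fun x : E =>
    ENNReal.ofReal ‖x‖⁻¹ * ENNReal.ofReal ((‖x‖ - ⟪x, e⟫) ^ (-ν) * exp (-‖x‖))) _ (by fun_prop), hE,
    Nat.add_sub_cancel, ← lintegral_const_mul _ (by fun_prop)]
  refine lintegral_congr fun ξ => ?_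
  have hn' : (1 : ℝ) ≤ n := by exact_mod_cast hn
  have h0 : 0 ≤ 1 - ⟪(ξ : E), e⟫ := by
    have := real_inner_le_norm (ξ : E) e
    simp only [norm_eq_of_mem_sphere, he] at this
    linarith
  have h1 : ∀ s ∈ Ioi (0 : ℝ), ENNReal.ofReal (s ^ n) * (ENNReal.ofReal ‖s • (ξ : E)‖⁻¹ *
      ENNReal.ofReal ((‖s • (ξ : E)‖ - ⟪s • (ξ : E), e⟫) ^ (-ν) * exp (-‖s • (ξ : E)‖))) =
      ENNReal.ofReal (s ^ ((n - ν : ℝ) - 1) * exp (-(1 * s))) *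
        ENNReal.ofReal ((1 - ⟪(ξ : E), e⟫) ^ (-ν)) := by
    intro s hs
    have hs' : 0 < s := hs
    have h2 : ‖s • (ξ : E)‖ = s := by simp [norm_smul, abs_of_pos hs']
    rw [h2, inner_smul_left, RCLike.conj_to_real, show s - s * ⟪(ξ : E), e⟫ =
      s * (1 - ⟪(ξ : E), e⟫) by ring, mul_rpow hs'.le h0, one_mul,
      show (n - ν : ℝ) - 1 = n + -ν - 1 by ring, rpow_sub_one hs'.ne', rpow_add hs', rpow_natCast,
      ← ENNReal.ofReal_mul (by positivity), ← ENNReal.ofReal_mul (by positivity),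
      ← ENNReal.ofReal_mul (by positivity)]
    congr 1
    ring
  rw [setLIntegral_congr_fun measurableSet_Ioi h1, lintegral_mul_const _ (by fun_prop),
    lintegral_rpow_mul_exp_neg_mul_Ioi (by linarith) one_pos]
  simp

theorem toSphere_inner_eq_zero {d : E} (hd : d ≠ 0) :
    (volume : Measure E).toSphere {ξ | ⟪(ξ : E), d⟫ = 0} = 0 := by
  have hms : MeasurableSet {ξ : Metric.sphere (0 : E) 1 | ⟪(ξ : E), d⟫ = 0} :=
    measurableSet_eq_fun (by fun_prop) (by fun_prop)
  rw [Measure.toSphere_apply' _ hms]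
  refine mul_eq_zero_of_right _ (measure_mono_null ?_ (Measure.addHaar_submodule volume
    (ℝ ∙ d)ᗮ ?_))
  · rintro _ ⟨s, hs, _, ⟨ξ, hξ, rfl⟩, rfl⟩
    simp only [SetLike.mem_coe, Submodule.mem_orthogonal_singleton_iff_inner_left]
    simp_all [inner_smul_left]
  · rw [Ne, Submodule.orthogonal_eq_top_iff]
    simpa using hd

end Constant

/-- A measurable involution `map` under which the kernel `K` is conformally covariant, together with
a half-space `half` on which it decreases interactions across the boundary. The reflection
`f ↦ weight * f ∘ map` is an isometry of `L^p` and `dualWeight` is its conjugate weight. -/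
structure Polarizer {X : Type*} [MeasurableSpace X] (μ : Measure X) (K : X → X → ℝ≥0∞) (p : ℝ) where
  /-- the involution -/
  map : X → X
  /-- the weight of the reflection of functions -/
  weight : X → ℝ≥0∞
  /-- the conjugate weight -/
  dualWeight : X → ℝ≥0∞
  /-- the half-space onto which polarization moves mass -/
  half : Set X
  measurable_map : Measurable map
  measurable_weight : Measurable weight
  measurable_dualWeight : Measurable dualWeight
  measurableSet_half : MeasurableSet half
  map_map : ∀ x, map (map x) = x
  weight_mul_weight_map : ∀ x, weight x * weight (map x) = 1
  weight_rpow : ∀ x, weight x ^ p = weight x * dualWeight x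
  lintegral_map : ∀ F : X → ℝ≥0∞, Measurable F →
    ∫⁻ x, weight x * dualWeight x * F (map x) ∂μ = ∫⁻ x, F x ∂μ
  kernel_map : ∀ x y, dualWeight x * dualWeight y * K (map x) (map y) = K x y
  kernel_mirror_comm : ∀ x y, dualWeight y * K x (map y) = dualWeight x * K (map x) y
  mirror_le : ∀ x y, (x ∈ half ↔ y ∈ half) → dualWeight y * K x (map y) ≤ K x y
  le_mirror : ∀ x y, ¬ (x ∈ half ↔ y ∈ half) → K x y ≤ dualWeight y * K x (map y)
  map_notMem : ∀ x ∈ half, map x ∉ half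
  map_eq_of_notMem : ∀ x, x ∉ half → map x ∉ half → map x = x ∧ weight x = 1
  weight_le_one : ∀ x ∈ half, weight x ≤ 1
  dualWeight_lt_one : ∀ x ∈ half, dualWeight x < 1

/-- Two-point rearrangement inequality. -/
theorem two_point_rearrangement (s s' t t' : ℝ≥0∞) {k k' : ℝ≥0∞} (h : k' ≤ k) :
    (s * t + s' * t') * k + (s * t' + s' * t) * k' ≤
      (max s s' * max t t' + min s s' * min t t') * k +
        (max s s' * min t t' + min s s' * max t t') * k' := by
  obtain ⟨d, rfl⟩ := exists_add_of_le h
  rcases le_total s s' with hs | hs <;> rcases le_total t t' with ht | ht <;>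
    simp only [hs, ht, max_eq_left, max_eq_right, min_eq_left, min_eq_right] <;>
    obtain ⟨u, rfl⟩ := exists_add_of_le hs <;> obtain ⟨v, rfl⟩ := exists_add_of_le ht
  · apply le_of_eq; ring
  · calc _ ≤ (s * (t' + v) + (s + u) * t') * (k' + d) + (s * t' + (s + u) * (t' + v)) * k' + u * v * d := le_self_add
      _ = _ := by ring
  · calc _ ≤ ((s' + u) * t + s' * (t + v)) * (k' + d) + ((s' + u) * (t + v) + s' * t) * k' + u * v * d := le_self_add
      _ = _ := by ring
  · apply le_of_eq; ring

section Energy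

variable {X : Type*} [MeasurableSpace X]

/-- The potential of `f` with respect to the kernel `K`. -/
def kernelPotential (μ : Measure X) (K : X → X → ℝ≥0∞) (f : X → ℝ≥0∞) (x : X) : ℝ≥0∞ :=
  ∫⁻ y, K x y * f y ∂μ

/-- The energy of `f` with respect to the kernel `K`. -/
def kernelEnergy (μ : Measure X) (K : X → X → ℝ≥0∞) (f : X → ℝ≥0∞) : ℝ≥0∞ :=
  ∫⁻ x, f x * kernelPotential μ K f x ∂μ

theorem measurable_kernelPotential {μ : Measure X} [SFinite μ] {K : X → X → ℝ≥0∞}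
    (hK : Measurable (Function.uncurry K)) {f : X → ℝ≥0∞} (hf : Measurable f) :
    Measurable (kernelPotential μ K f) :=
  Measurable.lintegral_prod_right' (f := fun z : X × X => K z.1 z.2 * f z.2)
    (hK.mul (hf.comp measurable_snd))

end Energy

namespace Polarizer

variable {X : Type*} [MeasurableSpace X] {μ : Measure X} {K : X → X → ℝ≥0∞} {p : ℝ}
  (P : Polarizer μ K p)

/-- The reflection of a function. -/
def refl (f : X → ℝ≥0∞) (x : X) : ℝ≥0∞ := P.weight x * f (P.map x)

open Classical in
/-- The polarization of a function. -/
def polarize (f : X → ℝ≥0∞) (x : X) : ℝ≥0∞ :=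
  if x ∈ P.half then max (f x) (P.refl f x) else min (f x) (P.refl f x)

theorem measurable_refl {f : X → ℝ≥0∞} (hf : Measurable f) : Measurable (P.refl f) :=
  P.measurable_weight.mul (hf.comp P.measurable_map)

theorem measurable_polarize {f : X → ℝ≥0∞} (hf : Measurable f) : Measurable (P.polarize f) :=
  Measurable.ite P.measurableSet_half (hf.max (P.measurable_refl hf))
    (hf.min (P.measurable_refl hf))

theorem refl_refl (f : X → ℝ≥0∞) : P.refl (P.refl f) = f := by
  funext x
  rw [refl, refl, P.map_map, ← mul_assoc, P.weight_mul_weight_map, one_mul]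

theorem refl_eq_of_notMem {x : X} (hx : x ∉ P.half) (hx' : P.map x ∉ P.half) (f : X → ℝ≥0∞) :
    P.refl f x = f x := by
  obtain ⟨h1, h2⟩ := P.map_eq_of_notMem x hx hx'
  rw [refl, h1, h2, one_mul]

theorem polarize_of_mem {x : X} (hx : x ∈ P.half) (f : X → ℝ≥0∞) :
    P.polarize f x = max (f x) (P.refl f x) := if_pos hx

theorem polarize_of_notMem {x : X} (hx : x ∉ P.half) (f : X → ℝ≥0∞) :
    P.polarize f x = min (f x) (P.refl f x) := if_neg hx

theorem weight_mul_min (f : X → ℝ≥0∞) (x : X) : P.weight x * min (f (P.map x)) (P.refl f (P.map x)) =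
    min (f x) (P.refl f x) := by
  conv_rhs => rw [← P.refl_refl f]
  rw [min_comm (P.refl (P.refl f) x), P.refl_refl]
  exact Monotone.map_min (fun _ _ h => by gcongr)

theorem weight_mul_max (f : X → ℝ≥0∞) (x : X) : P.weight x * max (f (P.map x)) (P.refl f (P.map x)) =
    max (f x) (P.refl f x) := by
  conv_rhs => rw [← P.refl_refl f]
  rw [max_comm (P.refl (P.refl f) x), P.refl_refl]
  exact Monotone.map_max (fun _ _ h => by gcongr)

theorem refl_polarize_of_mem {x : X} (hx : x ∈ P.half) (f : X → ℝ≥0∞) :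
    P.refl (P.polarize f) x = min (f x) (P.refl f x) := by
  rw [refl, P.polarize_of_notMem (P.map_notMem x hx), P.weight_mul_min]

theorem refl_polarize_of_notMem {x : X} (hx : x ∉ P.half) (f : X → ℝ≥0∞) :
    P.refl (P.polarize f) x = max (f x) (P.refl f x) := by
  by_cases hx' : P.map x ∈ P.half
  · rw [refl, P.polarize_of_mem hx', P.weight_mul_max]
  · rw [P.refl_eq_of_notMem hx hx', P.polarize_of_notMem hx, P.refl_eq_of_notMem hx hx']
    simp

theorem refl_le {f : X → ℝ≥0∞} {C : ℝ≥0∞} (hf : ∀ x, f x ≤ C) {x : X} (hx : x ∈ P.half) :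
    P.refl f x ≤ C :=
  (mul_le_mul' (P.weight_le_one x hx) (hf _)).trans_eq (one_mul C)

theorem polarize_le {f : X → ℝ≥0∞} {C : ℝ≥0∞} (hf : ∀ x, f x ≤ C) (x : X) :
    P.polarize f x ≤ C := by
  by_cases hx : x ∈ P.half
  · rw [P.polarize_of_mem hx]
    exact max_le (hf x) (P.refl_le hf hx)
  · rw [P.polarize_of_notMem hx]
    exact (min_le_left _ _).trans (hf x)

theorem lintegral_preimage_half {F : X → ℝ≥0∞} (hF : Measurable F) :
    ∫⁻ x in P.map ⁻¹' P.half, F x ∂μ =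
      ∫⁻ x in P.half, P.weight x * P.dualWeight x * F (P.map x) ∂μ := by
  have h := P.lintegral_map ((P.map ⁻¹' P.half).indicator F)
    (hF.indicator (P.measurable_map P.measurableSet_half))
  rw [lintegral_indicator (P.measurable_map P.measurableSet_half)] at h
  rw [← h, ← lintegral_indicator P.measurableSet_half]
  refine lintegral_congr fun x => ?_
  by_cases hx : x ∈ P.half <;> simp [hx, P.map_map]

/-- Splitting an integral along the half-space, its mirror image, and the fixed points. -/
theorem lintegral_eq_half {F : X → ℝ≥0∞} (hF : Measurable F) :
    ∫⁻ x, F x ∂μ = ∫⁻ x in P.half, (F x + P.weight x * P.dualWeight x * F (P.map x)) ∂μ +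
      ∫⁻ x in P.halfᶜ ∩ (P.map ⁻¹' P.half)ᶜ, F x ∂μ := by
  have hm := P.measurable_map P.measurableSet_half
  rw [lintegral_add_left hF, ← P.lintegral_preimage_half hF,
    ← lintegral_add_compl F P.measurableSet_half, add_assoc]
  congr 1
  rw [← lintegral_inter_add_sdiff F P.halfᶜ hm]
  congr 2
  rw [inter_eq_right.2]
  intro x hx hx'
  exact P.map_notMem x hx' hx

theorem lintegral_polarize_rpow {f : X → ℝ≥0∞} (hf : Measurable f) (hp : 0 ≤ p) :
    ∫⁻ x, P.polarize f x ^ p ∂μ = ∫⁻ x, f x ^ p ∂μ := by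
  have key : ∀ (g : X → ℝ≥0∞) (x : X), P.weight x * P.dualWeight x * g (P.map x) ^ p =
      P.refl g x ^ p := fun g x => by
    rw [refl, ENNReal.mul_rpow_of_nonneg _ _ hp, P.weight_rpow]
  rw [P.lintegral_eq_half ((P.measurable_polarize hf).pow_const p),
    P.lintegral_eq_half (hf.pow_const p)]
  congr 1
  · refine setLIntegral_congr_fun P.measurableSet_half fun x hx => ?_
    simp only [key, P.refl_polarize_of_mem hx, P.polarize_of_mem hx]
    rcases le_total (f x) (P.refl f x) with h | h <;> simp [h, add_comm]
  · refine setLIntegral_congr_fun (P.measurableSet_half.compl.inter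
      (P.measurable_map P.measurableSet_half).compl) fun x hx => ?_
    simp only [P.polarize_of_notMem hx.1, P.refl_eq_of_notMem hx.1 hx.2, min_self]

/-- The amount of mass gained by polarization. -/
def gain (f : X → ℝ≥0∞) : ℝ≥0∞ :=
  ∫⁻ x in P.half, (P.refl f x - f x) * (1 - P.dualWeight x) ∂μ

theorem measurable_gain_integrand {f : X → ℝ≥0∞} (hf : Measurable f) :
    Measurable fun x => (P.refl f x - f x) * (1 - P.dualWeight x) :=
  ((P.measurable_refl hf).sub hf).mul (measurable_const.sub P.measurable_dualWeight)

theorem lintegral_add_gain_le {f : X → ℝ≥0∞} (hf : Measurable f) (hfin : ∀ x, f x ≠ ∞) :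
    ∫⁻ x, f x ∂μ + P.gain f ≤ ∫⁻ x, P.polarize f x ∂μ := by
  have key : ∀ (g : X → ℝ≥0∞) (x : X), P.weight x * P.dualWeight x * g (P.map x) =
      P.dualWeight x * P.refl g x := fun g x => by rw [refl]; ring
  rw [P.lintegral_eq_half (P.measurable_polarize hf), P.lintegral_eq_half hf, add_right_comm, gain,
    ← lintegral_add_right _ (P.measurable_gain_integrand hf)]
  refine add_le_add (setLIntegral_mono' P.measurableSet_half fun x hx => ?_) (le_of_eq ?_)
  · simp only [key, P.refl_polarize_of_mem hx, P.polarize_of_mem hx]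
    rcases le_total (f x) (P.refl f x) with h | h
    · obtain ⟨d, hd⟩ := exists_add_of_le h
      obtain ⟨e, he⟩ := exists_add_of_le (P.dualWeight_lt_one x hx).le
      have h1 : 1 - P.dualWeight x = e := by
        rw [he]; exact ENNReal.add_sub_cancel_left (P.dualWeight_lt_one x hx).ne_top
      rw [max_eq_right h, min_eq_left h, hd, ENNReal.add_sub_cancel_left (hfin x), h1]
      apply le_of_eq
      calc _ = f x + P.dualWeight x * f x + (P.dualWeight x + e) * d := by ring
        _ = _ := by rw [← he]; ring
    · rw [tsub_eq_zero_of_le h, max_eq_left h, min_eq_right h, zero_mul, add_zero]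
  · refine setLIntegral_congr_fun (P.measurableSet_half.compl.inter
      (P.measurable_map P.measurableSet_half).compl) fun x hx => ?_
    simp only [P.polarize_of_notMem hx.1, P.refl_eq_of_notMem hx.1 hx.2, min_self]

/-- The kernel with one argument reflected. -/
def mirror (x y : X) : ℝ≥0∞ := P.dualWeight y * K x (P.map y)

theorem measurable_mirror (hK : Measurable (Function.uncurry K)) : Measurable (Function.uncurry P.mirror) :=
  (P.measurable_dualWeight.comp measurable_snd).mul
    (hK.comp (measurable_fst.prodMk (P.measurable_map.comp measurable_snd)))

theorem kernelPotential_mirror_refl (hK : Measurable (Function.uncurry K)) {f : X → ℝ≥0∞}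
    (hf : Measurable f) :
    kernelPotential μ P.mirror (P.refl f) = kernelPotential μ K f := by
  funext x
  rw [kernelPotential, kernelPotential, ← P.lintegral_map (fun y => K x y * f y)
    (hK.of_uncurry_left.mul hf)]
  refine lintegral_congr fun y => ?_
  rw [mirror, refl]
  ring

theorem kernelPotential_mirror (hK : Measurable (Function.uncurry K)) {f : X → ℝ≥0∞}
    (hf : Measurable f) :
    kernelPotential μ P.mirror f = kernelPotential μ K (P.refl f) := by
  rw [← P.kernelPotential_mirror_refl hK (P.measurable_refl hf), P.refl_refl]

theorem dualWeight_mul_kernelPotential_map (hK : Measurable (Function.uncurry K)) {f : X → ℝ≥0∞}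
    (hf : Measurable f) (x : X) :
    P.dualWeight x * kernelPotential μ K f (P.map x) = kernelPotential μ P.mirror f x := by
  have hKx : Measurable (K (P.map x)) := hK.of_uncurry_left
  rw [kernelPotential, kernelPotential, ← lintegral_const_mul _ (by fun_prop)]
  refine lintegral_congr fun y => ?_
  rw [mirror, P.kernel_mirror_comm, mul_assoc]

theorem kernelEnergy_refl [SFinite μ] (hK : Measurable (Function.uncurry K)) {f : X → ℝ≥0∞}
    (hf : Measurable f) : kernelEnergy μ K (P.refl f) = kernelEnergy μ K f := by
  have hm := (P.measurable_refl hf).mul (measurable_kernelPotential (μ := μ) hK (P.measurable_refl hf))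
  rw [kernelEnergy, kernelEnergy, ← P.lintegral_map
    (fun x => P.refl f x * kernelPotential μ K (P.refl f) x) hm]
  refine lintegral_congr fun x => ?_
  rw [← P.kernelPotential_mirror_refl hK hf, ← P.dualWeight_mul_kernelPotential_map hK
    (P.measurable_refl hf)]
  conv_rhs => rw [← congrFun (P.refl_refl f) x, refl]
  ring

/-- The integrand of the symmetrized energy. -/
def symmIntegrand (f : X → ℝ≥0∞) (x y : X) : ℝ≥0∞ :=
  (f x * f y + P.refl f x * P.refl f y) * K x y +
    (f x * P.refl f y + P.refl f x * f y) * P.mirror x y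

theorem four_mul_kernelEnergy [SFinite μ] (hK : Measurable (Function.uncurry K)) {f : X → ℝ≥0∞}
    (hf : Measurable f) :
    4 * kernelEnergy μ K f = ∫⁻ x, ∫⁻ y, P.symmIntegrand f x y ∂μ ∂μ := by
  have hr := P.measurable_refl hf
  have hM := P.measurable_mirror hK
  have h1 : ∀ x, ∫⁻ y, P.symmIntegrand f x y ∂μ = f x * kernelPotential μ K f x +
      P.refl f x * kernelPotential μ K (P.refl f) x + f x * kernelPotential μ K f x +
      P.refl f x * kernelPotential μ K (P.refl f) x := by
    intro x
    have hKx : Measurable (K x) := hK.of_uncurry_left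
    have hMx : Measurable (P.mirror x) := hM.of_uncurry_left
    rw [← P.kernelPotential_mirror hK hf]
    nth_rewrite 2 [← P.kernelPotential_mirror_refl hK hf]
    rw [P.kernelPotential_mirror hK hf]
    nth_rewrite 2 [← P.kernelPotential_mirror hK hf]
    simp only [kernelPotential]
    rw [← lintegral_const_mul _ (by fun_prop), ← lintegral_const_mul _ (by fun_prop),
      ← lintegral_const_mul _ (by fun_prop), ← lintegral_const_mul _ (by fun_prop),
      ← lintegral_add_left (by fun_prop), ← lintegral_add_left (by fun_prop),
      ← lintegral_add_left (by fun_prop)]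
    refine lintegral_congr fun y => ?_
    rw [symmIntegrand]
    ring
  have hp := measurable_kernelPotential (μ := μ) hK hf
  have hp' := measurable_kernelPotential (μ := μ) hK hr
  have h2 := P.kernelEnergy_refl hK hf
  simp only [kernelEnergy] at h2 ⊢
  simp only [h1]
  rw [lintegral_add_left (by fun_prop), lintegral_add_left (by fun_prop),
    lintegral_add_left (by fun_prop), h2]
  ring

theorem kernelEnergy_le_polarize [SFinite μ] (hK : Measurable (Function.uncurry K)) {f : X → ℝ≥0∞}
    (hf : Measurable f) : kernelEnergy μ K f ≤ kernelEnergy μ K (P.polarize f) := by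
  refine (ENNReal.mul_le_mul_iff_right (a := 4) (by norm_num) (by norm_num)).1 ?_
  rw [P.four_mul_kernelEnergy hK hf, P.four_mul_kernelEnergy hK (P.measurable_polarize hf)]
  refine lintegral_mono fun x => lintegral_mono fun y => ?_
  simp only [symmIntegrand]
  by_cases hx : x ∈ P.half <;> by_cases hy : y ∈ P.half <;>
    simp only [hx, hy, P.polarize_of_mem, P.polarize_of_notMem, P.refl_polarize_of_mem,
      P.refl_polarize_of_notMem, not_false_eq_true]
  · exact two_point_rearrangement _ _ _ _ (P.mirror_le x y (by tauto))
  · rw [add_comm, add_comm (_ * K x y)]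
    have := two_point_rearrangement (f x) (P.refl f x) (P.refl f y) (f y)
      (P.le_mirror x y (by tauto))
    rwa [max_comm (P.refl f y), min_comm (P.refl f y)] at this
  · have := two_point_rearrangement (f x) (P.refl f x) (P.refl f y) (f y)
      (P.le_mirror x y (by tauto))
    rw [max_comm (P.refl f y), min_comm (P.refl f y)] at this
    rw [add_comm, add_comm (_ * K x y)]
    exact this.trans_eq (by rw [mirror]; ring)
  · have := two_point_rearrangement (f x) (P.refl f x) (f y) (P.refl f y)
      (P.mirror_le x y (by tauto))
    exact this.trans_eq (by rw [mirror]; ring)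

/-- Comparison of the potentials at `P.map y` and `y`, up to a multiple of the gain. -/
theorem dualWeight_mul_setLIntegral_le (hK : Measurable (Function.uncurry K)) {f : X → ℝ≥0∞}
    (hf : Measurable f) {C : ℝ≥0∞} (hC : ∀ x, f x ≤ C) (N : ℝ≥0∞) (y : X) :
    P.dualWeight y * ∫⁻ x in P.map ⁻¹' P.half, K (P.map y) x * f x ∂μ ≤
      ∫⁻ x in P.half, K y x * f x ∂μ + N * P.gain f +
        C * ∫⁻ x in P.half, (K y x - N * (1 - P.dualWeight x)) ∂μ := by
  have hKy : ∀ z, Measurable (K z) := fun z => hK.of_uncurry_left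
  have hd := P.measurable_dualWeight
  have hg := P.measurable_gain_integrand hf
  rw [P.lintegral_preimage_half (F := fun x => K (P.map y) x * f x) ((hKy _).mul hf),
    ← lintegral_const_mul _ (by
      exact (P.measurable_weight.mul hd).mul (((hKy _).mul hf).comp P.measurable_map)),
    gain, ← lintegral_const_mul _ hg, ← lintegral_const_mul _ (by fun_prop),
    ← lintegral_add_left (by fun_prop), ← lintegral_add_left (by fun_prop)]
  refine setLIntegral_mono' P.measurableSet_half fun x hx => ?_
  calc P.dualWeight y * (P.weight x * P.dualWeight x * (K (P.map y) (P.map x) * f (P.map x)))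
      = P.dualWeight y * P.dualWeight x * K (P.map y) (P.map x) * P.refl f x := by
        rw [refl]; ring
    _ = K y x * P.refl f x := by rw [P.kernel_map]
    _ ≤ K y x * (f x + (P.refl f x - f x)) := by gcongr; exact le_add_tsub
    _ = K y x * f x + (P.refl f x - f x) * K y x := by ring
    _ ≤ K y x * f x + (P.refl f x - f x) *
        (N * (1 - P.dualWeight x) + (K y x - N * (1 - P.dualWeight x))) := by
        gcongr; exact le_add_tsub
    _ = K y x * f x + N * ((P.refl f x - f x) * (1 - P.dualWeight x)) + (P.refl f x - f x) *
        (K y x - N * (1 - P.dualWeight x)) := by ring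
    _ ≤ _ := by
        gcongr
        exact tsub_le_self.trans (P.refl_le hC hx)

/-- The error term of the previous comparison disappears in the limit. -/
theorem tendsto_setLIntegral_tsub (hK : Measurable (Function.uncurry K)) (y : X) (hy : ∫⁻ x, K y x ∂μ ≠ ∞) :
    Tendsto (fun N : ℕ => ∫⁻ x in P.half, (K y x - N * (1 - P.dualWeight x)) ∂μ) atTop (𝓝 0) := by
  have hKy : Measurable (K y) := hK.of_uncurry_left
  have hd := P.measurable_dualWeight
  have hy' : ∫⁻ x in P.half, K y x ∂μ ≠ ∞ := ((setLIntegral_le_lintegral _ _).trans_lt hy.lt_top).ne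
  rw [← lintegral_zero (μ := μ.restrict P.half)]
  refine tendsto_lintegral_filter_of_dominated_convergence (K y) (Eventually.of_forall fun N => by
    fun_prop) (Eventually.of_forall fun N => Eventually.of_forall fun x => tsub_le_self) hy' ?_
  filter_upwards [ae_lt_top hKy hy', ae_restrict_mem P.measurableSet_half] with x hx hx'
  have hpos : 1 - P.dualWeight x ≠ 0 := (tsub_pos_of_lt (P.dualWeight_lt_one x hx')).ne'
  have h1 : Tendsto (fun N : ℕ => (N : ℝ≥0∞) * (1 - P.dualWeight x)) atTop (𝓝 ∞) := by
    have := ENNReal.Tendsto.mul_const (b := 1 - P.dualWeight x) ENNReal.tendsto_nat_nhds_top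
      (Or.inl ENNReal.top_ne_zero)
    rwa [ENNReal.top_mul hpos] at this
  refine tendsto_const_nhds.congr' ?_
  filter_upwards [h1.eventually (lt_mem_nhds hx)] with N hN
  rw [tsub_eq_zero_of_le hN.le]

end Polarizer

section Abstract

variable {X : Type*} [MeasurableSpace X] {μ : Measure X} {K : X → X → ℝ≥0∞} {p : ℝ}

theorem kernelPotential_le (hK : Measurable (Function.uncurry K)) {S : ℝ≥0∞}
    (hS : ∀ x, ∫⁻ y, K x y ∂μ = S) {f : X → ℝ≥0∞} {C : ℝ≥0∞} (hC : ∀ x, f x ≤ C) (x : X) :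
    kernelPotential μ K f x ≤ S * C := by
  have hKx : Measurable (K x) := hK.of_uncurry_left
  rw [← hS x, ← lintegral_mul_const _ hKx]
  exact lintegral_mono fun y => mul_le_mul_right (hC y) _

theorem lintegral_kernelPotential [SFinite μ] (hK : Measurable (Function.uncurry K))
    (hsymm : ∀ x y, K x y = K y x) {S : ℝ≥0∞} (hS : ∀ x, ∫⁻ y, K x y ∂μ = S) {f : X → ℝ≥0∞}
    (hf : Measurable f) : ∫⁻ x, kernelPotential μ K f x ∂μ = S * ∫⁻ x, f x ∂μ := by
  simp only [kernelPotential]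
  rw [lintegral_lintegral_swap (hK.mul (hf.comp measurable_snd)).aemeasurable,
    ← lintegral_const_mul _ hf]
  refine lintegral_congr fun y => ?_
  have hKy : Measurable (K y) := hK.of_uncurry_left
  simp only [fun x => hsymm x y]
  rw [lintegral_mul_const _ hKy, hS]

theorem lintegral_le_lintegral_rpow [IsProbabilityMeasure μ] (hp : 1 ≤ p) {f : X → ℝ≥0∞}
    (hf : Measurable f) : ∫⁻ x, f x ∂μ ≤ (∫⁻ x, f x ^ p ∂μ) ^ (1 / p) := by
  have h := eLpNorm_le_eLpNorm_of_exponent_le (μ := μ) (p := 1) (q := ENNReal.ofReal p) (f := f)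
    (by simpa using hp) hf.aestronglyMeasurable
  have hp0 : 0 < p := by linarith
  rwa [eLpNorm_one_eq_lintegral_enorm, eLpNorm_eq_lintegral_rpow_enorm_toReal (by simpa using hp0)
    (by simp), ENNReal.toReal_ofReal hp0.le] at h

/-- A sequence along which every polarization gain tends to zero has asymptotically constant
potentials. -/
theorem tendsto_lintegral_potential_tsub [IsProbabilityMeasure μ]
    (hK : Measurable (Function.uncurry K)) {S : ℝ≥0∞} (hS : ∀ x, ∫⁻ y, K x y ∂μ = S) (hStop : S ≠ ∞)
    (hnull : ∀ x, ∀ᵐ y ∂μ, x ≠ y) {C : ℝ≥0∞} (hCtop : C ≠ ∞)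
    (hpol : ∀ x y, x ≠ y → ∀ δ : ℝ≥0∞, δ ≠ 0 → ∃ (P Q : Polarizer μ K p) (N : ℕ),
      ∀ f, Measurable f → (∀ z, f z ≤ C) → kernelPotential μ K f x ≤
        kernelPotential μ K f y + δ + N * (P.gain f + Q.gain f))
    {u : ℕ → X → ℝ≥0∞} (hu : ∀ j, Measurable (u j)) (huC : ∀ j x, u j x ≤ C)
    (hgain : ∀ P : Polarizer μ K p, Tendsto (fun j => P.gain (u j)) atTop (𝓝 0)) :
    Tendsto (fun j => ∫⁻ x, ∫⁻ y, (kernelPotential μ K (u j) x - kernelPotential μ K (u j) y) ∂μ ∂μ)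
      atTop (𝓝 0) := by
  have hm : ∀ j, Measurable (kernelPotential μ K (u j)) := fun j =>
    measurable_kernelPotential hK (hu j)
  have hbound : ∀ j x y, kernelPotential μ K (u j) x - kernelPotential μ K (u j) y ≤ S * C :=
    fun j x y => tsub_le_self.trans (kernelPotential_le hK hS (huC j) x)
  have hSC : S * C ≠ ∞ := ENNReal.mul_ne_top hStop hCtop
  have hpt : ∀ x y, x ≠ y → Tendsto
      (fun j => kernelPotential μ K (u j) x - kernelPotential μ K (u j) y) atTop (𝓝 0) := by
    intro x y hxy
    rw [ENNReal.tendsto_nhds_zero]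
    intro ε hε
    obtain ⟨P, Q, N, h⟩ := hpol x y hxy (ε / 2) (ENNReal.half_pos hε.ne').ne'
    have h1 : Tendsto (fun j => (N : ℝ≥0∞) * (P.gain (u j) + Q.gain (u j))) atTop (𝓝 0) := by
      have := ENNReal.Tendsto.const_mul (a := (N : ℝ≥0∞)) ((hgain P).add (hgain Q))
        (Or.inr (ENNReal.natCast_ne_top N))
      simpa using this
    filter_upwards [ENNReal.tendsto_nhds_zero.1 h1 (ε / 2) (ENNReal.half_pos hε.ne')] with j hj
    rw [tsub_le_iff_left]
    calc _ ≤ _ := h (u j) (hu j) (huC j)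
      _ ≤ kernelPotential μ K (u j) y + ε / 2 + ε / 2 := by gcongr
      _ = _ := by rw [add_assoc, ENNReal.add_halves]
  have hin : ∀ x, Tendsto (fun j => ∫⁻ y, (kernelPotential μ K (u j) x -
      kernelPotential μ K (u j) y) ∂μ) atTop (𝓝 0) := by
    intro x
    rw [← lintegral_zero (μ := μ)]
    refine tendsto_lintegral_filter_of_dominated_convergence (fun _ => S * C)
      (Eventually.of_forall fun j => measurable_const.sub (hm j))
      (Eventually.of_forall fun j => Eventually.of_forall fun y => hbound j x y) (by simpa using hSC)
      ?_
    filter_upwards [hnull x] with y hy using hpt x y hy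
  conv => arg 3; rw [← lintegral_zero (μ := μ)]
  refine tendsto_lintegral_filter_of_dominated_convergence (fun _ => S * C)
    (Eventually.of_forall fun j => ?_)
    (Eventually.of_forall fun j => Eventually.of_forall fun x => ?_) (by simpa using hSC)
    (Eventually.of_forall hin)
  · exact Measurable.lintegral_prod_right' (f := fun z : X × X => kernelPotential μ K (u j) z.1 -
      kernelPotential μ K (u j) z.2) (((hm j).comp measurable_fst).sub ((hm j).comp measurable_snd))
  · exact (lintegral_mono fun y => hbound j x y).trans_eq (by simp)

theorem kernelEnergy_le_add [IsProbabilityMeasure μ]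
    (hK : Measurable (Function.uncurry K)) (hsymm : ∀ x y, K x y = K y x) {S : ℝ≥0∞}
    (hS : ∀ x, ∫⁻ y, K x y ∂μ = S) {f : X → ℝ≥0∞} (hf : Measurable f) {C : ℝ≥0∞}
    (hC : ∀ x, f x ≤ C) :
    kernelEnergy μ K f ≤ S * (∫⁻ x, f x ∂μ) ^ 2 +
      C * ∫⁻ x, ∫⁻ y, (kernelPotential μ K f x - kernelPotential μ K f y) ∂μ ∂μ := by
  have hm : Measurable (kernelPotential μ K f) := measurable_kernelPotential hK hf
  have hm' : Measurable fun x => ∫⁻ y, (kernelPotential μ K f x - kernelPotential μ K f y) ∂μ :=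
    Measurable.lintegral_prod_right' (f := fun z : X × X => kernelPotential μ K f z.1 -
      kernelPotential μ K f z.2) ((hm.comp measurable_fst).sub (hm.comp measurable_snd))
  calc kernelEnergy μ K f
      ≤ ∫⁻ x, (f x * (∫⁻ y, kernelPotential μ K f y ∂μ) +
          C * ∫⁻ y, (kernelPotential μ K f x - kernelPotential μ K f y) ∂μ) ∂μ := by
        refine lintegral_mono fun x => ?_
        calc f x * kernelPotential μ K f x = f x * ∫⁻ _, kernelPotential μ K f x ∂μ := by simp
          _ ≤ f x * ∫⁻ y, (kernelPotential μ K f y +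
              (kernelPotential μ K f x - kernelPotential μ K f y)) ∂μ := by
            gcongr with y
            exact le_add_tsub
          _ ≤ _ := by
            rw [lintegral_add_left hm, mul_add]
            gcongr
            exact hC x
    _ = _ := by
        rw [lintegral_add_left (by fun_prop), lintegral_mul_const _ hf, lintegral_const_mul _ hm',
          lintegral_kernelPotential hK hsymm hS hf]
        ring

theorem kernelEnergy_le_of_bounded [IsProbabilityMeasure μ]
    (hK : Measurable (Function.uncurry K)) (hsymm : ∀ x y, K x y = K y x) {S : ℝ≥0∞}
    (hS : ∀ x, ∫⁻ y, K x y ∂μ = S) (hStop : S ≠ ∞) (hp : 1 ≤ p)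
    (hnull : ∀ x, ∀ᵐ y ∂μ, x ≠ y) {C : ℝ≥0∞} (hCtop : C ≠ ∞)
    (hpol : ∀ x y, x ≠ y → ∀ δ : ℝ≥0∞, δ ≠ 0 → ∃ (P Q : Polarizer μ K p) (N : ℕ),
      ∀ f, Measurable f → (∀ z, f z ≤ C) → kernelPotential μ K f x ≤
        kernelPotential μ K f y + δ + N * (P.gain f + Q.gain f))
    {f : X → ℝ≥0∞} (hf : Measurable f) (hC : ∀ x, f x ≤ C) :
    kernelEnergy μ K f ≤ S * (∫⁻ x, f x ^ p ∂μ) ^ (2 / p) := by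
  have hp0 : 0 < p := by linarith
  set B := ∫⁻ x, f x ^ p ∂μ with hB
  have hBtop : B ^ (1 / p) ≠ ∞ := by
    refine ENNReal.rpow_ne_top_of_nonneg (by positivity) (ne_top_of_le_ne_top (b := C ^ p)
      (ENNReal.rpow_ne_top_of_nonneg hp0.le hCtop) ?_)
    calc B ≤ ∫⁻ _, C ^ p ∂μ := lintegral_mono fun x => ENNReal.rpow_le_rpow (hC x) hp0.le
      _ = C ^ p := by simp
  have hBsq : B ^ (2 / p) = (B ^ (1 / p)) ^ 2 := by
    rw [← ENNReal.rpow_natCast, ← ENNReal.rpow_mul]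
    congr 1
    push_cast
    ring
  have main : ∀ ε : ℝ≥0∞, ε ≠ 0 → ε ≠ ∞ →
      kernelEnergy μ K f ≤ S * B ^ (2 / p) + ε * B ^ (1 / p) := by
    intro ε hε hεtop
    set A : Set (X → ℝ≥0∞) := {g | Measurable g ∧ (∀ x, g x ≤ C) ∧ ∫⁻ x, g x ^ p ∂μ ≤ B} with hA
    set Φ : (X → ℝ≥0∞) → ℝ≥0∞ := fun g => kernelEnergy μ K g + ε * ∫⁻ x, g x ∂μ with hΦ
    have hfA : f ∈ A := ⟨hf, hC, le_rfl⟩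
    obtain ⟨v, -, hv, hvA⟩ := exists_seq_tendsto_sSup (S := Φ '' A) ⟨_, f, hfA, rfl⟩ (OrderTop.bddAbove _)
    choose u huA huv using hvA
    set m := sSup (Φ '' A)
    have hle : ∀ g ∈ A, Φ g ≤ m := fun g hg => le_sSup ⟨g, hg, rfl⟩
    have hΦtop : ∀ g ∈ A, Φ g ≤ C * (S * C) + ε * C := by
      intro g hg
      refine add_le_add ?_ (mul_le_mul_right ?_ _)
      · calc kernelEnergy μ K g ≤ ∫⁻ _, C * (S * C) ∂μ :=
            lintegral_mono fun x => mul_le_mul' (hg.2.1 x) (kernelPotential_le hK hS hg.2.1 x)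
          _ = _ := by simp
      · exact (lintegral_mono hg.2.1).trans_eq (by simp)
    have hmtop : m ≠ ∞ := by
      refine ne_top_of_le_ne_top (b := C * (S * C) + ε * C) ?_ (sSup_le ?_)
      · finiteness
      · rintro _ ⟨g, hg, rfl⟩
        exact hΦtop g hg
    have hgain : ∀ P : Polarizer μ K p, Tendsto (fun j => P.gain (u j)) atTop (𝓝 0) := by
      intro P
      have h1 : ∀ j, P.gain (u j) ≤ ε⁻¹ * (m - v j) := by
        intro j
        obtain ⟨hm, hc, hb⟩ := huA j
        have h2 : v j + ε * P.gain (u j) ≤ m := by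
          rw [← huv j]
          refine le_trans ?_ (hle (P.polarize (u j)) ⟨P.measurable_polarize hm, P.polarize_le hc,
            (P.lintegral_polarize_rpow hm hp0.le).trans_le hb⟩)
          simp only [hΦ]
          rw [add_assoc, ← mul_add]
          gcongr
          · exact P.kernelEnergy_le_polarize hK hm
          · exact P.lintegral_add_gain_le hm fun x => ne_top_of_le_ne_top hCtop (hc x)
        have h3 : ε * P.gain (u j) ≤ m - v j := by
          refine ENNReal.le_sub_of_add_le_left (ne_top_of_le_ne_top hmtop ?_) h2
          exact le_self_add.trans h2
        calc P.gain (u j) = ε⁻¹ * (ε * P.gain (u j)) := by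
              rw [← mul_assoc, ENNReal.inv_mul_cancel hε hεtop, one_mul]
          _ ≤ _ := by gcongr
      have h4 : Tendsto (fun j => ε⁻¹ * (m - v j)) atTop (𝓝 0) := by
        have h5 : Tendsto (fun j => m - v j) atTop (𝓝 (m - m)) :=
          ENNReal.Tendsto.sub tendsto_const_nhds hv (Or.inl hmtop)
        have := ENNReal.Tendsto.const_mul h5 (Or.inr (ENNReal.inv_ne_top.2 hε))
        simpa using this
      exact tendsto_of_tendsto_of_tendsto_of_le_of_le tendsto_const_nhds h4 (fun _ => zero_le) h1
    have hlim := tendsto_lintegral_potential_tsub hK hS hStop hnull hCtop hpol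
      (fun j => (huA j).1) (fun j => (huA j).2.1) hgain
    have hbd : ∀ j, v j ≤ S * B ^ (2 / p) + C * (∫⁻ x, ∫⁻ y, (kernelPotential μ K (u j) x -
        kernelPotential μ K (u j) y) ∂μ ∂μ) + ε * B ^ (1 / p) := by
      intro j
      obtain ⟨hm, hc, hb⟩ := huA j
      have h6 : ∫⁻ x, u j x ∂μ ≤ B ^ (1 / p) :=
        (lintegral_le_lintegral_rpow hp hm).trans (ENNReal.rpow_le_rpow hb (by positivity))
      rw [← huv j, hBsq]
      refine add_le_add ((kernelEnergy_le_add hK hsymm hS hm hc).trans ?_) (by gcongr)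
      gcongr
    have hlim' : Tendsto (fun j => S * B ^ (2 / p) + C * (∫⁻ x, ∫⁻ y, (kernelPotential μ K (u j) x -
        kernelPotential μ K (u j) y) ∂μ ∂μ) + ε * B ^ (1 / p)) atTop
        (𝓝 (S * B ^ (2 / p) + C * 0 + ε * B ^ (1 / p))) :=
      (tendsto_const_nhds.add (ENNReal.Tendsto.const_mul hlim (Or.inr hCtop))).add tendsto_const_nhds
    rw [mul_zero, add_zero] at hlim'
    exact (le_self_add.trans (hle f hfA)).trans (le_of_tendsto_of_tendsto' hv hlim' hbd)
  have hε : Tendsto (fun j : ℕ => S * B ^ (2 / p) + (j : ℝ≥0∞)⁻¹ * B ^ (1 / p)) atTop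
      (𝓝 (S * B ^ (2 / p) + 0 * B ^ (1 / p))) :=
    tendsto_const_nhds.add (ENNReal.Tendsto.mul_const ENNReal.tendsto_inv_nat_nhds_zero
      (Or.inr hBtop))
  rw [zero_mul, add_zero] at hε
  refine ge_of_tendsto hε ?_
  filter_upwards [eventually_gt_atTop 0] with j hj
  exact main _ (by simp) (by simp [hj.ne'])

theorem kernelEnergy_le_of_polarizers [IsProbabilityMeasure μ]
    (hK : Measurable (Function.uncurry K)) (hsymm : ∀ x y, K x y = K y x) {S : ℝ≥0∞}
    (hS : ∀ x, ∫⁻ y, K x y ∂μ = S) (hStop : S ≠ ∞) (hp : 1 ≤ p)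
    (hnull : ∀ x, ∀ᵐ y ∂μ, x ≠ y)
    (hpol : ∀ C : ℝ≥0∞, C ≠ ∞ → ∀ x y, x ≠ y → ∀ δ : ℝ≥0∞, δ ≠ 0 →
      ∃ (P Q : Polarizer μ K p) (N : ℕ),
        ∀ f, Measurable f → (∀ z, f z ≤ C) → kernelPotential μ K f x ≤
          kernelPotential μ K f y + δ + N * (P.gain f + Q.gain f))
    {f : X → ℝ≥0∞} (hf : Measurable f) (hftop : ∀ x, f x ≠ ∞) :
    kernelEnergy μ K f ≤ S * (∫⁻ x, f x ^ p ∂μ) ^ (2 / p) := by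
  set g : ℕ → X → ℝ≥0∞ := fun N x => min (f x) N with hg
  have hgm : ∀ N, Measurable (g N) := fun N => hf.min measurable_const
  have hmono : ∀ x, Monotone fun N => g N x := fun x a b hab =>
    min_le_min_left _ (by exact_mod_cast hab)
  have hev : ∀ x, ∀ᶠ N in atTop, f x = g N x := by
    intro x
    obtain ⟨k, hk⟩ := ENNReal.exists_nat_gt (hftop x)
    filter_upwards [eventually_ge_atTop k] with N hN
    exact (min_eq_left (hk.le.trans (by exact_mod_cast hN))).symm
  have hpotmono : ∀ x, Monotone fun N => kernelPotential μ K (g N) x := fun x a b hab =>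
    lintegral_mono fun y => mul_le_mul_right (hmono y hab) _
  have hpotlim : ∀ x, Tendsto (fun N => kernelPotential μ K (g N) x) atTop
      (𝓝 (kernelPotential μ K f x)) := by
    intro x
    have hKx : Measurable (K x) := hK.of_uncurry_left
    refine lintegral_tendsto_of_tendsto_of_monotone (fun N => (hKx.mul (hgm N)).aemeasurable)
      (Eventually.of_forall fun y a b hab => mul_le_mul_right (hmono y hab) _)
      (Eventually.of_forall fun y => tendsto_const_nhds.congr' ?_)
    filter_upwards [hev y] with N hN
    rw [hN]
  have henergy : Tendsto (fun N => kernelEnergy μ K (g N)) atTop (𝓝 (kernelEnergy μ K f)) := by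
    refine lintegral_tendsto_of_tendsto_of_monotone
      (fun N => ((hgm N).mul (measurable_kernelPotential hK (hgm N))).aemeasurable)
      (Eventually.of_forall fun x a b hab => mul_le_mul' (hmono x hab) (hpotmono x hab))
      (Eventually.of_forall fun x => ?_)
    refine (ENNReal.Tendsto.const_mul (hpotlim x) (Or.inr (hftop x))).congr' ?_
    filter_upwards [hev x] with N hN
    rw [← hN]
  refine le_of_tendsto' henergy fun N => ?_
  have hN : ((N : ℕ) : ℝ≥0∞) ≠ ∞ := ENNReal.natCast_ne_top N
  refine (kernelEnergy_le_of_bounded hK hsymm hS hStop hp hnull hN (hpol N hN) (hgm N)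
    fun x => min_le_right _ _).trans ?_
  have hp0 : 0 < p := by linarith
  gcongr
  exact min_le_left _ _

end Abstract

/-- Two polarizers whose involutions both map `y` to `x` and whose half-spaces almost cover the space
without overlap compare the potentials at `x` and `y`. -/
theorem Polarizer.mul_kernelPotential_le {X : Type*} [MeasurableSpace X] {μ : Measure X}
    {K : X → X → ℝ≥0∞} {p : ℝ} (P Q : Polarizer μ K p) (hK : Measurable (Function.uncurry K))
    {f : X → ℝ≥0∞} (hf : Measurable f) {C : ℝ≥0∞} (hC : ∀ x, f x ≤ C) (N : ℝ≥0∞) {x y : X}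
    {t : ℝ≥0∞} (hP : P.map y = x) (hQ : Q.map y = x) (htP : t ≤ P.dualWeight y)
    (htQ : t ≤ Q.dualWeight y) (ht : t ≤ 1) {G : Set X}
    (hG : ∀ z, z ∉ G → P.map z ∈ P.half ∨ Q.map z ∈ Q.half) :
    t * kernelPotential μ K f x ≤ kernelPotential μ K f y +
      C * (∫⁻ z in G, K x z ∂μ + ∫⁻ z in G, K y z ∂μ) + N * (P.gain f + Q.gain f) +
      C * (∫⁻ z in P.half, (K y z - N * (1 - P.dualWeight z)) ∂μ +
        ∫⁻ z in Q.half, (K y z - N * (1 - Q.dualWeight z)) ∂μ) := by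
  have hKy : ∀ z, Measurable (K z) := fun z => hK.of_uncurry_left
  have hset : ∀ (z : X) (s : Set X), ∫⁻ w in s, K z w * f w ∂μ ≤ C * ∫⁻ w in s, K z w ∂μ := by
    intro z s
    rw [← lintegral_const_mul _ (hKy z)]
    refine lintegral_mono fun w => ?_
    rw [mul_comm]
    exact mul_le_mul_left (hC w) _
  have h1 : kernelPotential μ K f x ≤ ∫⁻ w in P.map ⁻¹' P.half, K x w * f w ∂μ +
      ∫⁻ w in Q.map ⁻¹' Q.half, K x w * f w ∂μ + ∫⁻ w in G, K x w * f w ∂μ := by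
    have huniv : P.map ⁻¹' P.half ∪ Q.map ⁻¹' Q.half ∪ G = univ := by
      refine eq_univ_of_forall fun z => ?_
      by_cases hz : z ∈ G
      · exact Or.inr hz
      · exact Or.inl (hG z hz)
    rw [kernelPotential, ← setLIntegral_univ, ← huniv]
    exact (lintegral_union_le _ _ _).trans (by gcongr; exact lintegral_union_le _ _ _)
  have h2 : ∫⁻ w in P.half, K y w * f w ∂μ + ∫⁻ w in Q.half, K y w * f w ∂μ ≤
      kernelPotential μ K f y + ∫⁻ w in G, K y w * f w ∂μ := by
    have hsub : P.half ∩ Q.half ⊆ G := by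
      rintro z ⟨hz, hz'⟩
      by_contra hzG
      rcases hG z hzG with h | h
      · exact P.map_notMem z hz h
      · exact Q.map_notMem z hz' h
    have hm : Measurable fun w => K y w * f w := (hKy y).mul hf
    calc _ ≤ ∫⁻ w, (K y w * f w + (P.half ∩ Q.half).indicator (fun w => K y w * f w) w) ∂μ := by
          rw [← lintegral_indicator P.measurableSet_half, ← lintegral_indicator Q.measurableSet_half,
            ← lintegral_add_left (hm.indicator P.measurableSet_half)]
          refine lintegral_mono fun w => ?_
          by_cases hw : w ∈ P.half <;> by_cases hw' : w ∈ Q.half <;> simp [hw, hw']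
      _ = kernelPotential μ K f y + ∫⁻ w in P.half ∩ Q.half, K y w * f w ∂μ := by
          rw [lintegral_add_left hm, lintegral_indicator
            (P.measurableSet_half.inter Q.measurableSet_half), kernelPotential]
      _ ≤ _ := by gcongr
  have hP1 := P.dualWeight_mul_setLIntegral_le hK hf hC N y
  have hQ1 := Q.dualWeight_mul_setLIntegral_le hK hf hC N y
  rw [hP] at hP1
  rw [hQ] at hQ1
  calc t * kernelPotential μ K f x
      ≤ t * (∫⁻ w in P.map ⁻¹' P.half, K x w * f w ∂μ +
        ∫⁻ w in Q.map ⁻¹' Q.half, K x w * f w ∂μ + ∫⁻ w in G, K x w * f w ∂μ) := by gcongr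
    _ = t * ∫⁻ w in P.map ⁻¹' P.half, K x w * f w ∂μ +
        t * ∫⁻ w in Q.map ⁻¹' Q.half, K x w * f w ∂μ + t * ∫⁻ w in G, K x w * f w ∂μ := by ring
    _ ≤ P.dualWeight y * ∫⁻ w in P.map ⁻¹' P.half, K x w * f w ∂μ +
        Q.dualWeight y * ∫⁻ w in Q.map ⁻¹' Q.half, K x w * f w ∂μ +
        1 * (C * ∫⁻ w in G, K x w ∂μ) := by
        gcongr
        exact hset x G
    _ ≤ _ := add_le_add (add_le_add hP1 hQ1) le_rfl
    _ = (∫⁻ w in P.half, K y w * f w ∂μ + ∫⁻ w in Q.half, K y w * f w ∂μ) +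
        C * ∫⁻ w in G, K x w ∂μ + N * (P.gain f + Q.gain f) +
        C * (∫⁻ z in P.half, (K y z - N * (1 - P.dualWeight z)) ∂μ +
        ∫⁻ z in Q.half, (K y z - N * (1 - Q.dualWeight z)) ∂μ) := by ring
    _ ≤ (kernelPotential μ K f y + C * ∫⁻ w in G, K y w ∂μ) +
        C * ∫⁻ w in G, K x w ∂μ + N * (P.gain f + Q.gain f) +
        C * (∫⁻ z in P.half, (K y z - N * (1 - P.dualWeight z)) ∂μ +
        ∫⁻ z in Q.half, (K y z - N * (1 - Q.dualWeight z)) ∂μ) := by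
        exact add_le_add_left (add_le_add_left (add_le_add_left
          (h2.trans (add_le_add_right (hset y G) _)) _) _) _
    _ = _ := by ring

section Chordal

variable {E : Type*} [NormedAddCommGroup E]

/-- The Riesz kernel of the chordal distance on the unit sphere, infinite on the diagonal. -/
def chordalKernel (ν : ℝ) (ξ η : Metric.sphere (0 : E) 1) : ℝ≥0∞ :=
  ENNReal.ofReal (‖(ξ : E) - η‖ ^ 2) ^ (-ν)

theorem chordalKernel_comm (ν : ℝ) (ξ η : Metric.sphere (0 : E) 1) :
    chordalKernel ν ξ η = chordalKernel ν η ξ := by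
  rw [chordalKernel, norm_sub_rev, chordalKernel]

theorem measurable_chordalKernel [MeasurableSpace E] [BorelSpace E] [SecondCountableTopology E]
    (ν : ℝ) : Measurable (Function.uncurry (chordalKernel (E := E) ν)) := by
  have : Continuous fun z : Metric.sphere (0 : E) 1 × Metric.sphere (0 : E) 1 =>
    ‖(z.1 : E) - z.2‖ ^ 2 := by fun_prop
  exact (ENNReal.measurable_ofReal.comp this.measurable).pow_const _

theorem ENNReal.ofReal_rpow_mul_ofReal_rpow {c : ℝ} (hc : 0 < c) (t z : ℝ) :
    ENNReal.ofReal c ^ z * ENNReal.ofReal t ^ z = ENNReal.ofReal (c * t) ^ z := by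
  rw [ENNReal.ofReal_mul hc.le, ENNReal.mul_rpow_eq_ite, if_neg]
  simp

theorem ENNReal.rpow_neg_anti {s t : ℝ≥0∞} (h : s ≤ t) {z : ℝ} (hz : 0 ≤ z) :
    t ^ (-z) ≤ s ^ (-z) := by
  rw [ENNReal.rpow_neg, ENNReal.rpow_neg, ENNReal.inv_le_inv]
  exact ENNReal.rpow_le_rpow h hz

namespace CapReflection

variable [InnerProductSpace ℝ E] (R : CapReflection E)

theorem mirror_chordalKernel (ν : ℝ) (ξ η : Metric.sphere (0 : E) 1) :
    ENNReal.ofReal (R.factor η) ^ (-ν) * chordalKernel ν ξ (R.onSphere η) =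
      ENNReal.ofReal (‖(ξ : E) - η‖ ^ 2 +
        (R.factor ξ - 1) * (R.factor η - 1) / R.height ^ 2) ^ (-ν) := by
  rw [chordalKernel, ENNReal.ofReal_rpow_mul_ofReal_rpow (R.factor_pos η), mul_comm,
    R.norm_sub_onSphere_sq]

theorem onSphere_eq_self {ξ : Metric.sphere (0 : E) 1} (h : R.factor ξ = 1) : R.onSphere ξ = ξ := by
  have h1 := R.factor_eq ξ
  have h2 : ⟪(ξ : E), R.vec⟫ - R.height = 0 := by
    have := R.height_pos
    rw [h] at h1
    have h3 : (2 * R.height) * (⟪(ξ : E), R.vec⟫ - R.height) = 0 := by linarith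
    exact (mul_eq_zero.1 h3).resolve_left (by positivity)
  ext1
  rw [R.coe_onSphere, h, coneMap, norm_eq_of_mem_sphere, mul_one, h2]
  simp

variable [FiniteDimensional ℝ E] [MeasurableSpace E] [BorelSpace E]

/-- The polarizer of the chordal Riesz kernel given by the inversion in a spherical cap; mass is
moved to the complement of the cap. -/
def polarizer {n : ℕ} (hn : 1 ≤ n) (hE : Module.finrank ℝ E = n + 1) {ν p : ℝ} (hν : 0 < ν)
    (hνn : ν < n) (hp : (n - ν) * p = n) (c : ℝ≥0∞) :
    Polarizer (c • (volume : Measure E).toSphere) (chordalKernel ν) p where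
  map := R.onSphere
  weight ξ := ENNReal.ofReal (R.factor ξ) ^ (-(n - ν))
  dualWeight ξ := ENNReal.ofReal (R.factor ξ) ^ (-ν)
  half := {ξ | 1 < R.factor ξ}
  measurable_map := R.continuous_onSphere.measurable
  measurable_weight := (ENNReal.measurable_ofReal.comp R.continuous_factor.measurable).pow_const _
  measurable_dualWeight :=
    (ENNReal.measurable_ofReal.comp R.continuous_factor.measurable).pow_const _
  measurableSet_half := measurableSet_lt measurable_const R.continuous_factor.measurable
  map_map := R.onSphere_onSphere
  weight_mul_weight_map ξ := by
    rw [ENNReal.ofReal_rpow_mul_ofReal_rpow (R.factor_pos ξ), R.factor_onSphere,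
      mul_inv_cancel₀ (R.factor_pos ξ).ne']
    simp
  weight_rpow ξ := by
    rw [← ENNReal.rpow_mul, ← ENNReal.rpow_add _ _ (by simpa using R.factor_pos ξ) (by simp)]
    congr 1
    linarith
  lintegral_map F hF := by
    simp only [lintegral_smul_measure]
    rw [← R.lintegral_onSphere hn hE hF]
    congr 1
    refine lintegral_congr fun ξ => ?_
    rw [← ENNReal.rpow_add _ _ (by simpa using R.factor_pos ξ) (by simp),
      ENNReal.ofReal_rpow_of_pos (R.factor_pos ξ)]
    congr 4
    ring
  kernel_map ξ η := by
    have h1 := R.factor_pos ξ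
    have h2 := R.factor_pos η
    rw [chordalKernel, R.norm_onSphere_sub_sq, mul_assoc, ENNReal.ofReal_rpow_mul_ofReal_rpow h2,
      ENNReal.ofReal_rpow_mul_ofReal_rpow h1, chordalKernel]
    congr 2
    field_simp
  kernel_mirror_comm ξ η := by
    rw [chordalKernel_comm ν (R.onSphere ξ), R.mirror_chordalKernel, R.mirror_chordalKernel,
      norm_sub_rev, mul_comm (R.factor ξ - 1)]
  mirror_le ξ η h := by
    rw [R.mirror_chordalKernel]
    refine ENNReal.rpow_neg_anti (ENNReal.ofReal_le_ofReal (le_add_of_nonneg_right ?_)) hν.le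
    simp only [mem_ofPred_eq] at h
    by_cases h1 : 1 < R.factor ξ
    · exact div_nonneg (mul_nonneg (by linarith) (by linarith [h.1 h1])) (sq_nonneg _)
    · have h2 : ¬ 1 < R.factor η := fun h2 => h1 (h.2 h2)
      push Not at h1 h2
      exact div_nonneg (mul_nonneg_of_nonpos_of_nonpos (by linarith) (by linarith)) (sq_nonneg _)
  le_mirror ξ η h := by
    rw [R.mirror_chordalKernel]
    refine ENNReal.rpow_neg_anti (ENNReal.ofReal_le_ofReal (add_le_of_nonpos_right ?_)) hν.le
    simp only [mem_ofPred_eq] at h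
    by_cases h1 : 1 < R.factor ξ
    · have h2 : ¬ 1 < R.factor η := fun h2 => h (by tauto)
      push Not at h2
      exact div_nonpos_of_nonpos_of_nonneg
        (mul_nonpos_of_nonneg_of_nonpos (by linarith) (by linarith)) (sq_nonneg _)
    · have h2 : 1 < R.factor η := by tauto
      push Not at h1
      exact div_nonpos_of_nonpos_of_nonneg
        (mul_nonpos_of_nonpos_of_nonneg (by linarith) (by linarith)) (sq_nonneg _)
  map_notMem ξ h := by
    simp only [mem_ofPred_eq, R.factor_onSphere, not_lt] at h ⊢
    exact inv_le_one_of_one_le₀ h.le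
  map_eq_of_notMem ξ h h' := by
    have h1 : R.factor ξ = 1 := by
      simp only [mem_ofPred_eq, R.factor_onSphere, not_lt] at h h'
      exact le_antisymm h ((inv_le_one₀ (R.factor_pos ξ)).1 h')
    exact ⟨R.onSphere_eq_self h1, by simp [h1]⟩
  weight_le_one ξ h := ENNReal.rpow_le_one_of_one_le_of_neg
    (by simpa using (show 1 < R.factor ξ from h).le) (by linarith)
  dualWeight_lt_one ξ h := ENNReal.rpow_lt_one_of_one_lt_of_neg
    (by simpa using (show 1 < R.factor ξ from h)) (by linarith)

end CapReflection

end Chordal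

section Swap

variable {E : Type*} [NormedAddCommGroup E]

theorem norm_coe_sub_pos {x y : Metric.sphere (0 : E) 1} (hxy : x ≠ y) : 0 < ‖(x : E) - y‖ :=
  norm_pos_iff.2 (sub_ne_zero.2 fun h => hxy (Subtype.ext h))

variable [InnerProductSpace ℝ E]

namespace CapReflection

variable {x y : Metric.sphere (0 : E) 1} (hxy : x ≠ y) {κ : ℝ} (hκ : 1 < κ)

/-- The inversion in a cap around `x` which exchanges `x` and `y`, with conformal factor `κ ^ 2`
at `y`. -/
def swap : CapReflection E where
  vec := ‖(x : E) - y‖⁻¹ • (κ • (x : E) - κ⁻¹ • (y : E))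
  height := ‖(x : E) - y‖⁻¹ * (κ - κ⁻¹)
  height_pos := mul_pos (inv_pos.2 (norm_coe_sub_pos hxy))
    (sub_pos.2 ((inv_lt_one_of_one_lt₀ hκ).trans hκ))
  norm_vec_sq := by
    have hd := norm_coe_sub_pos hxy
    have hκ0 : κ ≠ 0 := by positivity
    have h := norm_sub_sq_of_sphere x y
    rw [norm_smul, mul_pow, norm_sub_sq_real, norm_smul, norm_smul, norm_eq_of_mem_sphere,
      norm_eq_of_mem_sphere, inner_smul_left, inner_smul_right, norm_inv, norm_norm, mul_pow]
    simp only [mul_one, norm_inv, Real.norm_eq_abs, inv_pow, sq_abs, RCLike.conj_to_real]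
    generalize ‖(x : E) - y‖ = d at *
    field_simp
    linear_combination -κ ^ 2 * h

theorem inner_swap_vec_sub (z : E) : ⟪z, (swap hxy hκ).vec⟫ - (swap hxy hκ).height =
    ‖(x : E) - y‖⁻¹ * (κ * ⟪z, (x : E)⟫ - κ⁻¹ * ⟪z, (y : E)⟫ - (κ - κ⁻¹)) := by
  simp only [swap, inner_smul_right, inner_sub_right]
  ring

theorem inner_swap_vec_sub_self : ⟪(y : E), (swap hxy hκ).vec⟫ - (swap hxy hκ).height =
    -(κ * ‖(x : E) - y‖ / 2) := by
  have hd := norm_coe_sub_pos hxy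
  have h := norm_sub_sq_of_sphere x y
  rw [inner_swap_vec_sub, real_inner_self_eq_norm_sq, norm_eq_of_mem_sphere, real_inner_comm]
  generalize ‖(x : E) - y‖ = d at *
  field_simp
  linear_combination κ ^ 2 * h

theorem factor_swap : (swap hxy hκ).factor y = κ ^ 2 := by
  have hd := norm_coe_sub_pos hxy
  rw [factor_eq, inner_swap_vec_sub_self]
  simp only [swap]
  field_simp
  ring

theorem onSphere_swap : (swap hxy hκ).onSphere y = x := by
  have hd := norm_coe_sub_pos hxy
  ext1
  rw [coe_onSphere, factor_swap, coneMap, norm_eq_of_mem_sphere, mul_one, inner_swap_vec_sub_self]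
  have hκ0 : κ ≠ 0 := by positivity
  have h1 : (y : E) - (2 * -(κ * ‖(x : E) - y‖ / 2)) • (swap hxy hκ).vec = κ ^ 2 • (x : E) := by
    simp only [swap]
    rw [smul_smul, show 2 * -(κ * ‖(x : E) - y‖ / 2) * ‖(x : E) - y‖⁻¹ = -κ by field_simp, smul_sub,
      smul_smul, smul_smul, neg_mul κ κ⁻¹, mul_inv_cancel₀ hκ0]
    module
  rw [h1, inv_smul_smul₀ (by positivity)]

theorem factor_lt_one_iff (R : CapReflection E) (ξ : Metric.sphere (0 : E) 1) :
    R.factor ξ < 1 ↔ 0 < ⟪(ξ : E), R.vec⟫ - R.height := by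
  rw [R.factor_eq, sub_lt_self_iff, mul_pos_iff_of_pos_left (by linarith [R.height_pos])]

end CapReflection

/-- The part of the sphere covered by neither of the caps of `swap x y κ` and `swap y x κ`. -/
def capGap (x y : Metric.sphere (0 : E) 1) (κ : ℝ) : Set (Metric.sphere (0 : E) 1) :=
  {ξ | κ * ⟪(ξ : E), (x : E)⟫ - κ⁻¹ * ⟪(ξ : E), (y : E)⟫ ≤ κ - κ⁻¹ ∧
    κ * ⟪(ξ : E), (y : E)⟫ - κ⁻¹ * ⟪(ξ : E), (x : E)⟫ ≤ κ - κ⁻¹}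

theorem eventually_notMem_capGap {x y ξ : Metric.sphere (0 : E) 1}
    (h : ⟪(ξ : E), (x : E) - y⟫ ≠ 0) : ∀ᶠ κ in 𝓝[>] (1 : ℝ), ξ ∉ capGap x y κ := by
  have key : ∀ a b : ℝ, b < a → ∀ᶠ κ in 𝓝[>] (1 : ℝ), κ - κ⁻¹ < κ * a - κ⁻¹ * b := by
    intro a b hab
    have h1 : ContinuousAt (fun κ : ℝ => κ * a - κ⁻¹ * b - (κ - κ⁻¹)) 1 := by
      have : ContinuousAt (fun κ : ℝ => κ⁻¹) 1 := continuousAt_inv₀ one_ne_zero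
      fun_prop
    have h2 : ∀ᶠ κ in 𝓝 (1 : ℝ), 0 < κ * a - κ⁻¹ * b - (κ - κ⁻¹) :=
      h1.eventually (lt_mem_nhds (by simpa using hab))
    filter_upwards [nhdsWithin_le_nhds h2] with κ hκ
    linarith
  rw [inner_sub_right, sub_ne_zero] at h
  rcases lt_or_gt_of_ne h with h | h
  · filter_upwards [key _ _ h] with κ hκ hmem
    exact absurd hmem.2 (not_le.2 hκ)
  · filter_upwards [key _ _ h] with κ hκ hmem
    exact absurd hmem.1 (not_le.2 hκ)

variable [FiniteDimensional ℝ E] [MeasurableSpace E] [BorelSpace E]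

theorem measurableSet_capGap (x y : Metric.sphere (0 : E) 1) (κ : ℝ) :
    MeasurableSet (capGap x y κ) := by
  have h : ∀ e : E, Measurable fun ξ : Metric.sphere (0 : E) 1 => ⟪(ξ : E), e⟫ := fun e => by
    fun_prop
  exact (measurableSet_le (((h x).const_mul κ).sub ((h y).const_mul κ⁻¹)) measurable_const).inter
    (measurableSet_le (((h y).const_mul κ).sub ((h x).const_mul κ⁻¹)) measurable_const)

theorem tendsto_setLIntegral_capGap {μ : Measure (Metric.sphere (0 : E) 1)}
    (hμ : μ ≪ (volume : Measure E).toSphere) {x y : Metric.sphere (0 : E) 1} (hxy : x ≠ y)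
    {k : Metric.sphere (0 : E) 1 → ℝ≥0∞} (hk : Measurable k) (hktop : ∫⁻ ξ, k ξ ∂μ ≠ ∞) :
    Tendsto (fun κ => ∫⁻ ξ in capGap x y κ, k ξ ∂μ) (𝓝[>] 1) (𝓝 0) := by
  rw [← lintegral_zero (μ := μ)]
  simp_rw [← lintegral_indicator (measurableSet_capGap x y _)]
  refine tendsto_lintegral_filter_of_dominated_convergence k
    (Eventually.of_forall fun κ => hk.indicator (measurableSet_capGap x y κ))
    (Eventually.of_forall fun κ => Eventually.of_forall fun ξ => indicator_le_self _ _ _) hktop ?_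
  have hd : (x : E) - y ≠ 0 := sub_ne_zero.2 fun h => hxy (Subtype.ext h)
  have hnull : ∀ᵐ ξ : Metric.sphere (0 : E) 1 ∂μ, ⟪(ξ : E), (x : E) - y⟫ ≠ 0 := by
    rw [ae_iff]
    refine hμ ?_
    simpa using toSphere_inner_eq_zero hd
  filter_upwards [hnull] with ξ hξ
  refine tendsto_const_nhds.congr' ?_
  filter_upwards [eventually_notMem_capGap hξ] with κ hκ
  rw [indicator_of_notMem hκ]

theorem exists_polarizers {n : ℕ} (hn : 1 ≤ n) (hE : Module.finrank ℝ E = n + 1) {ν p : ℝ}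
    (hν : 0 < ν) (hνn : ν < n) (hp : (n - ν) * p = n) {c : ℝ≥0∞} {S : ℝ≥0∞} (hStop : S ≠ ∞)
    (hS : ∀ ξ, ∫⁻ η, chordalKernel ν ξ η ∂(c • (volume : Measure E).toSphere) = S)
    {C : ℝ≥0∞} (hC : C ≠ ∞) {x y : Metric.sphere (0 : E) 1} (hxy : x ≠ y) {δ : ℝ≥0∞} (hδ : δ ≠ 0) :
    ∃ (P Q : Polarizer (c • (volume : Measure E).toSphere) (chordalKernel (E := E) ν) p) (N : ℕ),
      ∀ f, Measurable f → (∀ z, f z ≤ C) →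
        kernelPotential (c • (volume : Measure E).toSphere) (chordalKernel ν) f x ≤
          kernelPotential (c • (volume : Measure E).toSphere) (chordalKernel ν) f y + δ +
            N * (P.gain f + Q.gain f) := by
  set μ := c • (volume : Measure E).toSphere with hμ
  have hK := measurable_chordalKernel (E := E) ν
  have hKz : ∀ z, Measurable (chordalKernel (E := E) ν z) := fun z => hK.of_uncurry_left
  have hμ' : μ ≪ (volume : Measure E).toSphere := Measure.smul_absolutelyContinuous
  have hSz : ∀ z, ∫⁻ w, chordalKernel ν z w ∂μ ≠ ∞ := fun z => by rw [hS z]; exact hStop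
  set t : ℝ → ℝ≥0∞ := fun κ => ENNReal.ofReal (κ ^ 2) ^ (-ν) with ht
  have htlim : Tendsto t (𝓝[>] 1) (𝓝 1) := by
    have h1 : ContinuousAt t 1 := by
      have h2 : Continuous fun κ : ℝ => ENNReal.ofReal (κ ^ 2) :=
        ENNReal.continuous_ofReal.comp (by fun_prop)
      exact (ENNReal.continuous_rpow_const.comp h2).continuousAt
    have h3 : t 1 = 1 := by simp [ht]
    rw [← h3]
    exact h1.mono_left nhdsWithin_le_nhds
  have hlim : Tendsto (fun κ => (1 - t κ) * (S * C) + C * (∫⁻ z in capGap x y κ,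
      chordalKernel ν x z ∂μ + ∫⁻ z in capGap x y κ, chordalKernel ν y z ∂μ)) (𝓝[>] 1) (𝓝 0) := by
    have h1 : Tendsto (fun κ => (1 - t κ) * (S * C)) (𝓝[>] 1) (𝓝 ((1 - 1) * (S * C))) :=
      ENNReal.Tendsto.mul_const (ENNReal.Tendsto.sub tendsto_const_nhds htlim (Or.inl (by simp)))
        (Or.inr (ENNReal.mul_ne_top hStop hC))
    have h2 := ENNReal.Tendsto.const_mul (a := C)
      ((tendsto_setLIntegral_capGap hμ' hxy (hKz x) (hSz x)).add
        (tendsto_setLIntegral_capGap hμ' hxy (hKz y) (hSz y))) (Or.inr hC)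
    simpa using h1.add h2
  have hδ2 : 0 < δ / 2 := ENNReal.half_pos hδ
  obtain ⟨κ, hκδ, hκ⟩ := ((ENNReal.tendsto_nhds_zero.1 hlim (δ / 2) hδ2).and
    self_mem_nhdsWithin).exists
  have hκ1 : 1 < κ := hκ
  have hκsq : 1 ≤ κ ^ 2 := one_le_pow₀ hκ1.le
  set R := CapReflection.swap hxy hκ1 with hR
  set R' := CapReflection.swap hxy.symm hκ1 with hR'
  set P := R.polarizer hn hE hν hνn hp c with hPdef
  set Q := R'.polarizer hn hE hν hνn hp c with hQdef
  have hNlim : Tendsto (fun N : ℕ => C * (∫⁻ z in P.half,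
      (chordalKernel ν y z - N * (1 - P.dualWeight z)) ∂μ + ∫⁻ z in Q.half,
      (chordalKernel ν y z - N * (1 - Q.dualWeight z)) ∂μ)) atTop (𝓝 0) := by
    have := ENNReal.Tendsto.const_mul (a := C) ((P.tendsto_setLIntegral_tsub hK y (hSz y)).add
      (Q.tendsto_setLIntegral_tsub hK y (hSz y))) (Or.inr hC)
    rwa [add_zero, mul_zero] at this
  obtain ⟨N, hN⟩ := (ENNReal.tendsto_nhds_zero.1 hNlim (δ / 2) hδ2).exists
  refine ⟨P, Q, N, fun f hf hfC => ?_⟩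
  have hR'y : R'.onSphere y = x := by
    rw [← CapReflection.onSphere_swap hxy.symm hκ1]
    exact R'.onSphere_onSphere x
  have hR'f : R'.factor y = (κ ^ 2)⁻¹ := by
    rw [← CapReflection.factor_swap hxy.symm hκ1, ← R'.factor_onSphere,
      CapReflection.onSphere_swap hxy.symm hκ1]
  have ht1 : t κ ≤ 1 := ENNReal.rpow_le_one_of_one_le_of_neg (by simpa using hκsq) (by linarith)
  have htP : t κ ≤ P.dualWeight y := by
    change _ ≤ ENNReal.ofReal (R.factor y) ^ (-ν)
    rw [hR, CapReflection.factor_swap hxy hκ1]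
  have htQ : t κ ≤ Q.dualWeight y := by
    change _ ≤ ENNReal.ofReal (R'.factor y) ^ (-ν)
    rw [hR'f]
    refine ENNReal.rpow_neg_anti (ENNReal.ofReal_le_ofReal ?_) hν.le
    exact (inv_le_one_of_one_le₀ hκsq).trans hκsq
  have hG : ∀ z, z ∉ capGap x y κ → P.map z ∈ P.half ∨ Q.map z ∈ Q.half := by
    intro z hz
    have hhalf : ∀ T : CapReflection E, 0 < ⟪(z : E), T.vec⟫ - T.height →
        1 < T.factor (T.onSphere z) := by
      intro T hT
      rw [T.factor_onSphere]
      exact one_lt_inv_iff₀.2 ⟨T.factor_pos z, (T.factor_lt_one_iff z).2 hT⟩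
    have hinv : 0 < ‖(x : E) - y‖⁻¹ := inv_pos.2 (norm_coe_sub_pos hxy)
    have hinv' : 0 < ‖(y : E) - x‖⁻¹ := inv_pos.2 (norm_coe_sub_pos hxy.symm)
    rcases not_and_or.1 hz with h | h
    · refine Or.inl (hhalf R ?_)
      rw [CapReflection.inner_swap_vec_sub]
      exact mul_pos hinv (by linarith [not_le.1 h])
    · refine Or.inr (hhalf R' ?_)
      rw [CapReflection.inner_swap_vec_sub]
      exact mul_pos hinv' (by linarith [not_le.1 h])
  have hmain := P.mul_kernelPotential_le Q hK hf hfC N (x := x) (y := y)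
    (CapReflection.onSphere_swap hxy hκ1) hR'y htP htQ ht1 hG
  calc kernelPotential μ (chordalKernel ν) f x
      = (1 - t κ) * kernelPotential μ (chordalKernel ν) f x +
        t κ * kernelPotential μ (chordalKernel ν) f x := by
        rw [← add_mul, tsub_add_cancel_of_le ht1, one_mul]
    _ ≤ (1 - t κ) * (S * C) + _ :=
        add_le_add (mul_le_mul_right (kernelPotential_le hK hS hfC x) _) hmain
    _ = kernelPotential μ (chordalKernel ν) f y + ((1 - t κ) * (S * C) + C *
        (∫⁻ z in capGap x y κ, chordalKernel ν x z ∂μ +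
          ∫⁻ z in capGap x y κ, chordalKernel ν y z ∂μ)) +
        C * (∫⁻ z in P.half, (chordalKernel ν y z - N * (1 - P.dualWeight z)) ∂μ +
          ∫⁻ z in Q.half, (chordalKernel ν y z - N * (1 - Q.dualWeight z)) ∂μ) +
        N * (P.gain f + Q.gain f) := by ring
    _ ≤ kernelPotential μ (chordalKernel ν) f y + δ / 2 + δ / 2 + N * (P.gain f + Q.gain f) := by
        gcongr
    _ = _ := by rw [add_assoc _ (δ / 2) (δ / 2), ENNReal.add_halves]

end Swap

section Main

variable {E : Type*} [NormedAddCommGroup E] [InnerProductSpace ℝ E] [FiniteDimensional ℝ E]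
  [MeasurableSpace E] [BorelSpace E]

theorem ae_toSphere_ne (hE : 1 < Module.finrank ℝ E) (x : Metric.sphere (0 : E) 1) :
    ∀ᵐ y ∂(volume : Measure E).toSphere, x ≠ y := by
  have hx0 : (x : E) ≠ 0 := ne_zero_of_mem_unit_sphere x
  obtain ⟨d, hd, hd0⟩ : ∃ d ∈ (ℝ ∙ (x : E))ᗮ, d ≠ 0 := by
    refine Submodule.exists_mem_ne_zero_of_ne_bot fun h => ?_
    have h1 := Submodule.finrank_add_finrank_orthogonal (ℝ ∙ (x : E))
    rw [h, finrank_bot, finrank_span_singleton hx0] at h1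
    omega
  rw [ae_iff]
  refine measure_mono_null (fun y hy => ?_) (toSphere_inner_eq_zero hd0)
  have hyx : y = x := by simpa using hy
  rw [hyx]
  exact (Submodule.mem_orthogonal_singleton_iff_inner_right).1 hd

theorem toSphere_univ_eq {n : ℕ} (hn : 1 ≤ n) (hE : Module.finrank ℝ E = n + 1) :
    (volume : Measure E).toSphere univ =
      ENNReal.ofReal ((2 * π) ^ (n / 2 : ℝ) * (2 ^ (n / 2 : ℝ) * Gamma (n / 2)) / Gamma n) := by
  have hn' : (0 : ℝ) < n := by exact_mod_cast hn
  have hΓ : 0 < Gamma n := Gamma_pos_of_pos hn'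
  have : Nontrivial E := Module.nontrivial_of_finrank_pos (R := ℝ) (by omega)
  obtain ⟨e, he⟩ := exists_norm_eq E zero_le_one
  have h := lintegral_toSphere_one_sub_inner_rpow hn hE he (ν := 0) (by positivity)
  simp only [neg_zero, rpow_zero, sub_zero, ENNReal.ofReal_one, lintegral_one] at h
  rw [ENNReal.ofReal_div_of_pos hΓ, ENNReal.eq_div_iff (by simpa using hΓ) (by simp), h]

theorem lintegral_chordalKernel_toSphere {n : ℕ} (hn : 1 ≤ n) (hE : Module.finrank ℝ E = n + 1)
    {ν : ℝ} (hν : ν < n / 2) (ξ : Metric.sphere (0 : E) 1) :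
    ∫⁻ η, chordalKernel ν ξ η ∂(volume : Measure E).toSphere =
      ENNReal.ofReal (2 ^ (-ν) * ((2 * π) ^ (n / 2 : ℝ) * (2 ^ (n / 2 - ν : ℝ) * Gamma (n / 2 - ν)) /
        Gamma (n - ν))) := by
  have hn' : (0 : ℝ) < n := by exact_mod_cast hn
  have hΓ : 0 < Gamma (n - ν) := Gamma_pos_of_pos (by linarith)
  have h := lintegral_toSphere_one_sub_inner_rpow hn hE (e := (ξ : E)) (by simp) hν
  rw [ENNReal.ofReal_mul (by positivity), ENNReal.ofReal_div_of_pos hΓ, ← h, mul_comm (ENNReal.ofReal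
    (Gamma _)), ENNReal.mul_div_cancel_right (by simpa using hΓ) (by simp),
    ← lintegral_const_mul _ (by fun_prop)]
  refine lintegral_congr_ae ?_
  filter_upwards [ae_toSphere_ne (by omega) ξ] with η hη
  have hpos := norm_coe_sub_pos hη
  have h1 := CapReflection.norm_sub_sq_of_sphere ξ η
  have h2 : 0 < 1 - ⟪(η : E), (ξ : E)⟫ := by
    rw [real_inner_comm]
    nlinarith [pow_pos hpos 2]
  rw [chordalKernel, h1, real_inner_comm, ENNReal.ofReal_rpow_of_pos (by positivity),
    mul_rpow (by norm_num) h2.le, ENNReal.ofReal_mul (by positivity)]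

end Main

theorem isProbabilityMeasure_sphereProb (n : ℕ) : IsProbabilityMeasure (sphereProb n) := by
  refine ⟨?_⟩
  rw [sphereProb, Measure.smul_apply, smul_eq_mul]
  refine ENNReal.inv_mul_cancel (fun h => ?_) (measure_ne_top _ _)
  rw [Measure.measure_univ_eq_zero] at h
  exact Measure.toSphere_ne_zero _ h

theorem lintegral_chordalKernel_sphereProb {n : ℕ} (hn : 1 ≤ n) {ν : ℝ} (hν : ν < n / 2)
    (ξ : Metric.sphere (0 : EuclideanSpace ℝ (Fin (n + 1))) 1) :
    ∫⁻ η, chordalKernel ν ξ η ∂(sphereProb n) =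
      ENNReal.ofReal (2 ^ (-(2 * ν)) * (Gamma n / Gamma (n / 2)) *
        (Gamma (n / 2 - ν) / Gamma (n - ν))) := by
  have hn' : (0 : ℝ) < n := by exact_mod_cast hn
  have hΓ1 : 0 < Gamma (n - ν) := Gamma_pos_of_pos (by linarith)
  have hΓ2 : 0 < Gamma (n / 2) := Gamma_pos_of_pos (by linarith)
  have hΓ3 : 0 < Gamma n := Gamma_pos_of_pos hn'
  rw [sphereProb, lintegral_smul_measure, lintegral_chordalKernel_toSphere hn (by simp) hν,
    toSphere_univ_eq hn (by simp), smul_eq_mul, ← ENNReal.ofReal_inv_of_pos (by positivity),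
    ← ENNReal.ofReal_mul (by positivity)]
  congr 1
  rw [rpow_sub two_pos, rpow_neg two_pos.le, rpow_neg two_pos.le, two_mul ν, rpow_add two_pos]
  field_simp

theorem chordalKernel_eq_ofReal {E : Type*} [NormedAddCommGroup E] {ξ η : Metric.sphere (0 : E) 1}
    (h : ξ ≠ η) (ν : ℝ) :
    chordalKernel ν ξ η = ENNReal.ofReal (‖(ξ : E) - η‖ ^ (-(2 * ν))) := by
  have hpos := norm_coe_sub_pos h
  rw [chordalKernel, ENNReal.ofReal_rpow_of_pos (by positivity), ← rpow_natCast, ← rpow_mul hpos.le]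
  congr 2
  push_cast
  ring

theorem lintegral_sphereProb_eq_kernelEnergy {n : ℕ} (hn : 1 ≤ n) (ν : ℝ)
    {f : Metric.sphere (0 : EuclideanSpace ℝ (Fin (n + 1))) 1 → ℝ≥0∞} (hf : Measurable f) :
    ∫⁻ ξ, ∫⁻ η, f ξ * ENNReal.ofReal (‖(ξ : EuclideanSpace ℝ (Fin (n + 1))) - η‖ ^ (-(2 * ν))) *
        f η ∂(sphereProb n) ∂(sphereProb n) =
      kernelEnergy (sphereProb n) (chordalKernel ν) f := by
  refine lintegral_congr fun ξ => ?_
  have hK : Measurable (chordalKernel (E := EuclideanSpace ℝ (Fin (n + 1))) ν ξ) :=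
    (measurable_chordalKernel ν).of_uncurry_left
  rw [kernelPotential, ← lintegral_const_mul _ (by fun_prop)]
  refine lintegral_congr_ae ?_
  have hac : sphereProb n ≪ (volume : Measure (EuclideanSpace ℝ (Fin (n + 1)))).toSphere :=
    Measure.smul_absolutelyContinuous
  filter_upwards [hac.ae_le (ae_toSphere_ne (by simp; omega) ξ)] with η hη
  rw [chordalKernel_eq_ofReal hη, mul_assoc]

end Development

/-- **Sharp Hardy–Littlewood–Sobolev inequality on the sphere, bilinear form.**
For `2 < q < ∞`, `p = q/(q−1)` and the normalized measure `dξ` on `S^n`,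
`∫∫ G(ξ)|ξ−η|^{−2n/q} G(η) dξ dη
  ≤ 2^{−2n/q} [Γ(n)/Γ(n/2)] [Γ(n/2−n/q)/Γ(n/p)] (∫ G^p dξ)^{2/p}`,
and this constant is least. -/
theorem stmt19 (n : ℕ) (hn : 1 ≤ n) (q p : ℝ) (hq : 2 < q) (hp : p = q / (q - 1)) :
    IsLeast {C : ℝ≥0∞ |
        ∀ G : Metric.sphere (0 : EuclideanSpace ℝ (Fin (n + 1))) 1 → ℝ,
          Measurable G → (∀ ξ, 0 ≤ G ξ) →
          (∫⁻ ξ, ∫⁻ η, ENNReal.ofReal (G ξ) *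
              ENNReal.ofReal
                (‖(ξ : EuclideanSpace ℝ (Fin (n + 1))) -
                    (η : EuclideanSpace ℝ (Fin (n + 1)))‖ ^ (-(2 * (n : ℝ) / q))) *
              ENNReal.ofReal (G η) ∂(sphereProb n) ∂(sphereProb n)) ≤
            C * (∫⁻ ξ, ENNReal.ofReal (G ξ) ^ p ∂(sphereProb n)) ^ (2 / p)}
      (ENNReal.ofReal
        ((2 : ℝ) ^ (-(2 * (n : ℝ) / q)) * (Real.Gamma (n : ℝ) / Real.Gamma ((n : ℝ) / 2)) *
          (Real.Gamma ((n : ℝ) / 2 - (n : ℝ) / q) / Real.Gamma ((n : ℝ) / p)))) := by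
  have hn' : (0 : ℝ) < n := by exact_mod_cast hn
  have hprob := isProbabilityMeasure_sphereProb n
  have hq1 : 0 < q - 1 := by linarith
  have hν : (0 : ℝ) < n / q := by positivity
  have hν2 : (n : ℝ) / q < n / 2 := by gcongr
  have hνn : (n : ℝ) / q < n := by linarith
  have hp1 : 1 ≤ p := by rw [hp, le_div_iff₀ hq1]; linarith
  have hnp : (n : ℝ) / p = n - n / q := by rw [hp]; field_simp
  have hpν : ((n : ℝ) - n / q) * p = n := by rw [← hnp]; field_simp
  have hS := lintegral_chordalKernel_sphereProb hn hν2
  rw [hnp, mul_div_assoc 2 (n : ℝ) q]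
  set S : ℝ := 2 ^ (-(2 * ((n : ℝ) / q))) * (Gamma n / Gamma (n / 2)) *
    (Gamma (n / 2 - n / q) / Gamma (n - n / q)) with hSdef
  constructor
  · intro G hG _
    have hf : Measurable fun ξ => ENNReal.ofReal (G ξ) := hG.ennreal_ofReal
    rw [lintegral_sphereProb_eq_kernelEnergy hn _ hf]
    refine kernelEnergy_le_of_polarizers (measurable_chordalKernel _) (chordalKernel_comm _) hS
      ENNReal.ofReal_ne_top hp1 (fun x => ?_) (fun C hC x y hxy δ hδ => ?_) hf
      fun _ => ENNReal.ofReal_ne_top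
    · exact (Measure.smul_absolutelyContinuous (μ := (volume : Measure _).toSphere)).ae_le
        (ae_toSphere_ne (by simp; omega) x)
    · exact exists_polarizers hn (by simp) hν hνn hpν ENNReal.ofReal_ne_top hS hC hxy hδ
  · intro C hC
    have h := hC (fun _ => 1) measurable_const fun _ => zero_le_one
    rw [lintegral_sphereProb_eq_kernelEnergy hn _ measurable_const] at h
    simpa [kernelEnergy, kernelPotential, hS] using h
end
end
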